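/- Let X = D⟨c⟩ with D = ⟨a,b⟩ ≅ D_{2n} dihedral, ⟨c⟩ cyclic of order m ≥ 2, D ∩ ⟨c⟩ = 1, and let M be the largest subgroup of X with ⟨c⟩ ≤ M ⊆ ⟨a⟩⟨c⟩ (as a subset). Then M = ⟨a^i⟩⟨c⟩ for some i ∈ {1, 2, 3, 4}, and correspondingly the quotient X/M_X (M_X the core of M in X) is isomorphic to Z_2, D_8, A_4, or S_4; specifically one of: M = ⟨a⟩⟨c⟩ with X/M_X ≅ Z_2; M = ⟨a^2⟩⟨c⟩ with M_X = ⟨a^2⟩⟨c^2⟩ and X/M_X ≅ D_8; M = ⟨a^2⟩⟨c⟩ with M_X = ⟨a^2⟩⟨c^3⟩ and X/M_X ≅ A_4; M = ⟨a^4⟩⟨c⟩ with M_X = ⟨a^4⟩⟨c^3⟩ and X/M_X ≅ S_4; M = ⟨a^3⟩⟨c⟩ with M_X = ⟨a^3⟩⟨c^4⟩ and X/M_X ≅ S_4. -/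

import Mathlib

open scoped Pointwise

/-- `a` and `b` generate a dihedral group complementing `⟨c⟩`, and `⟨c⟩` is the only overgroup of
`⟨c⟩` containing no reflection `a ^ j * b`. -/
structure DihedralCyclic {X : Type*} [Group X] (a b c : X) : Prop where
  sq : b * b = 1
  conj : b * a * b⁻¹ = a⁻¹
  cover : ∀ x : X, ∃ j k : ℤ, x = a ^ j * c ^ k ∨ x = a ^ j * b * c ^ k
  rot : ∀ j k : ℤ, a ^ j = c ^ k → a ^ j = 1
  refl : ∀ j k : ℤ, a ^ j * b ≠ c ^ k
  min : ∀ J : Subgroup X, c ∈ J → (∀ j : ℤ, a ^ j * b ∉ J) → J ≤ Subgroup.zpowers c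

namespace DihedralCyclic

variable {X : Type*} [Group X] {a b c : X}

theorem _root_.Subgroup.card_mul_relIndex_of_le {X : Type*} [Group X] {H K : Subgroup X}
    (hle : H ≤ K) : Nat.card H * H.relIndex K = Nat.card K := by
  rw [← Subgroup.relIndex_bot_left, ← Subgroup.relIndex_bot_left,
    Subgroup.relIndex_mul_relIndex _ _ _ bot_le hle]

theorem _root_.Subgroup.exists_zpow_mem_iff {X : Type*} [Group X] (H : Subgroup X) (a : X) :
    ∃ k : ℕ, ∀ j : ℤ, a ^ j ∈ H ↔ (k : ℤ) ∣ j := by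
  obtain ⟨g, hg⟩ := Int.subgroup_cyclic
    (AddSubgroup.comap (zmultiplesHom (Additive X) (Additive.ofMul a)) (Subgroup.toAddSubgroup H))
  refine ⟨g.natAbs, fun j => ?_⟩
  have : j ∈ AddSubgroup.comap (zmultiplesHom (Additive X) (Additive.ofMul a))
      (Subgroup.toAddSubgroup H) ↔ a ^ j ∈ H := by
    simp [AddSubgroup.mem_comap, ← ofMul_zpow]
  rw [← this, hg, ← AddSubgroup.zmultiples_eq_closure, Int.mem_zmultiples_iff, Int.natAbs_dvd]

section
variable (h : DihedralCyclic a b c)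
include h

theorem b_inv : b⁻¹ = b := inv_eq_of_mul_eq_one_left h.sq

theorem b_mul_zpow (j : ℤ) : b * a ^ j = a ^ (-j) * b := by
  have h1 : b * a ^ j * b⁻¹ = (a ^ j)⁻¹ := by rw [← conj_zpow, h.conj, inv_zpow]
  rw [zpow_neg, ← h1]; group

theorem refl_mul_zpow (i j : ℤ) : a ^ i * b * a ^ j = a ^ (i - j) * b := by
  rw [mul_assoc, h.b_mul_zpow, ← mul_assoc, ← zpow_add]; rfl

theorem refl_mul_refl (i j : ℤ) : a ^ i * b * (a ^ j * b) = a ^ (i - j) := by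
  rw [← mul_assoc, h.refl_mul_zpow, mul_assoc, h.sq, mul_one]

theorem refl_sq (j : ℤ) : a ^ j * b * (a ^ j * b) = 1 := by
  rw [h.refl_mul_refl]; simp

theorem refl_inv (j : ℤ) : (a ^ j * b)⁻¹ = a ^ j * b := inv_eq_of_mul_eq_one_left (h.refl_sq j)

theorem eq_one_of_mem {j : ℤ} (hj : a ^ j ∈ Subgroup.zpowers c) : a ^ j = 1 := by
  obtain ⟨k, hk⟩ := hj
  exact h.rot j k hk.symm

theorem refl_notMem (j : ℤ) : a ^ j * b ∉ Subgroup.zpowers c := by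
  rintro ⟨k, hk⟩
  exact h.refl j k hk.symm

theorem b_notMem : b ∉ Subgroup.zpowers c := by simpa using h.refl_notMem 0

theorem refl_ne_rot (i j : ℤ) : a ^ i * b ≠ a ^ j := by
  intro e
  refine h.refl (i - j) 0 ?_
  rw [sub_eq_neg_add, zpow_add, mul_assoc, e]; simp

theorem rebase (i : ℤ) : DihedralCyclic a (a ^ i * b) c where
  sq := h.refl_sq i
  conj := by
    rw [h.refl_inv]
    have := h.refl_mul_zpow i 1
    rw [zpow_one] at this
    rw [this, h.refl_mul_refl]; simp
  cover x := by
    obtain ⟨j, k, e | e⟩ := h.cover x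
    · exact ⟨j, k, Or.inl e⟩
    · exact ⟨j - i, k, Or.inr (by rw [e, ← mul_assoc (a ^ (j - i)), ← zpow_add]; simp)⟩
  rot := h.rot
  refl j k := by rw [← mul_assoc, ← zpow_add]; exact h.refl _ _
  min J hc hJ := h.min J hc fun j hj => hJ (j - i) (by
    rw [← mul_assoc, ← zpow_add]; simpa using hj)

/-- The dihedral subgroup of rotations and reflections. -/
def dihedral : Subgroup X where
  carrier := {x | ∃ j : ℤ, x = a ^ j ∨ x = a ^ j * b}
  one_mem' := ⟨0, by simp⟩
  mul_mem' := by
    rintro x y ⟨i, rfl | rfl⟩ ⟨j, rfl | rfl⟩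
    · exact ⟨i + j, Or.inl (zpow_add a i j).symm⟩
    · exact ⟨i + j, Or.inr (by rw [zpow_add, mul_assoc])⟩
    · exact ⟨i - j, Or.inr (h.refl_mul_zpow i j)⟩
    · exact ⟨i - j, Or.inl (h.refl_mul_refl i j)⟩
  inv_mem' := by
    rintro x ⟨i, rfl | rfl⟩
    · exact ⟨-i, Or.inl (zpow_neg a i).symm⟩
    · exact ⟨i, Or.inr (h.refl_inv i)⟩

theorem dihedral_isComplement : Subgroup.IsComplement' h.dihedral (Subgroup.zpowers c) := by
  apply Subgroup.isComplement'_of_disjoint_and_mul_eq_univ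
  · rw [Subgroup.disjoint_def]
    rintro x ⟨j, rfl | rfl⟩ hc
    · exact h.eq_one_of_mem hc
    · exact absurd hc (h.refl_notMem j)
  · rw [Set.eq_univ_iff_forall]
    intro x
    obtain ⟨j, k, e | e⟩ := h.cover x
    · exact ⟨a ^ j, ⟨j, Or.inl rfl⟩, c ^ k, ⟨k, rfl⟩, e.symm⟩
    · exact ⟨a ^ j * b, ⟨j, Or.inr rfl⟩, c ^ k, ⟨k, rfl⟩, e.symm⟩

theorem zpowers_le_dihedral : Subgroup.zpowers a ≤ h.dihedral := by
  rw [Subgroup.zpowers_le]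
  exact ⟨1, by simp⟩

theorem relIndex_zpowers_dihedral : (Subgroup.zpowers a).relIndex h.dihedral = 2 := by
  rw [Subgroup.relIndex_eq_two_iff]
  refine ⟨b, ⟨0, by simp⟩, ?_⟩
  rintro x ⟨j, rfl | rfl⟩
  · refine Or.inr ⟨⟨j, rfl⟩, ?_⟩
    rintro ⟨i, hi⟩
    exact h.refl_ne_rot j i hi.symm
  · refine Or.inl ⟨by rw [mul_assoc, h.sq, mul_one]; exact ⟨j, rfl⟩, ?_⟩
    rintro ⟨i, hi⟩
    exact h.refl_ne_rot j i hi.symm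

theorem card_dihedral : Nat.card h.dihedral = 2 * orderOf a := by
  rw [← Subgroup.card_mul_relIndex_of_le h.zpowers_le_dihedral, h.relIndex_zpowers_dihedral,
    Nat.card_zpowers, mul_comm]

theorem card_eq : Nat.card X = 2 * orderOf a * orderOf c := by
  rw [← h.dihedral_isComplement.card_mul_card, h.card_dihedral, Nat.card_zpowers]

theorem index_dihedral [Finite X] : h.dihedral.index = orderOf c := by
  have := h.dihedral.card_mul_index
  rw [h.card_dihedral, h.card_eq] at this
  exact Nat.eq_of_mul_eq_mul_left (by have := orderOf_pos a; positivity) this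

theorem index_zpowers [Finite X] : (Subgroup.zpowers c).index = 2 * orderOf a := by
  have := (Subgroup.zpowers c).card_mul_index
  rw [Nat.card_zpowers, h.card_eq, mul_comm] at this
  exact Nat.eq_of_mul_eq_mul_right (orderOf_pos c) this

theorem le_of_normal {L : Subgroup X} [L.Normal]
    (hL : ∀ j : ℤ, a ^ j * b ∉ L ⊔ Subgroup.zpowers c) : L ≤ Subgroup.zpowers c :=
  le_sup_left.trans (h.min _ (Subgroup.mem_sup_right (Subgroup.mem_zpowers c)) hL)

theorem exists_refl_of_not_le {L : Subgroup X} [L.Normal] (hL : ¬ L ≤ Subgroup.zpowers c) :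
    ∃ j : ℤ, a ^ j * b ∈ L ⊔ Subgroup.zpowers c := by
  by_contra! hc
  exact hL (h.le_of_normal hc)

theorem rot_eq_one_of_normalizes {j : ℤ}
    (hn : Subgroup.zpowers c ≤ Subgroup.normalizer (Subgroup.zpowers (a ^ j) : Set X)) :
    a ^ j = 1 := by
  apply h.eq_one_of_mem
  refine h.min (Subgroup.zpowers (a ^ j) ⊔ Subgroup.zpowers c)
    (Subgroup.mem_sup_right (Subgroup.mem_zpowers c)) ?_
    (Subgroup.mem_sup_left (Subgroup.mem_zpowers _))
  intro i hi
  rw [← SetLike.mem_coe, Subgroup.coe_mul_of_right_le_normalizer_left _ _ hn] at hi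
  obtain ⟨_, ⟨l, rfl⟩, _, ⟨r, rfl⟩, e⟩ := hi
  refine h.refl (i - j * l) r ?_
  simp only at e
  rw [sub_eq_neg_add, zpow_add, mul_assoc, ← e, ← mul_assoc, ← zpow_mul, ← zpow_add]; simp

theorem rot_eq_one_of_normal {j : ℤ} (hn : (Subgroup.zpowers (a ^ j)).Normal) : a ^ j = 1 :=
  h.rot_eq_one_of_normalizes Subgroup.le_normalizer_of_normal

theorem rot_eq_one_of_commute {j : ℤ} (hn : Commute (a ^ j) c) : a ^ j = 1 := by
  apply h.rot_eq_one_of_normalizes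
  rw [Subgroup.zpowers_le, Subgroup.mem_normalizer_iff]
  intro x
  constructor
  · rintro ⟨l, rfl⟩
    have := (hn.zpow_left l).eq
    exact ⟨l, by simp only at this ⊢; rw [← this]; group⟩
  · rintro ⟨l, hl⟩
    have := (hn.zpow_left l).eq
    refine ⟨l, ?_⟩
    simp only at hl this ⊢
    have e : x = c⁻¹ * (a ^ j) ^ l * c := by rw [hl]; group
    rw [e, mul_assoc, this]; group

theorem subgroup {H : Subgroup X} {k : ℕ} (hk : ∀ j : ℤ, a ^ j ∈ H ↔ (k : ℤ) ∣ j)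
    (ha : a ^ k ∈ H) (hb : b ∈ H) (hc : c ∈ H) :
    DihedralCyclic (⟨a ^ k, ha⟩ : H) ⟨b, hb⟩ ⟨c, hc⟩ where
  sq := Subtype.ext h.sq
  conj := by
    apply Subtype.ext
    have := h.refl_mul_zpow 0 k
    simp only [Subgroup.coe_mul, Subgroup.coe_inv]
    rw [← zpow_natCast, h.b_mul_zpow]; simp
  cover := by
    rintro ⟨x, hx⟩
    obtain ⟨j, l, e | e⟩ := h.cover x
    · have : a ^ j ∈ H := by rwa [e, H.mul_mem_cancel_right (H.zpow_mem hc l)] at hx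
      obtain ⟨t, rfl⟩ := (hk j).1 this
      refine ⟨t, l, Or.inl (Subtype.ext ?_)⟩
      simp [e, zpow_mul]
    · have : a ^ j ∈ H := by
        rwa [e, H.mul_mem_cancel_right (H.zpow_mem hc l), H.mul_mem_cancel_right hb] at hx
      obtain ⟨t, rfl⟩ := (hk j).1 this
      refine ⟨t, l, Or.inr (Subtype.ext ?_)⟩
      simp [e, zpow_mul]
  rot j l e := by
    apply Subtype.ext
    have e' := congrArg Subtype.val e
    simp only [Subgroup.coe_zpow, Subgroup.coe_one] at e' ⊢
    rw [← zpow_natCast, ← zpow_mul] at e' ⊢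
    exact h.rot _ _ e'
  refl j l e := by
    have e' := congrArg Subtype.val e
    simp only [Subgroup.coe_zpow, Subgroup.coe_mul] at e'
    rw [← zpow_natCast, ← zpow_mul] at e'
    exact h.refl _ _ e'
  min J hJ hr := by
    have := h.min (J.map H.subtype) ⟨_, hJ, rfl⟩ (by
      rintro j ⟨⟨x, hx⟩, hxJ, e⟩
      simp only [Subgroup.subtype_apply] at e
      subst e
      obtain ⟨t, rfl⟩ := (hk j).1 ((H.mul_mem_cancel_right hb).1 hx)
      apply hr t
      have e : (⟨a ^ k, ha⟩ : H) ^ t * ⟨b, hb⟩ = ⟨a ^ ((k : ℤ) * t) * b, hx⟩ :=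
        Subtype.ext (by simp [zpow_mul])
      rwa [e])
    intro x hx
    obtain ⟨l, hl⟩ := this ⟨x, hx, rfl⟩
    exact ⟨l, Subtype.ext (by simpa using hl)⟩

end

/-- `DihedralCyclic` passes to quotients in which the dihedral part stays large enough. -/
theorem map_mk (N : Subgroup X) [N.Normal] (hsq : b * b = 1) (hconj : b * a * b⁻¹ = a⁻¹)
    (hcover : ∀ x : X, ∃ j k : ℤ, x = a ^ j * c ^ k ∨ x = a ^ j * b * c ^ k)
    (hrot : ∀ j k : ℤ, a ^ j * c ^ k ∈ N → a ^ j ∈ N)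
    (hrefl : ∀ j k : ℤ, a ^ j * b * c ^ k ∉ N)
    (hmin : ∀ J : Subgroup X, N ≤ J → c ∈ J → (∀ j : ℤ, a ^ j * b ∉ J) →
      J ≤ N ⊔ Subgroup.zpowers c) :
    DihedralCyclic (a : X ⧸ N) (b : X ⧸ N) (c : X ⧸ N) where
  sq := by rw [← QuotientGroup.mk_mul, hsq]; rfl
  conj := by
    rw [← QuotientGroup.mk_mul, ← QuotientGroup.mk_inv, ← QuotientGroup.mk_mul, hconj]; rfl
  cover x := by
    obtain ⟨x, rfl⟩ := QuotientGroup.mk_surjective x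
    obtain ⟨j, k, e | e⟩ := hcover x
    · exact ⟨j, k, Or.inl (by rw [e]; rfl)⟩
    · exact ⟨j, k, Or.inr (by rw [e]; rfl)⟩
  rot j k e := by
    rw [← QuotientGroup.mk_zpow] at e ⊢
    rw [QuotientGroup.eq_one_iff]
    apply hrot j (-k)
    rw [← QuotientGroup.eq_one_iff, QuotientGroup.mk_mul, e, zpow_neg]
    exact mul_inv_cancel _
  refl j k e := by
    apply hrefl j (-k)
    rw [← QuotientGroup.eq_one_iff, QuotientGroup.mk_mul, QuotientGroup.mk_mul,
      QuotientGroup.mk_zpow, e, zpow_neg]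
    exact mul_inv_cancel _
  min J hJ hr := by
    have := hmin (J.comap (QuotientGroup.mk' N))
      (by intro x hx; rw [Subgroup.mem_comap, QuotientGroup.mk'_apply,
            (QuotientGroup.eq_one_iff x).2 hx]; exact J.one_mem) hJ hr
    intro x hx
    obtain ⟨x, rfl⟩ := QuotientGroup.mk_surjective x
    have hx' := this (show x ∈ J.comap (QuotientGroup.mk' N) from hx)
    obtain ⟨u, hu, _, ⟨k, rfl⟩, rfl⟩ := Subgroup.mem_sup_of_normal_left.1 hx'
    exact ⟨k, by
      rw [QuotientGroup.mk_mul, (QuotientGroup.eq_one_iff u).2 hu, one_mul]; rfl⟩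

section
variable (h : DihedralCyclic a b c)
include h

theorem quotient_core :
    DihedralCyclic (a : X ⧸ (Subgroup.zpowers c).normalCore) b c := by
  have hle := (Subgroup.zpowers c).normalCore_le
  refine map_mk _ h.sq h.conj h.cover ?_ ?_ ?_
  · intro j k hj
    rw [h.eq_one_of_mem (((Subgroup.zpowers c).mul_mem_cancel_right ⟨k, rfl⟩).1 (hle hj))]
    exact one_mem _
  · intro j k hj
    exact h.refl_notMem j (((Subgroup.zpowers c).mul_mem_cancel_right ⟨k, rfl⟩).1 (hle hj))
  · intro J _ hc hr
    exact (h.min J hc hr).trans le_sup_right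

theorem orderOf_quotient_core :
    orderOf (a : X ⧸ (Subgroup.zpowers c).normalCore) = orderOf a := by
  refine orderOf_eq_orderOf_iff.2 fun l => ?_
  rw [← QuotientGroup.mk_pow, QuotientGroup.eq_one_iff]
  constructor
  · intro hl
    have := (Subgroup.zpowers c).normalCore_le hl
    rw [← zpow_natCast] at this ⊢
    exact h.eq_one_of_mem this
  · intro e
    rw [e]; exact one_mem _

end

theorem _root_.Subgroup.normalCore_zpowers_quotient_eq_bot {X : Type*} [Group X] {c : X}
    {N : Subgroup X} [N.Normal] (hN : (N ⊔ Subgroup.zpowers c).normalCore ≤ N) :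
    (Subgroup.zpowers (c : X ⧸ N)).normalCore = ⊥ := by
  rw [eq_bot_iff]
  intro x hx
  obtain ⟨x, rfl⟩ := QuotientGroup.mk_surjective x
  rw [Subgroup.mem_bot, QuotientGroup.eq_one_iff]
  apply hN
  have hle : ((Subgroup.zpowers (c : X ⧸ N)).normalCore).comap (QuotientGroup.mk' N) ≤
      N ⊔ Subgroup.zpowers c := by
    intro y hy
    obtain ⟨k, hk⟩ := Subgroup.normalCore_le _ (Subgroup.mem_comap.1 hy)
    rw [Subgroup.mem_sup_of_normal_left]
    refine ⟨y * (c ^ k)⁻¹, ?_, c ^ k, ⟨k, rfl⟩, by group⟩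
    rw [← QuotientGroup.eq_one_iff, QuotientGroup.mk_mul, QuotientGroup.mk_inv,
      QuotientGroup.mk_zpow]
    simp only [QuotientGroup.mk'_apply] at hk
    rw [hk, mul_inv_cancel]
  exact Subgroup.normal_le_normalCore.2 hle hx

theorem _root_.Subgroup.eq_bot_of_normal_le_of_normalCore_eq_bot {X : Type*} [Group X]
    {L H : Subgroup X} [L.Normal] (hH : H.normalCore = ⊥) (hle : L ≤ H) : L = ⊥ := by
  rw [eq_bot_iff, ← hH]
  exact Subgroup.normal_le_normalCore.2 hle

theorem normalCore_quotient_core :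
    (Subgroup.zpowers (c : X ⧸ (Subgroup.zpowers c).normalCore)).normalCore = ⊥ := by
  apply Subgroup.normalCore_zpowers_quotient_eq_bot
  rw [sup_eq_right.2 (Subgroup.normalCore_le _)]

section
variable (h : DihedralCyclic a b c) (hcore : (Subgroup.zpowers c).normalCore = ⊥)
include h hcore

theorem exists_refl_of_ne_bot {L : Subgroup X} [L.Normal] (hL : L ≠ ⊥) :
    ∃ j : ℤ, a ^ j * b ∈ L ⊔ Subgroup.zpowers c :=
  h.exists_refl_of_not_le fun hle =>
    hL (Subgroup.eq_bot_of_normal_le_of_normalCore_eq_bot hcore hle)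

theorem eq_bot_of_odd_card [Finite X] {L : Subgroup X} [L.Normal] (hL : Odd (Nat.card L)) :
    L = ⊥ := by
  by_contra hne
  obtain ⟨j, hj⟩ := h.exists_refl_of_ne_bot hcore hne
  set J := L ⊔ Subgroup.zpowers c
  have hcJ : c ∈ J := Subgroup.mem_sup_right (Subgroup.mem_zpowers c)
  obtain ⟨k, hk⟩ := J.exists_zpow_mem_iff a
  have hJ := ((h.rebase j).subgroup hk (by rw [← zpow_natCast, hk]) hj hcJ).card_eq
  rw [Subgroup.orderOf_mk _ hcJ] at hJ
  have h1 : Nat.card L * L.relIndex (Subgroup.zpowers c) = Nat.card J := by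
    rw [← Subgroup.relIndex_sup_left, Subgroup.card_mul_relIndex_of_le le_sup_left]
  have h2 : Nat.card (L ⊓ Subgroup.zpowers c : Subgroup X) * L.relIndex (Subgroup.zpowers c) =
      orderOf c := by
    rw [← Subgroup.inf_relIndex_right, Subgroup.card_mul_relIndex_of_le inf_le_right, Nat.card_zpowers]
  have hr : 0 < L.relIndex (Subgroup.zpowers c) := by
    apply Nat.pos_of_ne_zero
    intro h0
    rw [h0, mul_zero] at h2
    exact (orderOf_pos c).ne h2
  rw [hJ, ← h2, ← mul_assoc] at h1
  have h3 := Nat.eq_of_mul_eq_mul_right hr h1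
  rw [h3, mul_assoc] at hL
  exact (Nat.not_odd_iff_even.2 (even_two_mul _)) hL

theorem eq_one_of_odd_order [Finite X] {T : Subgroup X} [T.Normal]
    (hT : ∀ x ∈ T, ∀ y ∈ T, x * y = y * x) {t : X} (ht : t ∈ T) (ho : Odd (orderOf t)) :
    t = 1 := by
  let L : Subgroup X :=
    { carrier := {x | x ∈ T ∧ x ^ orderOf t = 1}
      one_mem' := ⟨T.one_mem, one_pow _⟩
      mul_mem' := fun {x y} hx hy => ⟨T.mul_mem hx.1 hy.1, by
        rw [Commute.mul_pow (hT x hx.1 y hy.1), hx.2, hy.2, one_mul]⟩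
      inv_mem' := fun {x} hx => ⟨T.inv_mem hx.1, by rw [inv_pow, hx.2, inv_one]⟩ }
  have hLn : L.Normal := ⟨fun x hx g => ⟨‹T.Normal›.conj_mem x hx.1 g, by
    rw [conj_pow, hx.2, mul_one, mul_inv_cancel]⟩⟩
  have hodd : Odd (Nat.card L) := by
    by_contra he
    rw [Nat.not_odd_iff_even, even_iff_two_dvd] at he
    have : Fact (Nat.Prime 2) := ⟨Nat.prime_two⟩
    obtain ⟨x, hx⟩ := exists_prime_orderOf_dvd_card' 2 he
    have h1 : orderOf (x : X) = 2 := by rw [Subgroup.orderOf_coe, hx]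
    have := orderOf_dvd_of_pow_eq_one x.2.2
    rw [h1, ← even_iff_two_dvd] at this
    exact (Nat.not_odd_iff_even.2 this) ho
  have := h.eq_bot_of_odd_card hcore hodd
  have ht' : t ∈ L := ⟨ht, pow_orderOf_eq_one t⟩
  rw [this] at ht'
  exact Subgroup.mem_bot.1 ht'

end
end DihedralCyclic

namespace Subgroup

variable {X : Type*} [Group X] [Finite X] {c : X}

theorem zpowers_eq_zpowers_of_orderOf_eq {x y : X} (hx : x ∈ zpowers c) (hy : y ∈ zpowers c)
    (ho : orderOf x = orderOf y) : zpowers x = zpowers y := by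
  let T : Subgroup X :=
    { carrier := {z | z ∈ zpowers c ∧ z ^ orderOf x = 1}
      one_mem' := ⟨one_mem _, one_pow _⟩
      mul_mem' := fun {z w} hz hw => ⟨mul_mem hz.1 hw.1, by
        obtain ⟨i, rfl⟩ := hz.1
        obtain ⟨j, rfl⟩ := hw.1
        rw [Commute.mul_pow ((Commute.refl c).zpow_zpow i j), hz.2, hw.2, one_mul]⟩
      inv_mem' := fun {z} hz => ⟨inv_mem hz.1, by rw [inv_pow, hz.2, inv_one]⟩ }
  have hTC : T ≤ zpowers c := fun z hz => hz.1
  have : IsCyclic T := isCyclic_of_le hTC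
  obtain ⟨g, hg⟩ := IsCyclic.exists_ofOrder_eq_natCard (α := T)
  have hle : Nat.card T ≤ orderOf x := by
    rw [← hg, ← orderOf_coe]
    exact Nat.le_of_dvd (orderOf_pos x) (orderOf_dvd_of_pow_eq_one g.2.2)
  have key : ∀ z ∈ zpowers c, orderOf z = orderOf x → zpowers z = T := by
    intro z hz hzx
    refine eq_of_le_of_card_ge ?_ (by rwa [Nat.card_zpowers, hzx])
    rw [zpowers_le]
    exact ⟨hz, by rw [← hzx, pow_orderOf_eq_one]⟩
  rw [key x hx rfl, key y hy ho.symm]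

theorem mem_normalizer_zpowers_of_conj_mem {y g : X} (hy : y ∈ zpowers c)
    (hg : g * y * g⁻¹ ∈ zpowers c) : g ∈ normalizer (zpowers y : Set X) := by
  rw [mem_normalizer_iff_map_conj_eq, MonoidHom.map_zpowers]
  apply zpowers_eq_zpowers_of_orderOf_eq (c := c)
  · simpa using hg
  · exact hy
  · exact orderOf_injective _ (MulEquiv.injective _) y

/-- An element of the core-free subgroup `⟨c⟩` all of whose conjugates by a maximal subgroup and
by one further element stay in `⟨c⟩` is trivial. -/
theorem eq_one_of_conj_mem_of_isCoatom (hcore : (zpowers c).normalCore = ⊥) {H : Subgroup X}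
    (hH : IsCoatom H) {y : X} (hy : y ∈ zpowers c) (hyH : ∀ h ∈ H, h * y * h⁻¹ ∈ zpowers c)
    {x : X} (hx : x ∉ H) (hyx : x * y * x⁻¹ ∈ zpowers c) : y = 1 := by
  have hle : H ≤ normalizer (zpowers y : Set X) := fun h hh =>
    mem_normalizer_zpowers_of_conj_mem hy (hyH h hh)
  have htop : normalizer (zpowers y : Set X) = ⊤ := by
    apply hH.2
    refine lt_of_le_of_ne hle ?_
    rintro rfl
    exact hx (mem_normalizer_zpowers_of_conj_mem hy hyx)
  have hn : (zpowers y).Normal := normalizer_eq_top_iff.1 htop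
  have := eq_bot_of_normal_le_of_normalCore_eq_bot hcore (zpowers_le.2 hy)
  exact zpowers_eq_bot.1 this

theorem normal_of_isComplement'_zpowers {A : Subgroup X} (hA : IsComplement' A (zpowers c))
    (hT : ∀ x ∉ zpowers c, ∀ y ∈ zpowers c, x * y * x⁻¹ ∈ zpowers c → y = 1) : A.Normal := by
  have hdisj : ∀ x ∈ A, x ∈ zpowers c → x = 1 := fun x h1 h2 => disjoint_def.1 hA.disjoint h1 h2
  have hA1 : ∀ q ∈ A, ∀ y ∈ zpowers c, q * y * q⁻¹ ∈ A → y = 1 := by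
    intro q hq y hy hm
    rw [A.mul_mem_cancel_right (A.inv_mem hq), A.mul_mem_cancel_left hq] at hm
    exact hdisj y hm hy
  let f : A × {y : X // y ∈ zpowers c ∧ y ≠ 1} → {x : X // x ∉ A} := fun p =>
    ⟨p.1 * p.2 * (p.1 : X)⁻¹, fun hm => p.2.2.2 (hA1 p.1 p.1.2 p.2 p.2.2.1 hm)⟩
  have hinj : Function.Injective f := by
    rintro ⟨⟨q, hq⟩, ⟨y, hy, hy1⟩⟩ ⟨⟨q', hq'⟩, ⟨y', hy', hy1'⟩⟩ e
    have e' : q * y * q⁻¹ = q' * y' * q'⁻¹ := congrArg Subtype.val e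
    have e2 : (q'⁻¹ * q) * y * (q'⁻¹ * q)⁻¹ = y' := by
      calc (q'⁻¹ * q) * y * (q'⁻¹ * q)⁻¹ = q'⁻¹ * (q * y * q⁻¹) * q' := by group
        _ = y' := by rw [e']; group
    have hmem : q'⁻¹ * q ∈ zpowers c := by
      by_contra hn
      exact hy1 (hT _ hn y hy (by rw [e2]; exact hy'))
    have hq1 : q'⁻¹ * q = 1 := hdisj _ (A.mul_mem (A.inv_mem hq') hq) hmem
    rw [hq1] at e2
    have hqq : q' = q := inv_mul_eq_one.1 hq1
    have hyy : y = y' := by simpa using e2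
    subst hqq hyy
    rfl
  have hcard : Nat.card (A × {y : X // y ∈ zpowers c ∧ y ≠ 1}) = Nat.card {x : X // x ∉ A} := by
    classical
    have := Fintype.ofFinite X
    have h1 : Nat.card {x : X // x ∉ A} = Nat.card X - Nat.card A := by
      rw [Nat.card_eq_fintype_card, Nat.card_eq_fintype_card, Nat.card_eq_fintype_card,
        Fintype.card_subtype_compl]
    have h2 : Nat.card {y : X // y ∈ zpowers c ∧ y ≠ 1} = Nat.card (zpowers c) - 1 := by
      rw [Nat.card_congr (Equiv.subtypeSubtypeEquivSubtypeInter (· ∈ zpowers c) (· ≠ 1)).symm,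
        ← Nat.card_congr (Equiv.subtypeEquivRight (p := fun y : zpowers c => y ≠ 1)
          (fun y : zpowers c => by rw [ne_eq, ne_eq, Subtype.ext_iff]; rfl)),
        Nat.card_eq_fintype_card, Nat.card_eq_fintype_card, Fintype.card_subtype_compl]
      simp
    rw [Nat.card_prod, h1, h2, ← hA.card_mul_card, Nat.mul_sub_one]
  have hsurj : Function.Surjective f :=
    ((Nat.bijective_iff_injective_and_card f).2 ⟨hinj, hcard⟩).2
  refine ⟨fun x hx g => ?_⟩
  by_contra hg
  obtain ⟨⟨⟨q, hq⟩, ⟨y, hy, hy1⟩⟩, e⟩ := hsurj ⟨_, hg⟩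
  have e' : q * y * q⁻¹ = g * x * g⁻¹ := congrArg Subtype.val e
  obtain ⟨⟨⟨q', hq'⟩, ⟨_, ⟨r, rfl⟩⟩⟩, e3⟩ := hA.2 (g⁻¹ * q)
  simp only at e3
  obtain ⟨s, rfl⟩ := hy
  have e4 : x = q' * c ^ s * q'⁻¹ := by
    calc x = g⁻¹ * (g * x * g⁻¹) * g := by group
      _ = (g⁻¹ * q) * c ^ s * (g⁻¹ * q)⁻¹ := by rw [← e']; group
      _ = q' * c ^ s * q'⁻¹ := by rw [← e3]; group
  rw [e4] at hx
  exact hy1 (hA1 q' hq' _ ⟨s, rfl⟩ hx)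

omit [Finite X] in
theorem conj_eq_of_mem_zpowers {x y : X} (hx : x ∈ zpowers c) (hy : y ∈ zpowers c) :
    x * y * x⁻¹ = y := by
  obtain ⟨i, rfl⟩ := hx
  obtain ⟨j, rfl⟩ := hy
  simp only; group

theorem normal_of_isComplement'_zpowers_of_isCoatom (hcore : (zpowers c).normalCore = ⊥)
    (hmax : IsCoatom (zpowers c)) {A : Subgroup X} (hA : IsComplement' A (zpowers c)) :
    A.Normal := by
  refine normal_of_isComplement'_zpowers hA fun x hx y hy hxy => ?_
  refine eq_one_of_conj_mem_of_isCoatom hcore hmax hy (fun h hh => ?_) hx hxy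
  rwa [conj_eq_of_mem_zpowers hh hy]

theorem card_dvd_factorial_index (H : Subgroup X) (hH : H.normalCore = ⊥) :
    Nat.card X ∣ H.index.factorial := by
  rw [index_eq_card, ← Nat.card_perm]
  apply card_dvd_of_injective (MulAction.toPermHom X (X ⧸ H))
  rw [← MonoidHom.ker_eq_bot_iff, ← normalCore_eq_ker, hH]

end Subgroup

theorem Equiv.Perm.exists_card_support_eq_mul {α : Type*} [Fintype α] [DecidableEq α]
    (σ : Equiv.Perm α) {m : ℕ} (hm : σ ^ m = 1)
    (hfree : ∀ (x : α) (j : ℕ), (σ ^ j) x = x → σ x = x ∨ m ∣ j) :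
    ∃ s : ℕ, σ.support.card = s * m ∧ Equiv.Perm.sign σ = (-1) ^ (s * (m + 1)) := by
  have hall : ∀ l ∈ σ.cycleType, l = m := by
    intro l hl
    have h1 : l ∣ m := (Equiv.Perm.dvd_of_mem_cycleType hl).trans (orderOf_dvd_of_pow_eq_one hm)
    obtain ⟨γ, τ, hστ, hd, hγ, hcard⟩ := Equiv.Perm.mem_cycleType_iff.1 hl
    obtain ⟨x, hx, -⟩ := id hγ
    have hτx : τ x = x := (hd x).resolve_left hx
    have hσx : σ x ≠ x := by rw [hστ, Equiv.Perm.mul_apply, hτx]; exact hx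
    have hpow : (σ ^ l) x = x := by
      rw [hστ, hd.commute.mul_pow, Equiv.Perm.mul_apply, Equiv.Perm.pow_apply_eq_self_of_apply_eq_self hτx,
        ← hcard, ← hγ.orderOf, pow_orderOf_eq_one]
      rfl
    exact Nat.dvd_antisymm h1 ((hfree x l hpow).resolve_left hσx)
  refine ⟨σ.cycleType.card, ?_, ?_⟩
  · rw [← Equiv.Perm.sum_cycleType]
    conv_lhs => rw [Multiset.eq_replicate_card.2 hall, Multiset.sum_replicate, smul_eq_mul]
  · rw [Equiv.Perm.sign_of_cycleType]
    congr 1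
    have : σ.cycleType.sum = σ.cycleType.card * m := by
      conv_lhs => rw [Multiset.eq_replicate_card.2 hall, Multiset.sum_replicate, smul_eq_mul]
    rw [this, mul_add, mul_one]

namespace DihedralCyclic

variable {X : Type*} [Group X] {a b c : X} (h : DihedralCyclic a b c)
include h

/-- Squares of rotations in a normal subgroup consisting of rotations and reflections vanish. -/
theorem sq_eq_one_of_normal_le_dihedral {L : Subgroup X} [L.Normal] (hL : L ≤ h.dihedral) {j : ℤ}
    (hj : a ^ j ∈ L) : a ^ (2 * j) = 1 := by
  obtain ⟨k, hk⟩ := L.exists_zpow_mem_iff a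
  have hk1 : a ^ (k : ℤ) ∈ L := (hk k).2 dvd_rfl
  have hn : (Subgroup.zpowers (a ^ (2 * (k : ℤ)))).Normal := by
    have key : ∀ g : X, g * a ^ (2 * (k : ℤ)) * g⁻¹ ∈ Subgroup.zpowers (a ^ (2 * (k : ℤ))) := by
      intro g
      have h1 := ‹L.Normal›.conj_mem _ hk1 g
      have h2 : g * a ^ (2 * (k : ℤ)) * g⁻¹ = (g * a ^ (k : ℤ) * g⁻¹) * (g * a ^ (k : ℤ) * g⁻¹) := by
        rw [two_mul, zpow_add]; group
      obtain ⟨i, e | e⟩ := hL h1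
      · rw [e] at h1
        obtain ⟨t, rfl⟩ := (hk i).1 h1
        refine ⟨t, ?_⟩
        rw [h2, e]
        simp only
        rw [← zpow_mul, ← zpow_add]
        congr 1; ring
      · rw [h2, e, h.refl_sq]; exact one_mem _
    refine ⟨?_⟩
    rintro _ ⟨i, rfl⟩ g
    simp only
    rw [← conj_zpow]
    exact Subgroup.zpow_mem _ (key g) i
  have h1 := h.rot_eq_one_of_normal hn
  obtain ⟨t, rfl⟩ := (hk j).1 hj
  rw [← mul_assoc, zpow_mul, h1, one_zpow]

theorem normalCore_dihedral_eq_bot (ha : a ^ 4 ≠ 1) : h.dihedral.normalCore = ⊥ := by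
  have hrot : ∀ j : ℤ, a ^ j * b ∉ h.dihedral.normalCore := by
    intro j hj
    have h1 := h.dihedral.normalCore_normal.conj_mem _ hj a
    have h2 := h.dihedral.normalCore.mul_mem h1 hj
    have h3 : a * (a ^ j * b) * a⁻¹ * (a ^ j * b) = a ^ (2 : ℤ) := by
      have : a * (a ^ j * b) * a⁻¹ = a ^ (j + 2) * b := by
        have := h.refl_mul_zpow (1 + j) (-1)
        rw [zpow_add, zpow_one, zpow_neg_one, mul_assoc a] at this
        rw [this]; congr 2; ring
      rw [this, h.refl_mul_refl]; congr 1; ring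
    rw [h3] at h2
    have := h.sq_eq_one_of_normal_le_dihedral (h.dihedral.normalCore_le) h2
    exact ha (by exact_mod_cast this)
  obtain ⟨k, hk⟩ := h.dihedral.normalCore.exists_zpow_mem_iff a
  have hle : h.dihedral.normalCore = Subgroup.zpowers (a ^ (k : ℤ)) := by
    apply le_antisymm
    · intro x hx
      obtain ⟨j, rfl | rfl⟩ := h.dihedral.normalCore_le hx
      · obtain ⟨t, rfl⟩ := (hk j).1 hx
        exact ⟨t, by simp only; rw [zpow_mul]⟩
      · exact absurd hx (hrot j)
    · rw [Subgroup.zpowers_le]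
      exact (hk k).2 dvd_rfl
  rw [hle, Subgroup.zpowers_eq_bot]
  apply h.rot_eq_one_of_normal
  rw [← hle]
  exact Subgroup.normalCore_normal _

theorem card_dvd_factorial [Finite X] (ha : a ^ 4 ≠ 1) :
    2 * orderOf a * orderOf c ∣ (orderOf c).factorial := by
  rw [← h.index_dihedral, h.index_dihedral, ← h.card_eq, ← h.index_dihedral]
  exact Subgroup.card_dvd_factorial_index _ (h.normalCore_dihedral_eq_bot ha)

end DihedralCyclic

namespace Subgroup

variable {X : Type*} [Group X] [Finite X]

open Classical in
/-- The sign of the permutation of the cosets of `H` induced by an element. -/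
noncomputable def cosetSign (H : Subgroup X) : X →* ℤˣ :=
  letI := Fintype.ofFinite (X ⧸ H)
  Equiv.Perm.sign.comp (MulAction.toPermHom X (X ⧸ H))

omit [Finite X] in
theorem smul_mk_eq_mk_iff {H : Subgroup X} {g x : X} :
    g • (x : X ⧸ H) = x ↔ x⁻¹ * g * x ∈ H := by
  rw [MulAction.Quotient.smul_coe, eq_comm, QuotientGroup.eq, smul_eq_mul, mul_assoc]

theorem exists_index_eq_and_cosetSign_eq (H : Subgroup X) {g : X} {r : ℕ} (hr : g ^ r = 1)
    (hfree : ∀ (x : X) (j : ℕ), x⁻¹ * g ^ j * x ∈ H → x⁻¹ * g * x ∈ H ∨ r ∣ j) :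
    ∃ s : ℕ, H.index = {q : X ⧸ H | g • q = q}.ncard + s * r ∧
      H.cosetSign g = (-1) ^ (s * (r + 1)) := by
  classical
  let _ := Fintype.ofFinite (X ⧸ H)
  obtain ⟨s, hs, hsign⟩ := Equiv.Perm.exists_card_support_eq_mul
    (MulAction.toPermHom X (X ⧸ H) g) (m := r) (by rw [← map_pow, hr, map_one]) (by
      intro q j hj
      obtain ⟨x, rfl⟩ := QuotientGroup.mk_surjective q
      rw [← map_pow, MulAction.toPermHom_apply, MulAction.toPerm_apply, smul_mk_eq_mk_iff] at hj
      rw [MulAction.toPermHom_apply, MulAction.toPerm_apply, smul_mk_eq_mk_iff]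
      exact hfree x j hj)
  refine ⟨s, ?_, ?_⟩
  · have h1 : {q : X ⧸ H | g • q = q} =
        ((MulAction.toPermHom X (X ⧸ H) g).supportᶜ : Finset (X ⧸ H)) := by
      ext q
      simp
    rw [h1, Set.ncard_coe_finset, ← hs, Finset.card_compl_add_card, index_eq_card,
      Nat.card_eq_fintype_card]
  · rw [← hsign]
    unfold cosetSign
    simp only [MonoidHom.comp_apply]

end Subgroup

namespace DihedralCyclic

variable {X : Type*} [Group X] {a b c : X}

/-- The possible pairs of orders of `a` and `c` when `⟨c⟩` is core-free. -/
def Admissible (n m : ℕ) : Prop :=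
  (n = 1 ∧ m = 1) ∨ (n = 2 ∧ m = 2) ∨ (n = 2 ∧ m = 3) ∨ (n = 4 ∧ m = 3) ∨ (n = 3 ∧ m = 4)

section
variable (h : DihedralCyclic a b c)
include h

theorem eq_one_of_c_eq_one (hc : c = 1) : a = 1 := by
  have := h.min (Subgroup.zpowers a) (by rw [hc]; exact one_mem _) (by
    rintro j ⟨i, hi⟩
    exact h.refl_ne_rot j i hi.symm) (Subgroup.mem_zpowers a)
  have := h.eq_one_of_mem (j := 1) (by simpa using this)
  simpa using this

theorem eq_one_of_conj_mem {g x : X} (hg : g ∈ h.dihedral)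
    (hx : x⁻¹ * g * x ∈ Subgroup.zpowers c) : g = 1 := by
  obtain ⟨⟨⟨d, hd⟩, ⟨y, hy⟩⟩, e⟩ := h.dihedral_isComplement.2 x
  simp only at e
  have h1 : d⁻¹ * g * d ∈ Subgroup.zpowers c := by
    have : d⁻¹ * g * d = y * (x⁻¹ * g * x) * y⁻¹ := by rw [← e]; group
    rw [this]
    exact mul_mem (mul_mem hy hx) (inv_mem hy)
  have h2 := Subgroup.disjoint_def.1 h.dihedral_isComplement.disjoint
    (mul_mem (mul_mem (inv_mem hd) hg) hd) h1
  have : g = d * (d⁻¹ * g * d) * d⁻¹ := by group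
  rw [this, h2]; group

theorem admissible_of_isCoatom [Finite X] (hcore : (Subgroup.zpowers c).normalCore = ⊥)
    (hmax : IsCoatom (Subgroup.zpowers c)) : Admissible (orderOf a) (orderOf c) := by
  have hn := Subgroup.normal_of_isComplement'_zpowers_of_isCoatom hcore hmax
    h.dihedral_isComplement
  have ha := h.sq_eq_one_of_normal_le_dihedral (L := h.dihedral) le_rfl (j := 1) ⟨1, Or.inl rfl⟩
  have ha2 : orderOf a ∣ 2 := orderOf_dvd_of_pow_eq_one (by exact_mod_cast ha)
  by_cases hc : c = 1
  · left
    rw [h.eq_one_of_c_eq_one hc, hc]; simp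
  have hKK : ∀ (x : X) (j : ℕ), x⁻¹ * c ^ j * x ∈ Subgroup.zpowers c →
      x ∈ Subgroup.zpowers c ∨ c ^ j = 1 := by
    intro x j hj
    by_contra! hx
    refine hx.2 (Subgroup.eq_one_of_conj_mem_of_isCoatom hcore hmax (pow_mem (Subgroup.mem_zpowers c) j)
      (fun g hg => ?_) (x := x⁻¹) (by simpa using hx.1) (by simpa using hj))
    rw [Subgroup.conj_eq_of_mem_zpowers hg (pow_mem (Subgroup.mem_zpowers c) j)]
    exact pow_mem (Subgroup.mem_zpowers c) j
  have hmem : ∀ x ∈ Subgroup.zpowers c, x⁻¹ * c * x ∈ Subgroup.zpowers c := fun x hx =>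
    mul_mem (mul_mem (inv_mem hx) (Subgroup.mem_zpowers c)) hx
  obtain ⟨s, hs, -⟩ := (Subgroup.zpowers c).exists_index_eq_and_cosetSign_eq
    (pow_orderOf_eq_one c) (by
      intro x j hj
      rcases hKK x j hj with h1 | h1
      · exact Or.inl (hmem x h1)
      · exact Or.inr (orderOf_dvd_of_pow_eq_one h1))
  have hfix : {q : X ⧸ Subgroup.zpowers c | c • q = q} = {((1 : X) : X ⧸ Subgroup.zpowers c)} := by
    ext q
    obtain ⟨x, rfl⟩ := QuotientGroup.mk_surjective q
    rw [Set.mem_ofPred_eq, Set.mem_singleton_iff, Subgroup.smul_mk_eq_mk_iff, eq_comm,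
      QuotientGroup.eq, inv_one, one_mul]
    constructor
    · intro hx
      exact (hKK x 1 (by simpa using hx)).resolve_right (by simpa using hc)
    · exact hmem x
  rw [hfix, Set.ncard_singleton, h.index_zpowers] at hs
  have hm1 : orderOf c ≠ 1 := by simpa using hc
  rcases (Nat.dvd_prime Nat.prime_two).1 ha2 with e | e
  · rw [e] at hs
    exact absurd (Nat.eq_one_of_mul_eq_one_left (by omega : s * orderOf c = 1)) hm1
  · rw [e] at hs
    have : orderOf c ∣ 3 := ⟨s, by rw [mul_comm]; omega⟩
    have := ((Nat.dvd_prime Nat.prime_three).1 this).resolve_left hm1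
    right; right; left
    exact ⟨e, this⟩

end

end DihedralCyclic

namespace DihedralCyclic

variable {X : Type*} [Group X] {a b c : X}

/-- A core-free maximal overgroup `H` of `⟨c⟩` containing `b` and no nontrivial rotation. -/
structure ThinMaximal (a b c : X) (H : Subgroup X) : Prop where
  dc : DihedralCyclic a b c
  coatom : IsCoatom H
  c_mem : c ∈ H
  b_mem : b ∈ H
  rot_mem : ∀ j : ℤ, a ^ j ∈ H → a ^ j = 1
  core : H.normalCore = ⊥

namespace ThinMaximal

variable {H : Subgroup X} (t : ThinMaximal a b c H)
include t

theorem zpowers_le : Subgroup.zpowers c ≤ H := Subgroup.zpowers_le.2 t.c_mem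

theorem core_zpowers : (Subgroup.zpowers c).normalCore = ⊥ :=
  Subgroup.eq_bot_of_normal_le_of_normalCore_eq_bot t.core
    ((Subgroup.normalCore_le _).trans t.zpowers_le)

theorem a_ne_one : a ≠ 1 := by
  intro ha
  apply t.coatom.1
  rw [eq_top_iff]
  intro x _
  obtain ⟨j, k, e | e⟩ := t.dc.cover x
  · rw [e, ha, one_zpow, one_mul]; exact H.zpow_mem t.c_mem k
  · rw [e, ha, one_zpow, one_mul]; exact H.mul_mem t.b_mem (H.zpow_mem t.c_mem k)

theorem c_ne_one : c ≠ 1 := fun hc => t.a_ne_one (t.dc.eq_one_of_c_eq_one hc)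

theorem refl_mem {j : ℤ} (hj : a ^ j * b ∈ H) : a ^ j = 1 :=
  t.rot_mem j ((H.mul_mem_cancel_right t.b_mem).1 hj)

theorem mem_cases {x : X} (hx : x ∈ H) : ∃ k : ℤ, x = c ^ k ∨ x = b * c ^ k := by
  obtain ⟨j, k, e | e⟩ := t.dc.cover x
  · rw [e, H.mul_mem_cancel_right (H.zpow_mem t.c_mem k)] at hx
    exact ⟨k, Or.inl (by rw [e, t.rot_mem j hx, one_mul])⟩
  · rw [e, H.mul_mem_cancel_right (H.zpow_mem t.c_mem k)] at hx
    exact ⟨k, Or.inr (by rw [e, t.refl_mem hx, one_mul])⟩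

theorem exists_rot_mul (x : X) : ∃ j : ℤ, ∃ y ∈ H, x = a ^ j * y := by
  obtain ⟨j, k, e | e⟩ := t.dc.cover x
  · exact ⟨j, _, H.zpow_mem t.c_mem k, e⟩
  · exact ⟨j, _, H.mul_mem t.b_mem (H.zpow_mem t.c_mem k), by rw [e, mul_assoc]⟩

theorem isComplement : Subgroup.IsComplement' (Subgroup.zpowers a) H := by
  apply Subgroup.isComplement'_of_disjoint_and_mul_eq_univ
  · rw [Subgroup.disjoint_def]
    rintro _ ⟨j, rfl⟩ hj
    exact t.rot_mem j hj
  · rw [Set.eq_univ_iff_forall]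
    intro x
    obtain ⟨j, y, hy, e⟩ := t.exists_rot_mul x
    exact ⟨a ^ j, ⟨j, rfl⟩, y, hy, e.symm⟩

theorem relIndex : (Subgroup.zpowers c).relIndex H = 2 := by
  rw [Subgroup.relIndex_eq_two_iff]
  refine ⟨b, t.b_mem, fun x hx => ?_⟩
  have key : ∀ k : ℤ, b * c ^ k ∉ Subgroup.zpowers c := fun k hk =>
    t.dc.b_notMem (((Subgroup.zpowers c).mul_mem_cancel_right ⟨k, rfl⟩).1 hk)
  obtain ⟨k, rfl | rfl⟩ := t.mem_cases hx
  · refine Or.inr ⟨⟨k, rfl⟩, fun hk => t.dc.b_notMem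
      (((Subgroup.zpowers c).mul_mem_cancel_left ⟨k, rfl⟩).1 hk)⟩
  · refine Or.inl ⟨?_, key k⟩
    have hmem : b * c ^ k * b ∈ H := H.mul_mem hx t.b_mem
    obtain ⟨l, e | e⟩ := t.mem_cases hmem
    · exact ⟨l, e.symm⟩
    · exfalso
      have e' : c ^ k * b = c ^ l := by rwa [mul_assoc, mul_right_inj] at e
      exact t.dc.b_notMem (((Subgroup.zpowers c).mul_mem_cancel_left ⟨k, rfl⟩).1 ⟨l, e'.symm⟩)

theorem conj_mem {x y : X} (hx : x ∈ H) (hy : y ∈ Subgroup.zpowers c) :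
    x * y * x⁻¹ ∈ Subgroup.zpowers c := by
  have : ((Subgroup.zpowers c).subgroupOf H).Normal := Subgroup.normal_of_index_eq_two t.relIndex
  exact this.conj_mem ⟨y, t.zpowers_le hy⟩ hy ⟨x, hx⟩

theorem sq_mem {x : X} (hx : x ∈ H) : x * x ∈ Subgroup.zpowers c := by
  have := Subgroup.mul_self_mem_of_index_two t.relIndex (⟨x, hx⟩ : H)
  exact this

theorem index_eq [Finite X] : H.index = orderOf a := by
  have h1 := H.card_mul_index
  rw [← t.isComplement.card_mul_card, Nat.card_zpowers, mul_comm] at h1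
  exact Nat.eq_of_mul_eq_mul_right Nat.card_pos h1

variable [Finite X]

theorem eq_one_of_conj {x y : X} (hx : x ∉ H) (hy : y ∈ Subgroup.zpowers c)
    (hxy : x * y * x⁻¹ ∈ Subgroup.zpowers c) : y = 1 :=
  Subgroup.eq_one_of_conj_mem_of_isCoatom t.core_zpowers t.coatom hy
    (fun _ hg => t.conj_mem hg hy) hx hxy

theorem sq_eq_one_of_conj {x y : X} (hx : x ∉ H) (hy : y ∈ H) (hxy : x * y * x⁻¹ ∈ H) :
    y * y = 1 := by
  apply t.eq_one_of_conj hx (t.sq_mem hy)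
  have : x * (y * y) * x⁻¹ = (x * y * x⁻¹) * (x * y * x⁻¹) := by group
  rw [this]
  exact t.sq_mem hxy

omit [Finite X] in
theorem eq_bot_of_le {L : Subgroup X} [L.Normal] (hL : L ≤ H) : L = ⊥ :=
  Subgroup.eq_bot_of_normal_le_of_normalCore_eq_bot t.core hL

omit [Finite X] in
theorem eq_one_of_forall_conj_mem {z : X} (hz : ∀ x : X, x * z * x⁻¹ ∈ H) : z = 1 := by
  have : z ∈ H.normalCore := fun x => hz x
  rw [t.core] at this
  exact Subgroup.mem_bot.1 this

/-- In a cyclic group of even order the involution is central in any group normalizing it. -/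
theorem conj_half {h : ℕ} (hh : orderOf c = 2 * h) {x : X} (hx : x ∈ H) :
    x * c ^ h * x⁻¹ = c ^ h := by
  classical
  have h0 : 0 < h := by have := orderOf_pos c; omega
  have hz : orderOf (c ^ h) = 2 := by
    rw [orderOf_pow_of_dvd h0.ne' ⟨2, by omega⟩, hh]
    exact Nat.mul_div_cancel _ h0
  have h1 := Subgroup.zpowers_eq_zpowers_of_orderOf_eq (c := c) (x := x * c ^ h * x⁻¹) (y := c ^ h)
    (t.conj_mem hx ⟨h, by simp⟩) ⟨h, by simp⟩
    (by
      have := orderOf_injective (MulAut.conj x).toMonoidHom (MulEquiv.injective (MulAut.conj x)) (c ^ h)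
      simpa using this)
  have h2 : x * c ^ h * x⁻¹ ∈ Subgroup.zpowers (c ^ h) := by
    rw [← h1]; exact Subgroup.mem_zpowers _
  rw [mem_zpowers_iff_mem_range_orderOf, hz] at h2
  simp only [Finset.mem_image, Finset.mem_range] at h2
  obtain ⟨i, hi, e⟩ := h2
  interval_cases i
  · exfalso
    rw [pow_zero, eq_comm, mul_inv_eq_one, mul_eq_left] at e
    rw [e, orderOf_one] at hz
    omega
  · rw [← e, pow_one]

omit t in
theorem half_ne_one {h : ℕ} (hh : orderOf c = 2 * h) : c ^ h ≠ 1 := by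
  intro e
  have h0 : 0 < h := by have := orderOf_pos c; omega
  have := Nat.le_of_dvd h0 (orderOf_dvd_of_pow_eq_one e)
  omega

theorem mem_of_commute_half {h : ℕ} (hh : orderOf c = 2 * h) {x : X}
    (hx : x * c ^ h * x⁻¹ = c ^ h) : x ∈ H := by
  by_contra hn
  exact half_ne_one hh (t.eq_one_of_conj hn ⟨h, by simp⟩ (by rw [hx]; exact ⟨h, by simp⟩))

/-- The case of an even number of cosets and even order of `c` reduces to an involution fixing a
second coset. -/
theorem false_of_double_coset {h : ℕ} (hh : orderOf c = 2 * h) (hn : Even (orderOf a)) {u : X}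
    (hu : ∀ x ∉ H, ∃ p ∈ H, ∃ q ∈ H, x = p * u * q) : False := by
  set z := c ^ h with hz
  have hzH : z ∈ H := H.pow_mem t.c_mem h
  have hz2 : z ^ 2 = 1 := by rw [hz, ← pow_mul, mul_comm, ← hh, pow_orderOf_eq_one]
  obtain ⟨x, hx, hxz⟩ : ∃ x ∉ H, x⁻¹ * z * x ∈ H := by
    by_contra! hno
    obtain ⟨s, hs, -⟩ := H.exists_index_eq_and_cosetSign_eq hz2 (by
      intro x j hj
      by_cases hx : x ∈ H
      · exact Or.inl (H.mul_mem (H.mul_mem (H.inv_mem hx) hzH) hx)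
      · right
        by_contra hodd
        rw [Nat.two_dvd_ne_zero, ← Nat.odd_iff] at hodd
        obtain ⟨i, rfl⟩ := hodd
        rw [pow_add, pow_mul, hz2, one_pow, one_mul, pow_one] at hj
        exact hno x hx hj)
    have hfix : {q : X ⧸ H | z • q = q} = {((1 : X) : X ⧸ H)} := by
      ext q
      obtain ⟨x, rfl⟩ := QuotientGroup.mk_surjective q
      rw [Set.mem_ofPred_eq, Set.mem_singleton_iff, Subgroup.smul_mk_eq_mk_iff, eq_comm,
        QuotientGroup.eq, inv_one, one_mul]
      constructor
      · intro hx
        by_contra hx'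
        exact hno x hx' hx
      · intro hx
        exact H.mul_mem (H.mul_mem (H.inv_mem hx) hzH) hx
    rw [hfix, Set.ncard_singleton, t.index_eq] at hs
    rw [hs] at hn
    exact (Nat.not_even_iff_odd.2 ⟨s, by ring⟩) hn
  have hc' : ∀ p ∈ H, p⁻¹ * z * p = z := by
    intro p hp
    have := t.conj_half hh (H.inv_mem hp)
    rwa [inv_inv] at this
  have hu' : ∀ p u' q : X, p ∈ H → q ∈ H →
      (p * u' * q)⁻¹ * z * (p * u' * q) = q⁻¹ * (u'⁻¹ * z * u') * q := by
    intro p u' q hp hq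
    calc _ = q⁻¹ * (u'⁻¹ * (p⁻¹ * z * p) * u') * q := by group
      _ = _ := by rw [hc' p hp]
  have huz : u⁻¹ * z * u ∈ H := by
    obtain ⟨p, hp, q, hq, rfl⟩ := hu x hx
    rw [hu' p u q hp hq] at hxz
    rwa [H.mul_mem_cancel_right hq, H.mul_mem_cancel_left (H.inv_mem hq)] at hxz
  apply half_ne_one hh
  apply t.eq_one_of_forall_conj_mem
  intro x
  by_cases hx : x⁻¹ ∈ H
  · have := hc' _ hx
    rw [inv_inv] at this
    rw [this]; exact hzH
  · obtain ⟨p, hp, q, hq, e⟩ := hu _ hx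
    have := hu' p u q hp hq
    rw [← e, inv_inv] at this
    rw [this, H.mul_mem_cancel_right hq, H.mul_mem_cancel_left (H.inv_mem hq)]
    exact huz

end ThinMaximal
end DihedralCyclic

theorem Finset.exists_fixed_of_odd_card {α : Type*} [DecidableEq α] (s : Finset α) (f : α → α)
    (hs : Odd s.card) (hmem : ∀ x ∈ s, f x ∈ s) (hinv : ∀ x ∈ s, f (f x) = x) :
    ∃ x ∈ s, f x = x := by
  by_contra! hno
  have h1 : ∑ _x ∈ s, (1 : ZMod 2) = 0 := by
    refine Finset.sum_involution (fun x _ => f x) ?_ ?_ hmem hinv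
    · intro x _; decide
    · intro x hx _; exact hno x hx
  rw [Finset.sum_const, nsmul_eq_mul, mul_one, ZMod.natCast_eq_zero_iff_even] at h1
  exact (Nat.not_even_iff_odd.2 hs) h1

theorem IsCoatom.mul_mem_of_mul_mem {X : Type*} [Group X] [Finite X] {H : Subgroup X}
    (hH : IsCoatom H) {S : Set X} (hHS : ∀ y ∈ H, ∀ x ∈ S, y * x ∈ S) {g : X} (hg : g ∉ H)
    (hgS : ∀ x ∈ S, g * x ∈ S) (y : X) : ∀ x ∈ S, y * x ∈ S := by
  let K : Submonoid X :=
    { carrier := {y | ∀ x ∈ S, y * x ∈ S}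
      one_mem' := fun x hx => by rwa [one_mul]
      mul_mem' := fun {p q} hp hq x hx => by rw [mul_assoc]; exact hp _ (hq x hx) }
  have hpow : ∀ p ∈ K, p⁻¹ ∈ K := by
    intro p hp
    have : p⁻¹ ∈ Submonoid.powers p := by
      rw [mem_powers_iff_mem_zpowers]
      exact inv_mem (Subgroup.mem_zpowers p)
    exact (Submonoid.powers_le.2 hp) this
  let K' : Subgroup X := { K with inv_mem' := fun {p} hp => hpow p hp }
  have : K' = ⊤ := hH.2 K' (lt_of_le_of_ne hHS (by rintro rfl; exact hg hgS))
  have hy : y ∈ K' := by rw [this]; trivial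
  exact hy

/-- If a maximal subgroup `H` has a cyclic complement of even order, then it has only two double
cosets. -/
theorem Subgroup.exists_eq_mul_mul_of_isCoatom {X : Type*} [Group X] [Finite X] {H : Subgroup X}
    (hH : IsCoatom H) {a : X} (hA : IsComplement' (zpowers a) H) {r : ℕ}
    (hr : orderOf a = 2 * r) (x : X) (hx : x ∉ H) :
    ∃ p ∈ H, ∃ q ∈ H, x = p * a ^ r * q := by
  classical
  have := Fintype.ofFinite X
  have hdisj : ∀ s ∈ zpowers a, s ∈ H → s = 1 := fun s h1 h2 => disjoint_def.1 hA.disjoint h1 h2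
  have hcomm : ∀ s ∈ zpowers a, ∀ t ∈ zpowers a, s * t = t * s := by
    rintro _ ⟨i, rfl⟩ _ ⟨j, rfl⟩
    exact ((Commute.refl a).zpow_zpow i j).eq
  have hdec : ∀ y : X, ∃ s ∈ zpowers a, ∃ q ∈ H, y = s * q := by
    intro y
    obtain ⟨⟨⟨s, hs⟩, ⟨q, hq⟩⟩, e⟩ := hA.2 y
    exact ⟨s, hs, q, hq, e.symm⟩
  have hdec' : ∀ y : X, ∃ s ∈ zpowers a, ∃ q ∈ H, y = q * s := by
    intro y
    obtain ⟨s, hs, q, hq, e⟩ := hdec y⁻¹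
    exact ⟨s⁻¹, inv_mem hs, q⁻¹, inv_mem hq, by rw [← mul_inv_rev, ← e, inv_inv]⟩
  have hsq : ∀ s ∈ zpowers a, s * s = 1 → s = 1 ∨ s = a ^ r := by
    intro s hs hs1
    rw [mem_zpowers_iff_mem_range_orderOf] at hs
    simp only [Finset.mem_image, Finset.mem_range] at hs
    obtain ⟨i, hi, rfl⟩ := hs
    rw [← pow_add] at hs1
    have h2 := orderOf_dvd_of_pow_eq_one hs1
    rw [hr] at h2 hi
    rw [← two_mul] at h2
    have h3 := (Nat.mul_dvd_mul_iff_left (by norm_num)).1 h2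
    obtain ⟨k, rfl⟩ := h3
    have hk : k < 2 := by
      by_contra hk
      have := Nat.mul_le_mul_left r (Nat.le_of_not_lt hk)
      omega
    interval_cases k
    · left; simp
    · right; simp
  have hu0 : a ^ r ∉ H := by
    intro hu
    have := orderOf_dvd_of_pow_eq_one (hdisj _ ⟨r, by simp⟩ hu)
    have h0 := orderOf_pos a
    rw [hr] at this h0
    have := Nat.le_of_dvd (by omega) this
    omega
  have hu2 : a ^ r * a ^ r = 1 := by rw [← pow_add, ← two_mul, ← hr, pow_orderOf_eq_one]
  set T : Set X := {y | ∃ p ∈ H, ∃ q ∈ H, y = p * x * q} with hTdef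
  have hTl : ∀ p ∈ H, ∀ y, p * y ∈ T ↔ y ∈ T := by
    have h1 : ∀ p ∈ H, ∀ y, y ∈ T → p * y ∈ T := by
      rintro p hp _ ⟨p', hp', q, hq, rfl⟩
      exact ⟨p * p', mul_mem hp hp', q, hq, by group⟩
    intro p hp y
    refine ⟨fun hy => ?_, h1 p hp y⟩
    have := h1 _ (inv_mem hp) _ hy
    rwa [inv_mul_cancel_left] at this
  have hTr : ∀ q ∈ H, ∀ y, y * q ∈ T ↔ y ∈ T := by
    have h1 : ∀ q ∈ H, ∀ y, y ∈ T → y * q ∈ T := by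
      rintro q hq _ ⟨p', hp', q', hq', rfl⟩
      exact ⟨p', hp', q' * q, mul_mem hq' hq, by group⟩
    intro q hq y
    refine ⟨fun hy => ?_, h1 q hq y⟩
    have := h1 _ (inv_mem hq) _ hy
    rwa [mul_inv_cancel_right] at this
  have hT1 : (1 : X) ∉ T := by
    rintro ⟨p, hp, q, hq, e⟩
    apply hx
    have : x = p⁻¹ * q⁻¹ := by
      calc x = p⁻¹ * (p * x * q) * q⁻¹ := by group
        _ = _ := by rw [← e]; group
    rw [this]
    exact mul_mem (inv_mem hp) (inv_mem hq)
  have hxT : x ∈ T := ⟨1, one_mem _, 1, one_mem _, by group⟩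
  suffices hu : a ^ r ∈ T by
    obtain ⟨p, hp, q, hq, e⟩ := hu
    exact ⟨p⁻¹, inv_mem hp, q⁻¹, inv_mem hq, by rw [e]; group⟩
  -- the number of factorisations of an element through rotations in `T`
  let F : X → Finset X := fun y => Finset.univ.filter fun s => s ∈ zpowers a ∧ s ∈ T ∧ s⁻¹ * y ∈ T
  have hF : ∀ y s, s ∈ F y ↔ s ∈ zpowers a ∧ s ∈ T ∧ s⁻¹ * y ∈ T := by
    intro y s; simp [F]
  have hFr : ∀ q ∈ H, ∀ y, F (y * q) = F y := by
    intro q hq y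
    ext s
    rw [hF, hF, ← mul_assoc, hTr q hq]
  have hFl : ∀ p ∈ H, ∀ y, (F (p * y)).card = (F y).card := by
    have hle : ∀ p ∈ H, ∀ y, (F y).card ≤ (F (p * y)).card := by
      intro p hp y
      choose f hf g hg hfg using hdec
      refine Finset.card_le_card_of_injOn (fun s => f (p * s)) ?_ ?_
      · intro s hs
        obtain ⟨h1, h2, h3⟩ := (hF _ _).1 hs
        refine (hF _ _).2 ⟨hf _, ?_, ?_⟩
        · rw [← hTr _ (hg (p * s)), ← hfg, hTl p hp]; exact h2
        · rw [← hTl _ (inv_mem (hg (p * s)))]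
          have : (g (p * s))⁻¹ * ((f (p * s))⁻¹ * (p * y)) = (f (p * s) * g (p * s))⁻¹ * (p * y) := by
            group
          rw [this, ← hfg]
          have : (p * s)⁻¹ * (p * y) = s⁻¹ * y := by group
          rwa [this]
      · intro s hs s' hs' e
        simp only at e
        have h1 := hfg (p * s)
        have h2 := hfg (p * s')
        rw [e] at h1
        have h3 : s'⁻¹ * s = (g (p * s'))⁻¹ * g (p * s) := by
          calc s'⁻¹ * s = (p * s')⁻¹ * (p * s) := by group
            _ = (f (p * s') * g (p * s'))⁻¹ * (f (p * s') * g (p * s)) := by rw [← h1, ← h2]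
            _ = _ := by group
        have h4 := hdisj (s'⁻¹ * s) (mul_mem (inv_mem ((hF _ _).1 hs').1) ((hF _ _).1 hs).1)
          (by rw [h3]; exact mul_mem (inv_mem (hg _)) (hg _))
        exact (inv_mul_eq_one.1 h4).symm
    intro p hp y
    refine le_antisymm ?_ (hle p hp y)
    have := hle _ (inv_mem hp) (p * y)
    rwa [inv_mul_cancel_left] at this
  have hmap : ∀ y ∈ zpowers a, ∀ s ∈ F y, s⁻¹ * y ∈ F y := by
    intro y hy s hs
    obtain ⟨h1, h2, h3⟩ := (hF _ _).1 hs
    refine (hF _ _).2 ⟨mul_mem (inv_mem h1) hy, h3, ?_⟩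
    rw [hcomm _ (inv_mem h1) _ hy]
    have : (y * s⁻¹)⁻¹ * y = s := by group
    rwa [this]
  have hinv : ∀ y ∈ zpowers a, ∀ s ∈ F y, (s⁻¹ * y)⁻¹ * y = s := by
    intro y hy s hs
    rw [hcomm _ (inv_mem ((hF _ _).1 hs).1) _ hy]; group
  have hodd : ∀ y ∈ zpowers a, Odd (F y).card → ∃ s ∈ zpowers a, y = s * s := by
    intro y hy ho
    obtain ⟨s, hs, e⟩ := Finset.exists_fixed_of_odd_card (F y) (fun s => s⁻¹ * y) ho
      (hmap y hy) (hinv y hy)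
    refine ⟨s, ((hF _ _).1 hs).1, ?_⟩
    rw [inv_mul_eq_iff_eq_mul] at e
    exact e
  have heven : ∀ y, y ∉ H → ¬ Odd (F y).card := by
    intro w hw ho
    let S : Set X := {y | ∃ q ∈ H, ∃ s ∈ zpowers a, y = q * (s * s)}
    have hS := hH.mul_mem_of_mul_mem (S := S) (by
        rintro p hp _ ⟨q, hq, s, hs, rfl⟩
        exact ⟨p * q, mul_mem hp hq, s, hs, by group⟩) hw (by
        rintro _ ⟨q, hq, s, hs, rfl⟩
        obtain ⟨s', hs', q', hq', e⟩ := hdec' (w * q)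
        have ho' : Odd (F s').card := by
          have h1 : s' = q'⁻¹ * (w * q) := by rw [e]; group
          rw [h1, hFl _ (inv_mem hq'), hFr q hq]; exact ho
        obtain ⟨s'', hs'', rfl⟩ := hodd s' hs' ho'
        refine ⟨q', hq', s'' * s, mul_mem hs'' hs, ?_⟩
        rw [← mul_assoc, e, mul_assoc, mul_assoc s'' s, hcomm s hs (s'' * s) (mul_mem hs'' hs)]
        group)
    obtain ⟨q, hq, s, hs, e⟩ := hS a 1 ⟨1, one_mem _, 1, one_mem _, by group⟩
    rw [mul_one] at e
    have h1 : q = a * (s * s)⁻¹ := by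
      calc q = (q * (s * s)) * (s * s)⁻¹ := by group
        _ = _ := by rw [← e]
    have h2 := hdisj q (by rw [h1]; exact mul_mem (mem_zpowers a) (inv_mem (mul_mem hs hs))) hq
    rw [h2, one_mul] at e
    obtain ⟨i, rfl⟩ := hs
    simp only at e
    rw [← zpow_add] at e
    have h3 : a ^ (i + i - 1) = 1 := by rw [zpow_sub, ← e]; simp
    have h4 := orderOf_dvd_iff_zpow_eq_one.2 h3
    rw [hr] at h4
    push_cast at h4
    have h5 := (Dvd.intro _ rfl : (2 : ℤ) ∣ 2 * (r : ℤ)).trans h4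
    omega
  by_contra hu
  have hstep : ∀ s ∈ zpowers a, s ∈ T → a ^ r * s ∈ T := by
    intro s hs hsT
    by_contra hns
    have hs2 : s * s ∉ H := by
      intro hm
      rcases hsq s hs (hdisj _ (mul_mem hs hs) hm) with rfl | rfl
      · exact hT1 hsT
      · exact hu hsT
    have hy : s * s ∈ zpowers a := mul_mem hs hs
    have hsF : s ∈ F (s * s) := (hF _ _).2 ⟨hs, hsT, by rwa [inv_mul_cancel_left]⟩
    have ho : Odd ((F (s * s)).erase s).card := by
      rw [Finset.card_erase_of_mem hsF]
      have := heven _ hs2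
      rw [Nat.not_odd_iff_even] at this
      have hpos := Finset.card_pos.2 ⟨s, hsF⟩
      obtain ⟨k, hk⟩ := this
      exact ⟨k - 1, by omega⟩
    obtain ⟨v, hv, e⟩ := Finset.exists_fixed_of_odd_card _ (fun v => v⁻¹ * (s * s)) ho (by
        intro v hv
        rw [Finset.mem_erase] at hv ⊢
        refine ⟨?_, hmap _ hy v hv.2⟩
        intro e
        apply hv.1
        rw [inv_mul_eq_iff_eq_mul, mul_right_cancel_iff] at e
        exact e.symm) (fun v hv => hinv _ hy v (Finset.mem_of_mem_erase hv))
    rw [Finset.mem_erase] at hv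
    have hvA := ((hF _ _).1 hv.2).1
    rw [inv_mul_eq_iff_eq_mul] at e
    have h2 : (v * s⁻¹) * (v * s⁻¹) = 1 := by
      calc (v * s⁻¹) * (v * s⁻¹) = v * (s⁻¹ * v) * s⁻¹ := by group
        _ = v * (v * s⁻¹) * s⁻¹ := by rw [hcomm _ (inv_mem hs) _ hvA]
        _ = (v * v) * (s * s)⁻¹ := by group
        _ = 1 := by rw [← e, mul_inv_cancel]
    rcases hsq _ (mul_mem hvA (inv_mem hs)) h2 with h3 | h3
    · exact hv.1 (mul_inv_eq_one.1 h3)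
    · apply hns
      rw [← h3, inv_mul_cancel_right]
      exact ((hF _ _).1 hv.2).2.1
  have hall := hH.mul_mem_of_mul_mem (S := T) (fun p hp y hy => (hTl p hp y).2 hy) hu0 (by
    intro y hy
    obtain ⟨s, hs, q, hq, rfl⟩ := hdec y
    rw [← mul_assoc, hTr q hq]
    exact hstep s hs ((hTr q hq s).1 hy)) x⁻¹ x hxT
  rw [inv_mul_cancel] at hall
  exact hT1 hall

namespace DihedralCyclic
namespace ThinMaximal

variable {X : Type*} [Group X] {a b c : X} {H : Subgroup X} [Finite X]
  (t : ThinMaximal a b c H)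
include t

theorem false_of_even_of_even (hn : Even (orderOf a)) (hm : Even (orderOf c)) : False := by
  obtain ⟨r, hr⟩ := id hn
  obtain ⟨h, hh⟩ := hm
  exact t.false_of_double_coset (h := h) (by omega) hn (u := a ^ r)
    (Subgroup.exists_eq_mul_mul_of_isCoatom t.coatom t.isComplement (by omega))

theorem eq_of_even_of_odd (hn : Even (orderOf a)) (hm : Odd (orderOf c)) :
    orderOf a = 4 ∧ orderOf c = 3 := by
  have hconj : ∀ (x : X) (j : ℕ), x⁻¹ * a ^ j * x ∈ H → a ^ j = 1 := by
    intro x j hj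
    obtain ⟨i, y, hy, rfl⟩ := t.exists_rot_mul x
    have : (a ^ i * y)⁻¹ * a ^ j * (a ^ i * y) = y⁻¹ * (a ^ (-i) * a ^ (j : ℤ) * a ^ i) * y := by
      rw [zpow_natCast]; group
    rw [this, H.mul_mem_cancel_right hy, H.mul_mem_cancel_left (H.inv_mem hy), ← zpow_add,
      ← zpow_add] at hj
    have := t.rot_mem _ hj
    rw [← zpow_natCast, ← this]; congr 1; ring
  have hsa : H.cosetSign a = -1 := by
    obtain ⟨s, hs, hsign⟩ := H.exists_index_eq_and_cosetSign_eq (pow_orderOf_eq_one a)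
      (fun x j hj => Or.inr (orderOf_dvd_of_pow_eq_one (hconj x j hj)))
    have hfix : {q : X ⧸ H | a • q = q} = ∅ := by
      rw [Set.eq_empty_iff_forall_notMem]
      intro q hq
      obtain ⟨x, rfl⟩ := QuotientGroup.mk_surjective q
      rw [Set.mem_ofPred_eq, Subgroup.smul_mk_eq_mk_iff] at hq
      exact t.a_ne_one (by simpa using hconj x 1 (by simpa using hq))
    rw [hfix, Set.ncard_empty, t.index_eq, zero_add] at hs
    have hs1 : s = 1 := Nat.eq_of_mul_eq_mul_right (orderOf_pos a) (by rw [one_mul]; exact hs.symm)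
    rw [hsign, hs1, one_mul]
    exact (hn.add_one).neg_one_pow
  have hsc : H.cosetSign c = 1 := by
    have h1 : (H.cosetSign c) ^ orderOf c = 1 := by rw [← map_pow, pow_orderOf_eq_one, map_one]
    rcases Int.units_eq_one_or (H.cosetSign c) with e | e
    · exact e
    · rw [e, hm.neg_one_pow] at h1
      exact absurd h1 (by decide)
  have hsb : H.cosetSign b = -1 := by
    rcases Int.units_eq_one_or (H.cosetSign b) with e | e
    · exfalso
      have hle : H ≤ (H.cosetSign).ker := by
        intro x hx
        rw [MonoidHom.mem_ker]
        obtain ⟨k, rfl | rfl⟩ := t.mem_cases hx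
        · rw [map_zpow, hsc, one_zpow]
        · rw [map_mul, map_zpow, hsc, one_zpow, e, one_mul]
      have hker : (H.cosetSign).ker = H := by
        by_contra hne
        have := t.coatom.2 _ (lt_of_le_of_ne hle (Ne.symm hne))
        have ha : a ∈ (H.cosetSign).ker := by rw [this]; trivial
        rw [MonoidHom.mem_ker, hsa] at ha
        exact absurd ha (by decide)
      have := t.eq_bot_of_le hker.le
      have hc := t.c_mem
      rw [← hker, this] at hc
      exact t.c_ne_one (Subgroup.mem_bot.1 hc)
    · exact e
  set K := (H.cosetSign).ker with hK
  have hcK : c ∈ K := hsc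
  have hCK : Subgroup.zpowers c ≤ K := Subgroup.zpowers_le.2 hcK
  have hKH : ∀ x ∈ K, x ∈ H → x ∈ Subgroup.zpowers c := by
    intro x hx hxH
    obtain ⟨k, rfl | rfl⟩ := t.mem_cases hxH
    · exact ⟨k, rfl⟩
    · exfalso
      rw [hK, MonoidHom.mem_ker, map_mul, map_zpow, hsc, one_zpow, hsb] at hx
      exact absurd hx (by decide)
  have hzp : ∀ y : K, y ∈ Subgroup.zpowers (⟨c, hcK⟩ : K) ↔ (y : X) ∈ Subgroup.zpowers c := by
    intro y
    constructor
    · rintro ⟨k, rfl⟩; exact ⟨k, by simp⟩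
    · rintro ⟨k, hk⟩; exact ⟨k, Subtype.ext (by simpa using hk)⟩
  have hnorm : ((t.dc.dihedral).subgroupOf K).Normal := by
    refine Subgroup.normal_of_isComplement'_zpowers (c := (⟨c, hcK⟩ : K)) ?_ ?_
    · apply Subgroup.isComplement'_of_disjoint_and_mul_eq_univ
      · rw [Subgroup.disjoint_def]
        intro y hy hyc
        rw [hzp] at hyc
        exact Subtype.ext (Subgroup.disjoint_def.1 t.dc.dihedral_isComplement.disjoint hy hyc)
      · rw [Set.eq_univ_iff_forall]
        rintro ⟨x, hx⟩
        obtain ⟨⟨⟨d, hd⟩, ⟨y, hy⟩⟩, e⟩ := t.dc.dihedral_isComplement.2 x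
        simp only at e
        have hdK : d ∈ K := by
          rwa [← e, K.mul_mem_cancel_right (hCK hy)] at hx
        exact ⟨⟨d, hdK⟩, hd, ⟨y, hCK hy⟩, (hzp _).2 hy, Subtype.ext e⟩
    · intro x hx y hy hxy
      rw [hzp] at hx hy hxy
      exact Subtype.ext (t.eq_one_of_conj (fun hxH => hx (hKH x x.2 hxH)) hy hxy)
  have haD : a ∈ t.dc.dihedral := ⟨1, Or.inl (by simp)⟩
  have hnormX : (t.dc.dihedral ⊓ K).Normal := by
    have h1 : ∀ x ∈ K, ∀ d ∈ t.dc.dihedral ⊓ K, x * d * x⁻¹ ∈ t.dc.dihedral ⊓ K := by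
      rintro x hx d ⟨hd, hdK⟩
      exact ⟨hnorm.conj_mem ⟨d, hdK⟩ hd ⟨x, hx⟩, K.mul_mem (K.mul_mem hx hdK) (K.inv_mem hx)⟩
    refine ⟨fun d hd x => ?_⟩
    rcases Int.units_eq_one_or (H.cosetSign x) with e | e
    · exact h1 x e d hd
    · have hax : a⁻¹ * x ∈ K := by
        rw [hK, MonoidHom.mem_ker, map_mul, map_inv, hsa, e]; decide
      have h2 := h1 _ hax d hd
      have h3 : x * d * x⁻¹ = a * ((a⁻¹ * x) * d * (a⁻¹ * x)⁻¹) * a⁻¹ := by group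
      rw [h3]
      refine ⟨t.dc.dihedral.mul_mem (t.dc.dihedral.mul_mem haD h2.1)
        (t.dc.dihedral.inv_mem haD), ?_⟩
      exact (MonoidHom.normal_ker _).conj_mem _ h2.2 a
  have ha4 := t.dc.sq_eq_one_of_normal_le_dihedral (L := t.dc.dihedral ⊓ K) inf_le_left (j := 2)
    ⟨⟨2, Or.inl rfl⟩, by
      change a ^ (2 : ℤ) ∈ K
      rw [hK, MonoidHom.mem_ker, map_zpow, hsa]; decide⟩
  have hn4 : orderOf a ∣ 4 := orderOf_dvd_of_pow_eq_one (by exact_mod_cast ha4)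
  have hfact := H.card_dvd_factorial_index t.core
  rw [t.dc.card_eq, t.index_eq] at hfact
  have hm1 : orderOf c ≠ 1 := by
    rw [ne_eq, orderOf_eq_one_iff]; exact t.c_ne_one
  have hle := Nat.le_of_dvd (by norm_num) hn4
  have hpos := orderOf_pos a
  have hcases : orderOf a = 2 ∨ orderOf a = 4 := by
    interval_cases orderOf a <;> revert hn hn4 <;> decide
  rcases hcases with e | e
  · exfalso
    rw [e] at hfact
    have h4 : 4 ∣ 2 := (Dvd.intro (orderOf c) rfl).trans hfact
    omega
  · rw [e] at hfact
    have h3 : 8 * orderOf c ∣ 8 * 3 := hfact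
    have h3 := (Nat.mul_dvd_mul_iff_left (by norm_num)).1 h3
    exact ⟨e, ((Nat.dvd_prime Nat.prime_three).1 h3).resolve_left hm1⟩

end ThinMaximal
end DihedralCyclic

namespace DihedralCyclic
namespace ThinMaximal

variable {X : Type*} [Group X] {a b c : X} {H : Subgroup X} (t : ThinMaximal a b c H) [Finite X]
include t

theorem ncard_fixed_eq_two {y : X} (hy : y ∈ Subgroup.zpowers c) (hy1 : y ≠ 1) :
    {q : X ⧸ Subgroup.zpowers c | y • q = q}.ncard = 2 := by
  have : {q : X ⧸ Subgroup.zpowers c | y • q = q} =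
      {((1 : X) : X ⧸ Subgroup.zpowers c), ((b : X) : X ⧸ Subgroup.zpowers c)} := by
    ext q
    obtain ⟨x, rfl⟩ := QuotientGroup.mk_surjective q
    rw [Set.mem_ofPred_eq, Set.mem_insert_iff, Set.mem_singleton_iff, Subgroup.smul_mk_eq_mk_iff,
      eq_comm (a := (x : X ⧸ Subgroup.zpowers c)), eq_comm (a := (x : X ⧸ Subgroup.zpowers c)),
      QuotientGroup.eq, QuotientGroup.eq, inv_one, one_mul, t.dc.b_inv]
    constructor
    · intro hx
      have hxH : x ∈ H := by
        by_contra hx'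
        exact hy1 (t.eq_one_of_conj (x := x⁻¹) (by simpa using hx') hy (by simpa using hx))
      obtain ⟨k, rfl | rfl⟩ := t.mem_cases hxH
      · exact Or.inl ⟨k, rfl⟩
      · right
        rw [← mul_assoc, t.dc.sq, one_mul]
        exact ⟨k, rfl⟩
    · have key : ∀ x ∈ H, x⁻¹ * y * x ∈ Subgroup.zpowers c := fun x hx => by
        simpa using t.conj_mem (H.inv_mem hx) hy
      rintro (hx | hx)
      · exact key x (t.zpowers_le hx)
      · exact key x ((H.mul_mem_cancel_left t.b_mem).1 (t.zpowers_le hx))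
  rw [this, Set.ncard_pair]
  rw [ne_eq, QuotientGroup.eq, inv_one, one_mul]
  exact t.dc.b_notMem

omit t [Finite X] in
theorem eq_half_of_pow {h j : ℕ} (hh : orderOf c = 2 * h) (hj : c ^ j * c ^ j = 1) :
    c ^ j = 1 ∨ c ^ j = c ^ h := by
  rw [← pow_add] at hj
  have h1 := orderOf_dvd_of_pow_eq_one hj
  rw [hh, ← two_mul] at h1
  obtain ⟨i, rfl⟩ := (Nat.mul_dvd_mul_iff_left (by norm_num)).1 h1
  have h2 : c ^ h * c ^ h = 1 := by
    rw [← pow_add, ← two_mul, ← hh, pow_orderOf_eq_one]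
  rcases Nat.even_or_odd' i with ⟨r, rfl | rfl⟩
  · left
    rw [← mul_assoc, mul_comm h, pow_mul, ← hh, pow_orderOf_eq_one, one_pow]
  · right
    rw [mul_add, pow_add, ← mul_assoc, mul_comm h, pow_mul, ← hh, pow_orderOf_eq_one, one_pow,
      one_mul, mul_one]

omit t in
theorem eq_half_of_mem {h : ℕ} (hh : orderOf c = 2 * h) {y : X} (hy : y ∈ Subgroup.zpowers c)
    (hyy : y * y = 1) : y = 1 ∨ y = c ^ h := by
  obtain ⟨j, rfl⟩ := (mem_powers_iff_mem_zpowers.2 hy)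
  exact eq_half_of_pow hh hyy

theorem exists_conj_half_of_odd (hn : Odd (orderOf a)) :
    ∃ h s : ℕ, orderOf c = 2 * h ∧ Even h ∧ Odd s ∧ orderOf a = 1 + s * h ∧
      ∃ x ∉ H, ∃ j : ℤ, Odd j ∧ x * c ^ h * x⁻¹ = b * c ^ j := by
  set ε := (Subgroup.zpowers c).cosetSign with hε
  have hunit : ∀ {u : ℤˣ} {r : ℕ}, Odd r → u ^ r = 1 → u = 1 := by
    intro u r hr hu
    rcases Int.units_eq_one_or u with rfl | rfl
    · rfl
    · rw [hr.neg_one_pow] at hu; exact absurd hu (by decide)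
  have hb : ε b = -1 := by
    have hbD : b ∈ t.dc.dihedral := ⟨0, Or.inr (by simp)⟩
    have hb1 : b ≠ 1 := fun e => t.dc.b_notMem (by rw [e]; exact one_mem _)
    have hno : ∀ x : X, x⁻¹ * b * x ∉ Subgroup.zpowers c := fun x hx =>
      hb1 (t.dc.eq_one_of_conj_mem hbD hx)
    have hb2 : b ^ 2 = 1 := by rw [pow_two, t.dc.sq]
    obtain ⟨s, hs, hsign⟩ := (Subgroup.zpowers c).exists_index_eq_and_cosetSign_eq hb2 (by
      intro x j hj
      right
      by_contra hodd
      rw [Nat.two_dvd_ne_zero, ← Nat.odd_iff] at hodd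
      obtain ⟨i, rfl⟩ := hodd
      rw [pow_add, pow_mul, hb2, one_pow, one_mul, pow_one] at hj
      exact hno x hj)
    have hfix : {q : X ⧸ Subgroup.zpowers c | b • q = q} = ∅ := by
      ext q
      obtain ⟨x, rfl⟩ := QuotientGroup.mk_surjective q
      rw [Set.mem_ofPred_eq, Subgroup.smul_mk_eq_mk_iff]
      simpa using hno x
    rw [hfix, Set.ncard_empty, t.dc.index_zpowers] at hs
    have : s = orderOf a := by omega
    rw [hε, hsign, this]
    exact (hn.mul (by decide)).neg_one_pow
  have ha : ε a = 1 := hunit hn (by rw [← map_pow, pow_orderOf_eq_one, map_one])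
  have hc : ε c = -1 := by
    rcases Int.units_eq_one_or (ε c) with e | e
    · exfalso
      have := t.dc.min ε.ker (by rw [MonoidHom.mem_ker, e]) (by
        intro j hj
        rw [MonoidHom.mem_ker, map_mul, map_zpow, ha, hb, one_zpow] at hj
        exact absurd hj (by decide)) (show a ∈ ε.ker by rw [MonoidHom.mem_ker, ha])
      have := t.dc.eq_one_of_mem (j := 1) (by simpa using this)
      exact t.a_ne_one (by simpa using this)
    · exact e
  have hm : Even (orderOf c) := by
    by_contra hodd
    rw [Nat.not_even_iff_odd] at hodd
    have := hunit hodd (u := ε c) (by rw [← map_pow, pow_orderOf_eq_one, map_one])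
    rw [hc] at this
    exact absurd this (by decide)
  obtain ⟨h, hh⟩ := hm
  rw [← two_mul] at hh
  have hz1 : c ^ h ≠ 1 := half_ne_one hh
  have hz2 : (c ^ h) ^ 2 = 1 := by rw [← pow_mul, mul_comm, ← hh, pow_orderOf_eq_one]
  have hzC : c ^ h ∈ Subgroup.zpowers c := ⟨h, by simp⟩
  have hkC : ∀ x ∈ H, ∀ y ∈ Subgroup.zpowers c, x⁻¹ * y * x ∈ Subgroup.zpowers c :=
    fun x hx y hy => by simpa using t.conj_mem (H.inv_mem hx) hy
  have hC1 : ∀ x ∉ H, ∀ y ∈ Subgroup.zpowers c, x⁻¹ * y * x ∈ Subgroup.zpowers c → y = 1 :=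
    fun x hx y hy hxy => t.eq_one_of_conj (x := x⁻¹) (by simpa using hx) hy (by simpa using hxy)
  have hez : ε (c ^ h) = 1 := by
    obtain ⟨s, hs, hsign⟩ := (Subgroup.zpowers c).exists_index_eq_and_cosetSign_eq hz2 (by
      intro x j hj
      by_cases hx : x ∈ H
      · exact Or.inl (hkC x hx _ hzC)
      · right
        have h1 := hC1 x hx _ (pow_mem hzC j) hj
        by_contra hodd
        rw [Nat.two_dvd_ne_zero, ← Nat.odd_iff] at hodd
        obtain ⟨i, rfl⟩ := hodd
        rw [pow_add, pow_mul, hz2, one_pow, one_mul, pow_one] at h1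
        exact hz1 h1)
    rw [t.ncard_fixed_eq_two hzC hz1, t.dc.index_zpowers] at hs
    have hse : Even s := by
      obtain ⟨r, hr⟩ := hn
      exact ⟨r, by omega⟩
    rw [hε, hsign]
    exact (hse.mul_right _).neg_one_pow
  have hhe : Even h := by
    by_contra hodd
    rw [Nat.not_even_iff_odd] at hodd
    rw [map_pow, hc, hodd.neg_one_pow] at hez
    exact absurd hez (by decide)
  obtain ⟨s, hs, hsign⟩ := (Subgroup.zpowers c).exists_index_eq_and_cosetSign_eq
    (pow_orderOf_eq_one c) (by
      intro x j hj
      by_cases hx : x ∈ H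
      · exact Or.inl (hkC x hx _ (Subgroup.mem_zpowers c))
      · exact Or.inr (orderOf_dvd_of_pow_eq_one
          (hC1 x hx _ (pow_mem (Subgroup.mem_zpowers c) j) hj)))
  rw [t.ncard_fixed_eq_two (Subgroup.mem_zpowers c) t.c_ne_one, t.dc.index_zpowers, hh] at hs
  have hso : Odd s := by
    by_contra hev
    rw [Nat.not_odd_iff_even] at hev
    rw [← hε, hc, (hev.mul_right _).neg_one_pow] at hsign
    exact absurd hsign (by decide)
  have hns : orderOf a = 1 + s * h := by
    have : s * (2 * h) = 2 * (s * h) := by ring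
    omega
  refine ⟨h, s, hh, hhe, hso, hns, ?_⟩
  obtain ⟨x, hx, hxz⟩ : ∃ x ∉ H, x * c ^ h * x⁻¹ ∈ H := by
    by_contra! hno
    obtain ⟨r, hr, -⟩ := H.exists_index_eq_and_cosetSign_eq (pow_orderOf_eq_one c) (by
      intro x j hj
      by_cases hx : x ∈ H
      · exact Or.inl (H.mul_mem (H.mul_mem (H.inv_mem hx) t.c_mem) hx)
      · right
        have hx' : x⁻¹ ∉ H := by simpa using hx
        have hsq := t.sq_eq_one_of_conj hx' (H.pow_mem t.c_mem j) (by simpa using hj)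
        rcases eq_half_of_pow hh hsq with e | e
        · exact orderOf_dvd_of_pow_eq_one e
        · exact absurd (by rw [e] at hj; simpa using hj) (hno _ hx'))
    have hfix : {q : X ⧸ H | c • q = q} = {((1 : X) : X ⧸ H)} := by
      ext q
      obtain ⟨x, rfl⟩ := QuotientGroup.mk_surjective q
      rw [Set.mem_ofPred_eq, Set.mem_singleton_iff, Subgroup.smul_mk_eq_mk_iff, eq_comm,
        QuotientGroup.eq, inv_one, one_mul]
      constructor
      · intro hx
        by_contra hx'
        refine hno x⁻¹ (by simpa using hx') ?_
        have := H.pow_mem hx h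
        have e : (x⁻¹ * c * x) ^ h = x⁻¹ * c ^ h * x⁻¹⁻¹ := by
          have := conj_pow (i := h) (a := x⁻¹) (b := c)
          rwa [inv_inv] at this ⊢
        rwa [e] at this
      · intro hx
        exact H.mul_mem (H.mul_mem (H.inv_mem hx) t.c_mem) hx
    rw [hfix, Set.ncard_singleton, t.index_eq, hns, hh] at hr
    have h0 : 0 < h := by have := orderOf_pos c; omega
    have : s = 2 * r := by
      have e : s * h = 2 * r * h := by
        have : r * (2 * h) = 2 * r * h := by ring
        omega
      exact Nat.eq_of_mul_eq_mul_right h0 e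
    exact (Nat.not_odd_iff_even.2 ⟨r, by omega⟩) hso
  refine ⟨x, hx, ?_⟩
  obtain ⟨j, e | e⟩ := t.mem_cases hxz
  · exact absurd (t.eq_one_of_conj hx hzC (by rw [e]; exact ⟨j, rfl⟩)) hz1
  · refine ⟨j, ?_, e⟩
    have h1 : ε (x * c ^ h * x⁻¹) = 1 := by
      rw [map_mul, map_mul, hez, mul_one, map_inv, mul_inv_cancel]
    rw [e, map_mul, hb, map_zpow, hc] at h1
    by_contra hev
    rw [Int.not_odd_iff_even] at hev
    rw [hev.neg_one_zpow] at h1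
    exact absurd h1 (by decide)

theorem conj_eq_inv_of_conj_half {h : ℕ} (hh : orderOf c = 2 * h) {x : X} (hx : x ∉ H) {j : ℤ}
    (hj : Odd j) (e : x * c ^ h * x⁻¹ = b * c ^ j) : b * c * b⁻¹ = c⁻¹ := by
  set z := c ^ h with hz
  have hz2 : z * z = 1 := by rw [hz, ← pow_add, ← two_mul, ← hh, pow_orderOf_eq_one]
  have hbc : b * c * b⁻¹ ∈ Subgroup.zpowers c := t.conj_mem t.b_mem (Subgroup.mem_zpowers c)
  have hcc : ∀ u ∈ Subgroup.zpowers c, ∀ v ∈ Subgroup.zpowers c, u * v = v * u := by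
    rintro _ ⟨i, rfl⟩ _ ⟨k, rfl⟩
    exact (Commute.refl c).zpow_zpow i k
  set w := b * c * b⁻¹ with hw
  have hbw : b * w * b⁻¹ = c := by
    have : b * w * b⁻¹ = (b * b) * c * (b * b)⁻¹ := by rw [hw]; group
    rw [this, t.dc.sq]; group
  set y := c * w with hy
  have hyC : y ∈ Subgroup.zpowers c := mul_mem (Subgroup.mem_zpowers c) hbc
  have hby : b * y * b⁻¹ = y := by
    have : b * y * b⁻¹ = (b * c * b⁻¹) * (b * w * b⁻¹) := by rw [hy]; group
    rw [this, hbw, ← hw, hy, hcc _ hbc _ (Subgroup.mem_zpowers c)]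
  have hcom : (x * z * x⁻¹) * y * (x * z * x⁻¹)⁻¹ = y := by
    rw [e]
    have : b * c ^ j * y * (b * c ^ j)⁻¹ = b * (c ^ j * y * (c ^ j)⁻¹) * b⁻¹ := by group
    rw [this, hcc _ ⟨j, rfl⟩ _ hyC, mul_inv_cancel_right, hby]
  have hmem : x⁻¹ * y * x ∈ H := by
    apply t.mem_of_commute_half hh
    have h1 : (x⁻¹ * y * x) * z * (x⁻¹ * y * x)⁻¹ =
        x⁻¹ * (y * (x * z * x⁻¹) * y⁻¹) * x := by group
    have h2 : y * (x * z * x⁻¹) * y⁻¹ = x * z * x⁻¹ := by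
      rw [mul_inv_eq_iff_eq_mul] at hcom ⊢
      exact hcom.symm
    rw [← hz, h1, h2]; group
  have hyy : y * y = 1 := t.sq_eq_one_of_conj (x := x⁻¹) (by simpa using hx) (t.zpowers_le hyC)
    (by simpa using hmem)
  rcases eq_half_of_mem hh hyC hyy with h1 | h1
  · rw [hy] at h1
    exact eq_inv_of_mul_eq_one_right h1
  · exfalso
    rw [← hz, hy] at h1
    have h2 : w = c⁻¹ * z := by rw [← h1]; group
    have h3 : (b * c ^ j) * (b * c ^ j) = 1 := by
      rw [← e]
      have : x * z * x⁻¹ * (x * z * x⁻¹) = x * (z * z) * x⁻¹ := by group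
      rw [this, hz2]; group
    have h4 : (b * c ^ j) * (b * c ^ j) = w ^ j * (b * b) * c ^ j := by
      rw [hw, conj_zpow]; group
    have h5 : w ^ j = c ^ (-j) * z := by
      rw [h2, Commute.mul_zpow (hcc _ (inv_mem (Subgroup.mem_zpowers c)) _ ⟨h, by simp [hz]⟩)]
      obtain ⟨i, rfl⟩ := hj
      have : z ^ (2 * i + 1) = z := by
        rw [zpow_add, zpow_mul, zpow_two, hz2, one_zpow, one_mul, zpow_one]
      rw [this, inv_zpow, zpow_neg]
    rw [h4, h5, t.dc.sq, mul_one, mul_assoc, hcc z ⟨h, by simp [hz]⟩ _ ⟨j, rfl⟩, ← mul_assoc,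
      ← zpow_add, neg_add_cancel, zpow_zero, one_mul] at h3
    exact half_ne_one hh h3

end ThinMaximal
end DihedralCyclic

namespace DihedralCyclic
namespace ThinMaximal

variable {X : Type*} [Group X] {a b c : X} {H : Subgroup X} (t : ThinMaximal a b c H)
include t

theorem eq_one_of_commute_conj_half [Finite X] {h : ℕ} (hh : orderOf c = 2 * h) {q g w : X}
    (hq : q ∈ Subgroup.zpowers a) (hg : g = w * c ^ h * w⁻¹) (hqg : q * g * q⁻¹ = g) : q = 1 := by
  have h1 : w⁻¹ * q * w ∈ H := by
    apply t.mem_of_commute_half hh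
    have : w⁻¹ * q * w * c ^ h * (w⁻¹ * q * w)⁻¹ = w⁻¹ * (q * (w * c ^ h * w⁻¹) * q⁻¹) * w := by
      group
    rw [this, ← hg, hqg, hg]; group
  obtain ⟨j, rfl⟩ := hq
  obtain ⟨i, y, hy, rfl⟩ := t.exists_rot_mul w
  apply t.rot_mem
  have h2 : (a ^ i * y)⁻¹ * a ^ j * (a ^ i * y) = y⁻¹ * (a ^ (-i) * a ^ j * a ^ i) * y := by group
  simp only at h1
  rw [h2, ← zpow_add, ← zpow_add, neg_add_cancel_comm, H.mul_mem_cancel_right hy,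
    H.mul_mem_cancel_left (H.inv_mem hy)] at h1
  exact h1

omit t in
theorem zpow_mul_refl_of_inv (hinv : b * c * b⁻¹ = c⁻¹) (r i : ℤ) :
    c ^ r * (b * c ^ i) * (c ^ r)⁻¹ = b * c ^ (i - 2 * r) := by
  have h1 : b * c ^ (-r) * b⁻¹ = c ^ r := by rw [← conj_zpow, hinv, inv_zpow', neg_neg]
  have h2 : c ^ r * b = b * c ^ (-r) := by rw [← h1]; group
  rw [← mul_assoc, h2, mul_assoc, mul_assoc, ← zpow_neg, ← zpow_add, ← zpow_add]
  congr 2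
  ring

theorem conj_refl_notMem (hn : Odd (orderOf a)) (hinv : b * c * b⁻¹ = c⁻¹) {x : X} (hx : x ∉ H)
    (r : ℤ) : x⁻¹ * (b * c ^ (2 * r)) * x ∉ H := by
  intro hmem
  have h1 := zpow_mul_refl_of_inv hinv (-r) 0
  rw [zpow_zero, mul_one, show (0 : ℤ) - 2 * -r = 2 * r by ring] at h1
  rw [← h1] at hmem
  obtain ⟨i, y, hy, e⟩ := t.exists_rot_mul ((c ^ (-r))⁻¹ * x)
  have h2 : x⁻¹ * (c ^ (-r) * b * (c ^ (-r))⁻¹) * x =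
      ((c ^ (-r))⁻¹ * x)⁻¹ * b * ((c ^ (-r))⁻¹ * x) := by group
  have h3 : (a ^ i * y)⁻¹ * b * (a ^ i * y) = y⁻¹ * (a ^ (-i) * b * a ^ i) * y := by group
  rw [h2, e, h3, t.dc.refl_mul_zpow, H.mul_mem_cancel_right hy,
    H.mul_mem_cancel_left (H.inv_mem hy)] at hmem
  have h4 := t.refl_mem hmem
  have h5 : a ^ i = 1 := by
    have h6 : (orderOf a : ℤ) ∣ -i - i := orderOf_dvd_iff_zpow_eq_one.2 h4
    rw [← orderOf_dvd_iff_zpow_eq_one]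
    have h7 : IsCoprime (orderOf a : ℤ) 2 := by
      rw [← Nat.cast_ofNat (R := ℤ) (n := 2), Nat.isCoprime_iff_coprime]
      exact Nat.coprime_two_right.2 hn
    exact h7.dvd_of_dvd_mul_left (by
      have : (orderOf a : ℤ) ∣ -(-i - i) := h6.neg_right
      rwa [show -(-i - i) = 2 * i by ring] at this)
  apply hx
  rw [h5, one_mul] at e
  exact (H.mul_mem_cancel_left (H.inv_mem (H.zpow_mem t.c_mem (-r)))).1 (by rw [e]; exact hy)

variable [Finite X]

omit t in
theorem exists_pow_of_zpow {h : ℕ} (hh : orderOf c = 2 * h) (k : ℤ) :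
    ∃ r < h, (c ^ k = c ^ (2 * r) ∧ Even k) ∨ (c ^ k = c ^ (2 * r + 1) ∧ Odd k) := by
  have h0 : 0 < h := by have := orderOf_pos c; omega
  have h1 : c ^ k = c ^ (k % (2 * h : ℕ)) := by rw [← hh, zpow_mod_orderOf]
  have h2 := Int.emod_nonneg k (b := (2 * h : ℕ)) (by omega)
  have h3 := Int.emod_lt_of_pos k (b := (2 * h : ℕ)) (by omega)
  have h4 := Int.emod_add_mul_ediv k (2 * h : ℕ)
  obtain ⟨u, hu⟩ := Int.eq_ofNat_of_zero_le h2
  rw [hu] at h1 h3 h4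
  rw [zpow_natCast] at h1
  have h5 : ((2 * h : ℕ) : ℤ) * (k / (2 * h : ℕ)) = 2 * (h * (k / (2 * h : ℕ))) := by
    push_cast; ring
  rw [h5] at h4
  generalize (h : ℤ) * (k / (2 * h : ℕ)) = v at h4
  rcases Nat.even_or_odd' u with ⟨r, rfl | rfl⟩
  · refine ⟨r, by omega, Or.inl ⟨h1, ?_⟩⟩
    exact ⟨r + v, by push_cast at h4; omega⟩
  · refine ⟨r, by omega, Or.inr ⟨h1, ?_⟩⟩
    exact ⟨r + v, by push_cast at h4; omega⟩

omit t [Finite X] in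
theorem refl_pow_injective {h : ℕ} (hh : orderOf c = 2 * h) {i j : ℕ} (hi : i < 2 * h)
    (hj : j < 2 * h) (e : b * c ^ i = b * c ^ j) : i = j :=
  pow_injOn_Iio_orderOf (by simpa [hh] using hi) (by simpa [hh] using hj) (mul_left_cancel e)

theorem card_bound {h : ℕ} (hh : orderOf c = 2 * h) (hn : Odd (orderOf a))
    (hinv : b * c * b⁻¹ = c⁻¹)
    (hconj : ∀ i : ℤ, Odd i → ∃ w : X, b * c ^ i = w * c ^ h * w⁻¹) :
    (orderOf a - 1) * h ≤ (orderOf a - 1) + (h + 1) * h := by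
  classical
  have := Fintype.ofFinite X
  set z := c ^ h with hz
  set P : Finset X := (Finset.univ.filter (· ∈ Subgroup.zpowers a)).erase 1 with hP
  set E : Finset X := (Finset.range h).image (fun r => b * c ^ (2 * r)) with hE
  set Z : Finset X := insert z ((Finset.range h).image (fun r => b * c ^ (2 * r + 1))) with hZ
  have hPm : ∀ p, p ∈ P ↔ p ≠ 1 ∧ p ∈ Subgroup.zpowers a := by intro p; simp [hP]
  have hPH : ∀ p ∈ P, p ∉ H := by
    intro p hp hpH
    obtain ⟨h1, j, rfl⟩ := (hPm p).1 hp
    exact h1 (t.rot_mem j hpH)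
  have hPcard : P.card = orderOf a - 1 := by
    rw [hP, Finset.card_erase_of_mem (by simp [one_mem]), ← Nat.card_zpowers,
      ← Nat.subtype_card (p := (· ∈ Subgroup.zpowers a)) _ (by simp)]
  have hEcard : E.card = h := by
    rw [hE, Finset.card_image_of_injOn, Finset.card_range]
    intro i hi j hj e
    simp only [Finset.coe_range, Set.mem_Iio] at hi hj
    have := refl_pow_injective hh (by omega) (by omega) e
    omega
  have hZcard : Z.card ≤ h + 1 := by
    refine (Finset.card_insert_le _ _).trans ?_
    have := Finset.card_image_le (s := Finset.range h) (f := fun r => b * c ^ (2 * r + 1))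
    rw [Finset.card_range] at this
    omega
  have hEH : ∀ e ∈ E, e ∈ H := by
    intro e he
    obtain ⟨r, -, rfl⟩ := Finset.mem_image.1 he
    exact H.mul_mem t.b_mem (H.pow_mem t.c_mem _)
  have hEout : ∀ e ∈ E, ∀ x ∉ H, x⁻¹ * e * x ∉ H := by
    intro e he x hx
    obtain ⟨r, -, rfl⟩ := Finset.mem_image.1 he
    have := t.conj_refl_notMem hn hinv hx r
    simpa using (by exact_mod_cast this)
  have hEsq : ∀ e ∈ E, e * e = 1 := by
    intro e he
    obtain ⟨r, -, rfl⟩ := Finset.mem_image.1 he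
    have := zpow_mul_refl_of_inv hinv (-r) 0
    rw [zpow_zero, mul_one, show (0 : ℤ) - 2 * -r = (2 * r : ℕ) by push_cast; ring,
      zpow_natCast] at this
    rw [← this]
    have : c ^ (-r : ℤ) * b * (c ^ (-r : ℤ))⁻¹ * (c ^ (-r : ℤ) * b * (c ^ (-r : ℤ))⁻¹) =
      c ^ (-r : ℤ) * (b * b) * (c ^ (-r : ℤ))⁻¹ := by group
    rw [this, t.dc.sq]; group
  have hEZ : ∀ y ∈ H, y * y = 1 → y ≠ 1 → y ∈ E ∨ y ∈ Z := by
    intro y hy hyy hy1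
    obtain ⟨k, rfl | rfl⟩ := t.mem_cases hy
    · right
      have e : c ^ k = c ^ h := (eq_half_of_mem hh ⟨k, rfl⟩ hyy).resolve_left hy1
      rw [e, hZ]
      exact Finset.mem_insert_self _ _
    · obtain ⟨r, hr, ⟨e, -⟩ | ⟨e, -⟩⟩ := exists_pow_of_zpow hh k
      · exact Or.inl (Finset.mem_image.2 ⟨r, by simpa using hr, by rw [e]⟩)
      · exact Or.inr (Finset.mem_insert_of_mem
          (Finset.mem_image.2 ⟨r, by simpa using hr, by rw [e]⟩))
  have hZconj : ∀ y ∈ Z, ∃ w : X, y = w * c ^ h * w⁻¹ := by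
    intro y hy
    rcases Finset.mem_insert.1 hy with rfl | hy
    · exact ⟨1, by rw [hz]; group⟩
    · obtain ⟨r, -, rfl⟩ := Finset.mem_image.1 hy
      obtain ⟨w, hw⟩ := hconj ((2 * r + 1 : ℕ) : ℤ) ⟨r, by push_cast; ring⟩
      exact ⟨w, by simpa only [zpow_natCast] using hw⟩
  set G : Finset X := (P ×ˢ E).image (fun pe => pe.1 * pe.2 * pe.1⁻¹) with hG
  have hGcard : G.card = (orderOf a - 1) * h := by
    rw [hG, Finset.card_image_of_injOn, Finset.card_product, hPcard, hEcard]
    rintro ⟨p, e⟩ hpe ⟨p', e'⟩ hpe' heq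
    simp only [Finset.coe_product, Set.mem_prod, Finset.mem_coe] at hpe hpe'
    simp only at heq
    have h1 : (p⁻¹ * p')⁻¹ * e * (p⁻¹ * p') ∈ H := by
      have : (p⁻¹ * p')⁻¹ * e * (p⁻¹ * p') = p'⁻¹ * (p * e * p⁻¹) * p' := by group
      rw [this, heq]
      have : p'⁻¹ * (p' * e' * p'⁻¹) * p' = e' := by group
      rw [this]
      exact hEH _ hpe'.2
    have h2 : p⁻¹ * p' ∈ H := by
      by_contra hc
      exact hEout e hpe.2 _ hc h1
    have h3 : p⁻¹ * p' = 1 := Subgroup.disjoint_def.1 t.isComplement.disjoint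
      (mul_mem (inv_mem ((hPm p).1 hpe.1).2) ((hPm p').1 hpe'.1).2) h2
    have h4 : p = p' := inv_mul_eq_one.1 h3
    subst h4
    rw [mul_left_inj, mul_right_inj] at heq
    rw [heq]
  have hexists : ∀ g : X, ∃ q : X, g ∈ G →
      q ∈ P ∧ q * b * g ∈ H ∧ q⁻¹ * (q * b * g) * q ∈ H := by
    intro g
    by_cases hg : g ∈ G
    swap
    · exact ⟨1, fun hg' => absurd hg' hg⟩
    obtain ⟨⟨p, e⟩, hpe, rfl⟩ := Finset.mem_image.1 hg
    rw [Finset.mem_product] at hpe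
    simp only at hpe ⊢
    set g := p * e * p⁻¹ with hgdef
    have hgH : g ∉ H := by
      have := hEout e hpe.2 p⁻¹ (by simpa using hPH p hpe.1)
      simpa using this
    have hgg : g * g = 1 := by
      have : g * g = p * (e * e) * p⁻¹ := by rw [hgdef]; group
      rw [this, hEsq e hpe.2]; group
    obtain ⟨i, y, hy, hgy⟩ := t.exists_rot_mul g
    refine ⟨a ^ i, fun _ => ⟨(hPm _).2 ⟨?_, ⟨i, rfl⟩⟩, ?_, ?_⟩⟩
    · intro e1
      rw [e1, one_mul] at hgy
      exact hgH (by rw [hgy]; exact hy)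
    · rw [hgy, ← mul_assoc, t.dc.refl_mul_zpow, sub_self, zpow_zero, one_mul]
      exact H.mul_mem t.b_mem hy
    · have h1 : g = y⁻¹ * (a ^ i)⁻¹ := by
        rw [← mul_inv_rev, ← hgy]; exact eq_inv_of_mul_eq_one_left hgg
      have h2 : (a ^ i)⁻¹ * (a ^ i * b * g) * a ^ i = b * g * a ^ i := by group
      rw [h2, h1]
      have h3 : b * (y⁻¹ * (a ^ i)⁻¹) * a ^ i = b * y⁻¹ := by group
      rw [h3]
      exact H.mul_mem t.b_mem (H.inv_mem hy)
  choose q hq using hexists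
  have hfirst : (G.filter (fun g => q g * b * g = 1)).card ≤ P.card := by
    refine Finset.card_le_card_of_injOn q (fun g hg => (hq g (Finset.mem_filter.1 hg).1).1) ?_
    intro g hg g' hg' e
    have h1 := (Finset.mem_filter.1 hg).2
    have h2 := (Finset.mem_filter.1 hg').2
    rw [← h2, e] at h1
    exact mul_left_cancel h1
  have hsecond : (G.filter (fun g => ¬ q g * b * g = 1)).card ≤ Z.offDiag.card := by
    have hZmem : ∀ p ∉ H, ∀ y ∈ H, p⁻¹ * y * p ∈ H → y ≠ 1 → y ∈ Z ∧ p⁻¹ * y * p ∈ Z := by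
      intro p hp y hy hpy hy1
      have hsq : y * y = 1 := t.sq_eq_one_of_conj (x := p⁻¹) (by simpa using hp) hy
        (by simpa using hpy)
      constructor
      · exact (hEZ y hy hsq hy1).resolve_left fun hyE => hEout y hyE p hp hpy
      · refine (hEZ _ hpy ?_ ?_).resolve_left fun hyE =>
          hEout _ hyE p⁻¹ (by simpa using hp) ?_
        · have : p⁻¹ * y * p * (p⁻¹ * y * p) = p⁻¹ * (y * y) * p := by group
          rw [this, hsq]; group
        · intro e
          apply hy1
          have : y = p * (p⁻¹ * y * p) * p⁻¹ := by group
          rw [this, e]; group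
        · have : p⁻¹⁻¹ * (p⁻¹ * y * p) * p⁻¹ = y := by group
          rw [this]; exact hy
    refine Finset.card_le_card_of_injOn
      (fun g => (q g * b * g, (q g)⁻¹ * (q g * b * g) * q g)) ?_ ?_
    · intro g hg
      obtain ⟨hgG, hg1⟩ := Finset.mem_filter.1 hg
      obtain ⟨h1, h2, h3⟩ := hq g hgG
      obtain ⟨h4, h5⟩ := hZmem (q g) (hPH _ h1) _ h2 h3 hg1
      rw [Finset.mem_coe, Finset.mem_offDiag]
      refine ⟨h4, h5, fun e => ?_⟩
      obtain ⟨w, hw⟩ := hZconj _ h4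
      refine ((hPm _).1 h1).1 (t.eq_one_of_commute_conj_half hh ((hPm _).1 h1).2 hw ?_)
      simp only at e
      nth_rw 1 [e]
      group
    · intro g hg g' hg' e
      obtain ⟨hgG, hg1⟩ := Finset.mem_filter.1 hg
      obtain ⟨hgG', hg1'⟩ := Finset.mem_filter.1 hg'
      simp only [Prod.mk.injEq] at e
      obtain ⟨e1, e2⟩ := e
      obtain ⟨h1, h2, h3⟩ := hq g hgG
      obtain ⟨w, hw⟩ := hZconj _ (hZmem (q g) (hPH _ h1) _ h2 h3 hg1).1
      have h6 : q g' * (q g)⁻¹ = 1 := by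
        refine t.eq_one_of_commute_conj_half hh
          (mul_mem ((hPm _).1 (hq g' hgG').1).2 (inv_mem ((hPm _).1 h1).2)) hw ?_
        have : q g' * (q g)⁻¹ * (q g * b * g) * (q g' * (q g)⁻¹)⁻¹ =
            q g' * ((q g)⁻¹ * (q g * b * g) * q g) * (q g')⁻¹ := by group
        rw [this, e2, e1]; group
      rw [mul_inv_eq_one.1 h6] at e1
      exact mul_left_cancel e1
  have hoff : Z.offDiag.card ≤ (h + 1) * h := by
    rw [Finset.offDiag_card, ← Nat.mul_sub_one]
    exact Nat.mul_le_mul hZcard (by omega)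
  have := Finset.card_filter_add_card_filter_not (s := G) (fun g => q g * b * g = 1)
  rw [hGcard] at this
  omega

end ThinMaximal
end DihedralCyclic

namespace DihedralCyclic

theorem zpowers_normal_of_card_eq_fiftysix {X : Type*} [Group X] [Finite X] {a b c : X}
    (h : DihedralCyclic a b c) (ha : orderOf a = 7) (hc : orderOf c = 4) :
    (Subgroup.zpowers a).Normal := by
  have : Fact (Nat.Prime 7) := ⟨by norm_num⟩
  have hA : Nat.card (Subgroup.zpowers a) = 7 := by rw [Nat.card_zpowers, ha]
  have hX : Nat.card X = 56 := by rw [h.card_eq, ha, hc]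
  let P : Sylow 7 X := Sylow.ofCard (Subgroup.zpowers a) (by
    rw [hA, hX, show (56 : ℕ) = 7 ^ 1 * 8 by norm_num,
      Nat.factorization_mul (by norm_num) (by norm_num), Nat.factorization_pow]
    simp [Nat.Prime.factorization this.1, Nat.factorization_eq_zero_of_not_dvd (by norm_num :
      ¬ 7 ∣ 8)])
  have hP : (P : Subgroup X) = Subgroup.zpowers a := rfl
  have hle : h.dihedral ≤ Subgroup.normalizer (P : Set X) := by
    have hn : ((Subgroup.zpowers a).subgroupOf h.dihedral).Normal :=
      Subgroup.normal_of_index_eq_two h.relIndex_zpowers_dihedral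
    exact (Subgroup.normal_subgroupOf_iff_le_normalizer h.zpowers_le_dihedral).1 hn
  have h1 : Nat.card (Sylow 7 X) ∣ 4 := by
    rw [P.card_eq_index_normalizer, ← hc, ← h.index_dihedral]
    exact Subgroup.index_dvd_of_le hle
  have h2 := card_sylow_modEq_one 7 X
  have h3 : Nat.card (Sylow 7 X) = 1 := by
    have := Nat.le_of_dvd (by norm_num) h1
    interval_cases hk : Nat.card (Sylow 7 X)
    all_goals first | rfl | (exfalso; revert h2; decide)
  have : Subsingleton (Sylow 7 X) := (Nat.card_eq_one_iff_unique.1 h3).1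
  exact Sylow.normal_of_subsingleton P

namespace ThinMaximal

variable {X : Type*} [Group X] {a b c : X} {H : Subgroup X} (t : ThinMaximal a b c H) [Finite X]
include t

theorem false_of_orderOf_eq_succ {h : ℕ} (hh : orderOf c = 2 * h) (hn : orderOf a = h + 1)
    (hconj : ∀ i : ℤ, Odd i → ∃ w : X, b * c ^ i = w * c ^ h * w⁻¹) : False := by
  classical
  have := Fintype.ofFinite X
  set Z : Finset X := insert (c ^ h) ((Finset.range h).image (fun r => b * c ^ (2 * r + 1)))
    with hZ
  set K : Finset X := (Finset.univ.filter (· ∈ Subgroup.zpowers a)).image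
    (fun p => p * c ^ h * p⁻¹) with hK
  have hZcard : Z.card = h + 1 := by
    rw [hZ, Finset.card_insert_of_notMem, Finset.card_image_of_injOn, Finset.card_range]
    · intro i hi j hj e
      simp only [Finset.coe_range, Set.mem_Iio] at hi hj
      have := refl_pow_injective hh (by omega) (by omega) e
      omega
    · intro hmem
      obtain ⟨r, -, e⟩ := Finset.mem_image.1 hmem
      apply t.dc.b_notMem
      rw [← (Subgroup.zpowers c).mul_mem_cancel_right
        (pow_mem (Subgroup.mem_zpowers c) (2 * r + 1)), e]
      exact pow_mem (Subgroup.mem_zpowers c) h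
  have hKcard : K.card ≤ h + 1 := by
    refine Finset.card_image_le.trans ?_
    rw [← hn, ← Nat.card_zpowers, ← Nat.subtype_card (p := (· ∈ Subgroup.zpowers a)) _ (by simp)]
  have hKmem : ∀ w : X, w * c ^ h * w⁻¹ ∈ K := by
    intro w
    obtain ⟨i, y, hy, rfl⟩ := t.exists_rot_mul w
    refine Finset.mem_image.2 ⟨a ^ i, by simp, ?_⟩
    have : a ^ i * y * c ^ h * (a ^ i * y)⁻¹ = a ^ i * (y * c ^ h * y⁻¹) * (a ^ i)⁻¹ := by group
    rw [this, t.conj_half hh hy]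
  have hsub : Z ⊆ K := by
    intro y hy
    rcases Finset.mem_insert.1 hy with rfl | hy
    · simpa using hKmem 1
    · obtain ⟨r, -, rfl⟩ := Finset.mem_image.1 hy
      obtain ⟨w, hw⟩ := hconj ((2 * r + 1 : ℕ) : ℤ) ⟨r, by push_cast; ring⟩
      rw [zpow_natCast] at hw
      rw [hw]
      exact hKmem w
  have heq := Finset.eq_of_subset_of_card_le hsub (by rw [hZcard]; exact hKcard)
  apply half_ne_one hh
  apply t.eq_one_of_forall_conj_mem
  intro w
  have hw := hKmem w
  rw [← heq] at hw
  rcases Finset.mem_insert.1 hw with e | hw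
  · rw [e]; exact H.pow_mem t.c_mem h
  · obtain ⟨r, -, e⟩ := Finset.mem_image.1 hw
    rw [← e]
    exact H.mul_mem t.b_mem (H.pow_mem t.c_mem _)

theorem false_of_odd (hn : Odd (orderOf a)) : False := by
  obtain ⟨h, s, hh, hhe, hso, hns, x, hx, j, hj, e⟩ := t.exists_conj_half_of_odd hn
  have hinv := t.conj_eq_inv_of_conj_half hh hx hj e
  have hconj : ∀ i : ℤ, Odd i → ∃ w : X, b * c ^ i = w * c ^ h * w⁻¹ := by
    intro i hi
    obtain ⟨u, rfl⟩ := hi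
    obtain ⟨v, rfl⟩ := hj
    refine ⟨c ^ (v - u) * x, ?_⟩
    have h1 : c ^ (v - u) * x * c ^ h * (c ^ (v - u) * x)⁻¹ =
        c ^ (v - u) * (x * c ^ h * x⁻¹) * (c ^ (v - u))⁻¹ := by group
    rw [h1, e, zpow_mul_refl_of_inv hinv]
    congr 2
    ring
  have hb := t.card_bound hh hn hinv hconj
  have h0 : 0 < h := by have := orderOf_pos c; omega
  have h2 : 2 ≤ h := by obtain ⟨r, rfl⟩ := hhe; omega
  rw [hns, Nat.add_sub_cancel_left] at hb
  have hb' : s * h ≤ s + h + 1 := by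
    have : s * h * h ≤ (s + h + 1) * h := by
      calc s * h * h ≤ s * h + (h + 1) * h := hb
        _ = _ := by ring
    exact Nat.le_of_mul_le_mul_right this h0
  obtain ⟨u, rfl⟩ := hso
  rcases Nat.eq_zero_or_pos u with rfl | hu
  · exact t.false_of_orderOf_eq_succ hh (by rw [hns]; ring) hconj
  · have hh2 : h = 2 := by nlinarith
    subst hh2
    have hu1 : u = 1 := by omega
    subst hu1
    have := t.dc.rot_eq_one_of_normal (j := 1) (by
      rw [zpow_one]
      exact zpowers_normal_of_card_eq_fiftysix t.dc (by omega) (by omega))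
    exact t.a_ne_one (by simpa using this)

theorem admissible : Admissible (orderOf a) (orderOf c) := by
  rcases Nat.even_or_odd (orderOf a) with hn | hn
  · rcases Nat.even_or_odd (orderOf c) with hm | hm
    · exact (t.false_of_even_of_even hn hm).elim
    · exact Or.inr (Or.inr (Or.inr (Or.inl (t.eq_of_even_of_odd hn hm))))
  · exact (t.false_of_odd hn).elim

end ThinMaximal
end DihedralCyclic

namespace DihedralCyclic

variable {X : Type*} [Group X] {a b c : X}

/-- A maximal overgroup `H` of `⟨c⟩` containing `b` that is generated by its core and `⟨c⟩`; the
rotations in `H` are the powers of `a ^ k`. -/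
structure ThickMaximal (a b c : X) (H : Subgroup X) (k : ℕ) : Prop where
  dc : DihedralCyclic a b c
  coatom : IsCoatom H
  c_mem : c ∈ H
  b_mem : b ∈ H
  rot_mem : ∀ j : ℤ, a ^ j ∈ H → a ^ j ∈ H.normalCore
  sup : H.normalCore ⊔ Subgroup.zpowers c = H
  core : (Subgroup.zpowers c).normalCore = ⊥
  dvd : ∀ j : ℤ, a ^ j ∈ H ↔ (k : ℤ) ∣ j

namespace ThickMaximal

variable {H : Subgroup X} {k : ℕ} (t : ThickMaximal a b c H k)
include t

theorem zpowers_le : Subgroup.zpowers c ≤ H := Subgroup.zpowers_le.2 t.c_mem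

theorem exists_core_mul {x : X} (hx : x ∈ H) :
    ∃ g ∈ H.normalCore, ∃ y ∈ Subgroup.zpowers c, x = g * y := by
  rw [← t.sup] at hx
  obtain ⟨g, hg, y, hy, e⟩ := Subgroup.mem_sup_of_normal_left.1 hx
  exact ⟨g, hg, y, hy, e.symm⟩

theorem exists_rot_mul (x : X) : ∃ j : ℤ, ∃ y ∈ H, x = a ^ j * y := by
  obtain ⟨j, k, e | e⟩ := t.dc.cover x
  · exact ⟨j, _, H.zpow_mem t.c_mem k, e⟩
  · exact ⟨j, _, H.mul_mem t.b_mem (H.zpow_mem t.c_mem k), by rw [e, mul_assoc]⟩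

theorem a_notMem : a ∉ H := by
  intro ha
  apply t.coatom.1
  rw [eq_top_iff]
  intro x _
  obtain ⟨j, y, hy, rfl⟩ := t.exists_rot_mul x
  exact H.mul_mem (H.zpow_mem ha j) hy

theorem k_ne_one : k ≠ 1 := by
  rintro rfl
  exact t.a_notMem (by simpa using (t.dvd 1).2 (by simp))

theorem pow_mem : a ^ k ∈ H := by
  have := (t.dvd k).2 dvd_rfl
  rwa [zpow_natCast] at this

theorem pow_mem_core : a ^ k ∈ H.normalCore := by
  have := t.rot_mem k ((t.dvd k).2 dvd_rfl)
  rwa [zpow_natCast] at this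

theorem rot_mem_iff (j : ℤ) : a ^ j ∈ H.normalCore ↔ (k : ℤ) ∣ j :=
  ⟨fun h => (t.dvd j).1 (H.normalCore_le h), fun h => t.rot_mem j ((t.dvd j).2 h)⟩

theorem eq_one_of_conj_mem [Finite X] {x y : X} (hy : ∀ h ∈ H, h * y * h⁻¹ ∈ Subgroup.zpowers c)
    (hx : x ∉ H) (hyx : x * y * x⁻¹ ∈ Subgroup.zpowers c) : y = 1 :=
  Subgroup.eq_one_of_conj_mem_of_isCoatom t.core t.coatom (by simpa using hy 1 H.one_mem) hy hx hyx

theorem comap_zpowers :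
    (Subgroup.zpowers (c : X ⧸ H.normalCore)).comap (QuotientGroup.mk' H.normalCore) = H := by
  ext x
  rw [Subgroup.mem_comap, QuotientGroup.mk'_apply]
  constructor
  · rintro ⟨j, hj⟩
    simp only [← QuotientGroup.mk_zpow] at hj
    rw [QuotientGroup.eq] at hj
    exact (H.mul_mem_cancel_left (H.inv_mem (H.zpow_mem t.c_mem j))).1 (H.normalCore_le hj)
  · intro hx
    obtain ⟨g, hg, _, ⟨j, rfl⟩, rfl⟩ := t.exists_core_mul hx
    refine ⟨j, ?_⟩
    simp only
    rw [← QuotientGroup.mk_zpow, QuotientGroup.mk_mul, (QuotientGroup.eq_one_iff g).2 hg, one_mul]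

theorem isCoatom_quotient : IsCoatom (Subgroup.zpowers (c : X ⧸ H.normalCore)) := by
  have hsurj := QuotientGroup.mk'_surjective H.normalCore
  constructor
  · intro e
    have := t.comap_zpowers
    rw [e, Subgroup.comap_top] at this
    exact t.coatom.1 this.symm
  · intro K hK
    have h1 := t.coatom.2 (K.comap (QuotientGroup.mk' H.normalCore)) (by
      have := (Subgroup.comap_lt_comap_of_surjective hsurj).2 hK
      rwa [t.comap_zpowers] at this)
    rw [← Subgroup.comap_top (QuotientGroup.mk' H.normalCore)] at h1
    exact Subgroup.comap_injective hsurj h1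

theorem core_quotient : (Subgroup.zpowers (c : X ⧸ H.normalCore)).normalCore = ⊥ :=
  Subgroup.normalCore_zpowers_quotient_eq_bot (by rw [t.sup])

theorem rot_eq_one_of_mem_quotient {j : ℤ}
    (hj : (a : X ⧸ H.normalCore) ^ j ∈ Subgroup.zpowers (c : X ⧸ H.normalCore)) :
    (a : X ⧸ H.normalCore) ^ j = 1 := by
  rw [← QuotientGroup.mk_zpow] at hj ⊢
  rw [QuotientGroup.eq_one_iff]
  apply t.rot_mem
  rw [← t.comap_zpowers]
  exact hj

theorem isComplement_quotient : Subgroup.IsComplement' (Subgroup.zpowers (a : X ⧸ H.normalCore))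
    (Subgroup.zpowers (c : X ⧸ H.normalCore)) := by
  apply Subgroup.isComplement'_of_disjoint_and_mul_eq_univ
  · rw [Subgroup.disjoint_def]
    rintro _ ⟨j, rfl⟩ hj
    exact t.rot_eq_one_of_mem_quotient hj
  · rw [Set.eq_univ_iff_forall]
    intro x
    obtain ⟨x, rfl⟩ := QuotientGroup.mk_surjective x
    obtain ⟨j, y, hy, rfl⟩ := t.exists_rot_mul x
    refine ⟨(a : X ⧸ H.normalCore) ^ j, ⟨j, rfl⟩, y, ?_, ?_⟩
    · rw [← t.comap_zpowers] at hy
      exact hy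
    · simp

theorem normal_quotient [Finite X] : (Subgroup.zpowers (a : X ⧸ H.normalCore)).Normal :=
  Subgroup.normal_of_isComplement'_zpowers_of_isCoatom t.core_quotient t.isCoatom_quotient
    t.isComplement_quotient

theorem exists_conj_eq [Finite X] (x : X) :
    ∃ i : ℤ, ((x * a * x⁻¹ : X) : X ⧸ H.normalCore) = (a : X ⧸ H.normalCore) ^ i := by
  obtain ⟨i, hi⟩ := t.normal_quotient.conj_mem (a : X ⧸ H.normalCore) (Subgroup.mem_zpowers _) x
  exact ⟨i, by rw [QuotientGroup.mk_mul, QuotientGroup.mk_mul, QuotientGroup.mk_inv]; exact hi.symm⟩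

theorem mem_core_of_commutator {y : X} (hy : y ∈ Subgroup.zpowers c)
    (hya : y * a * y⁻¹ * a⁻¹ ∈ H.normalCore) : y ∈ H.normalCore := by
  have h1 : Commute (y : X ⧸ H.normalCore) a := by
    rw [← QuotientGroup.eq_one_iff, QuotientGroup.mk_mul, QuotientGroup.mk_mul,
      QuotientGroup.mk_mul, QuotientGroup.mk_inv, QuotientGroup.mk_inv, mul_inv_eq_one,
      mul_inv_eq_iff_eq_mul] at hya
    exact hya
  have h2 : ∀ x : X ⧸ H.normalCore, Commute x y := by
    intro x
    obtain ⟨x, rfl⟩ := QuotientGroup.mk_surjective x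
    obtain ⟨j, h, hh, rfl⟩ := t.exists_rot_mul x
    obtain ⟨g, hg, _, ⟨i, rfl⟩, rfl⟩ := t.exists_core_mul hh
    obtain ⟨l, rfl⟩ := hy
    simp only [QuotientGroup.mk_mul, QuotientGroup.mk_zpow, (QuotientGroup.eq_one_iff g).2 hg,
      one_mul] at h1 ⊢
    exact (h1.symm.zpow_left j).mul_left ((Commute.refl _).zpow_zpow i l)
  have hmem : (y : X ⧸ H.normalCore) ∈ (Subgroup.zpowers (c : X ⧸ H.normalCore)).normalCore := by
    intro x
    rw [(h2 x).eq, mul_inv_cancel_right]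
    obtain ⟨l, rfl⟩ := hy
    exact ⟨l, by simp⟩
  rw [t.core_quotient, Subgroup.mem_bot, QuotientGroup.eq_one_iff] at hmem
  exact hmem

theorem eq_two_of_even [Finite X] (hk : Even k) : k = 2 := by
  set A2 := Subgroup.zpowers ((a : X ⧸ H.normalCore) ^ 2) with hA2
  have hrot : ∀ j : ℤ, (a : X ⧸ H.normalCore) ^ j = 1 ↔ (k : ℤ) ∣ j := by
    intro j
    rw [← QuotientGroup.mk_zpow, QuotientGroup.eq_one_iff, t.rot_mem_iff]
  have hA2n : A2.Normal := by
    constructor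
    rintro _ ⟨j, rfl⟩ x
    obtain ⟨i, hi⟩ := t.normal_quotient.conj_mem (a : X ⧸ H.normalCore) (Subgroup.mem_zpowers _) x
    refine ⟨i * j, ?_⟩
    simp only at hi ⊢
    rw [← conj_zpow, ← conj_pow, ← hi, ← zpow_natCast, ← zpow_natCast, ← zpow_mul, ← zpow_mul,
      ← zpow_mul]
    congr 1; ring
  have hk2 : 2 ∣ k := hk.two_dvd
  by_cases hle : A2 ≤ Subgroup.zpowers (c : X ⧸ H.normalCore)
  · have h1 := t.rot_eq_one_of_mem_quotient (j := 2) (hle ⟨1, by simp⟩)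
    rw [hrot] at h1
    have h2 : k ∣ 2 := by exact_mod_cast h1
    exact Nat.dvd_antisymm h2 hk2
  · exfalso
    have htop := t.isCoatom_quotient.2 (A2 ⊔ Subgroup.zpowers (c : X ⧸ H.normalCore))
      (right_lt_sup.2 hle)
    have h1 : (a : X ⧸ H.normalCore) ∈ A2 ⊔ Subgroup.zpowers (c : X ⧸ H.normalCore) := by
      rw [htop]; trivial
    obtain ⟨_, ⟨l, rfl⟩, y, hy, e⟩ := Subgroup.mem_sup_of_normal_left.1 h1
    simp only at e
    have h2 : (a : X ⧸ H.normalCore) ^ (1 - 2 * l) = y := by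
      rw [sub_eq_neg_add, zpow_add, zpow_one, zpow_neg, zpow_mul, inv_mul_eq_iff_eq_mul]
      exact_mod_cast e.symm
    have h3 := t.rot_eq_one_of_mem_quotient (j := 1 - 2 * l) (by rw [h2]; exact hy)
    rw [hrot] at h3
    have h4 : (2 : ℤ) ∣ 1 - 2 * l := (by exact_mod_cast hk2 : (2 : ℤ) ∣ k).trans h3
    omega

theorem refl_notMem_core (hk : Odd k) (j : ℤ) : a ^ j * b ∉ H.normalCore := by
  intro hj
  have h1 := H.normalCore.mul_mem (H.normalCore_normal.conj_mem _ hj a) hj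
  have h2 : a * (a ^ j * b) * a⁻¹ * (a ^ j * b) = a ^ (2 : ℤ) := by
    have : a * (a ^ j * b) * a⁻¹ = a ^ (1 + j) * b * a ^ (-1 : ℤ) := by
      rw [zpow_add]; group
    rw [this, t.dc.refl_mul_zpow, t.dc.refl_mul_refl]
    congr 1; ring
  rw [h2, t.rot_mem_iff] at h1
  have h3 : k ∣ 2 := by exact_mod_cast h1
  rcases (Nat.dvd_prime Nat.prime_two).1 h3 with e | e
  · exact t.k_ne_one e
  · rw [e] at hk; exact absurd hk (by decide)

theorem c_notMem_core (hk : Odd k) : c ∉ H.normalCore := by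
  intro hc
  have : b ∈ H.normalCore := by
    have h1 := t.b_mem
    rw [← t.sup, sup_eq_left.2 (Subgroup.zpowers_le.2 hc)] at h1
    exact h1
  exact t.refl_notMem_core hk 0 (by simpa using this)

end ThickMaximal
end DihedralCyclic

theorem Subgroup.eq_of_mul_self_eq_one_of_mem_zpowers {X : Type*} [Group X] [Finite X] {c x y : X}
    (hx : x ∈ zpowers c) (hy : y ∈ zpowers c) (hxx : x * x = 1) (hyy : y * y = 1) (hx1 : x ≠ 1)
    (hy1 : y ≠ 1) : x = y := by
  have hd : 2 ∣ orderOf c := by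
    have h1 : orderOf x = 2 := orderOf_eq_prime (by rw [sq, hxx]) hx1
    have h2 : orderOf x ∣ Nat.card (zpowers c) := Subgroup.orderOf_dvd_natCard _ hx
    rwa [h1, Nat.card_zpowers] at h2
  obtain ⟨h, hh⟩ := hd
  rcases DihedralCyclic.ThinMaximal.eq_half_of_mem hh hx hxx with e | e
  · exact absurd e hx1
  · rcases DihedralCyclic.ThinMaximal.eq_half_of_mem hh hy hyy with e' | e'
    · exact absurd e' hy1
    · rw [e, e']

theorem Subgroup.mul_comm_of_mem_normalClosure {X : Type*} [Group X] {y : X}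
    (hy : ∀ x : X, Commute y (x * y * x⁻¹)) {s t : X} (hs : s ∈ normalClosure {y})
    (ht : t ∈ normalClosure {y}) : s * t = t * s := by
  have hsub : Group.conjugatesOfSet {y} ⊆ (centralizer (Group.conjugatesOfSet {y}) : Set X) := by
    intro p hp
    rw [SetLike.mem_coe, Subgroup.mem_centralizer_iff]
    intro q hq
    rw [Group.mem_conjugatesOfSet_iff] at hp hq
    obtain ⟨_, hp1, hp⟩ := hp
    obtain ⟨_, hq1, hq⟩ := hq
    rw [Set.mem_singleton_iff] at hp1 hq1
    rw [hp1, isConj_iff] at hp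
    rw [hq1, isConj_iff] at hq
    obtain ⟨p, rfl⟩ := hp
    obtain ⟨q, rfl⟩ := hq
    have h1 := (hy (q⁻¹ * p)).eq
    calc _ = q * (y * (q⁻¹ * p * y * (q⁻¹ * p)⁻¹)) * q⁻¹ := by group
      _ = _ := by rw [h1]; group
  have h1 : s ∈ centralizer (Group.conjugatesOfSet {y}) :=
    (Subgroup.closure_le _).2 hsub hs
  exact Subgroup.mem_centralizer_iff.1 (Subgroup.closure_le_centralizer_centralizer _ ht) s h1

namespace DihedralCyclic

variable {X : Type*} [Group X] {a b c : X}

namespace ThickMaximal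

variable {H : Subgroup X} {k : ℕ} (t : ThickMaximal a b c H k)
include t

/-- The largest subgroup of `⟨c⟩` normalized by `H`. -/
def innerCore (_ : ThickMaximal a b c H k) : Subgroup X where
  carrier := {y | ∀ h ∈ H, h * y * h⁻¹ ∈ Subgroup.zpowers c}
  one_mem' := fun h _ => by simp
  mul_mem' := fun {x y} hx hy h hh => by
    have := Subgroup.mul_mem _ (hx h hh) (hy h hh)
    simpa only [conj_mul] using this
  inv_mem' := fun {x} hx h hh => by
    have := Subgroup.inv_mem _ (hx h hh)
    rwa [conj_inv] at this

theorem innerCore_le : t.innerCore ≤ Subgroup.zpowers c :=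
  fun y hy => by simpa using hy 1 H.one_mem

theorem conj_mem_innerCore {y h : X} (hy : y ∈ t.innerCore) (hh : h ∈ H) :
    h * y * h⁻¹ ∈ t.innerCore := fun g hg => by
  have := hy (g * h) (H.mul_mem hg hh)
  rwa [show g * (h * y * h⁻¹) * g⁻¹ = g * h * y * (g * h)⁻¹ by group]

theorem k_dvd : k ∣ orderOf a := by
  have : ((k : ℕ) : ℤ) ∣ (orderOf a : ℕ) :=
    (t.dvd _).1 (by rw [zpow_natCast, pow_orderOf_eq_one]; exact H.one_mem)
  exact_mod_cast this

theorem c_ne_one : c ≠ 1 := by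
  intro hc
  apply t.a_notMem
  rw [t.dc.eq_one_of_c_eq_one hc]
  exact H.one_mem

variable [Finite X]

theorem two_le : 2 ≤ k := by
  have h1 := t.k_ne_one
  have h2 : k ≠ 0 := by
    rintro rfl
    have := orderOf_pos a
    have h3 := t.k_dvd
    omega
  omega

theorem orderOf_eq : orderOf a = k * orderOf (a ^ k) := by
  have := t.two_le
  rw [orderOf_pow_of_dvd (by omega) t.k_dvd, Nat.mul_div_cancel' t.k_dvd]

theorem commute_conj {y : X} (hy : y ∈ H.normalCore) (hyK : y ∈ t.innerCore) (x : X) :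
    Commute y (x * y * x⁻¹) := by
  by_cases hx : x ∈ H
  · have h1 := Subgroup.conj_eq_of_mem_zpowers (t.innerCore_le hyK) (hyK x hx)
    rw [mul_inv_eq_iff_eq_mul] at h1
    exact h1
  · have hxN : x * y * x⁻¹ ∈ H := H.normalCore_le (H.normalCore_normal.conj_mem y hy x)
    have hxN' : x⁻¹ * y * x ∈ H := by
      simpa using H.normalCore_le (H.normalCore_normal.conj_mem y hy x⁻¹)
    have hw : y * (x * y * x⁻¹) * y⁻¹ * (x * y * x⁻¹)⁻¹ ∈ t.innerCore := by
      have h1 := t.innerCore.mul_mem hyK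
        (t.conj_mem_innerCore (t.innerCore.inv_mem hyK) hxN)
      rwa [show y * (x * y * x⁻¹) * y⁻¹ * (x * y * x⁻¹)⁻¹ =
        y * (x * y * x⁻¹ * y⁻¹ * (x * y * x⁻¹)⁻¹) by group]
    have hw' : x⁻¹ * (y * (x * y * x⁻¹) * y⁻¹ * (x * y * x⁻¹)⁻¹) * x⁻¹⁻¹ ∈ t.innerCore := by
      have h1 := t.innerCore.mul_mem (t.conj_mem_innerCore hyK hxN') (t.innerCore.inv_mem hyK)
      rwa [show x⁻¹ * (y * (x * y * x⁻¹) * y⁻¹ * (x * y * x⁻¹)⁻¹) * x⁻¹⁻¹ =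
        x⁻¹ * y * x * y * (x⁻¹ * y * x)⁻¹ * y⁻¹ by group]
    have h2 := t.eq_one_of_conj_mem hw (fun h => hx (by simpa using h)) (t.innerCore_le hw')
    rw [mul_inv_eq_one, mul_inv_eq_iff_eq_mul] at h2
    exact h2

theorem eq_one_of_odd {y : X} (hy : y ∈ H.normalCore) (hyK : y ∈ t.innerCore)
    (ho : Odd (orderOf y)) : y = 1 :=
  t.dc.eq_one_of_odd_order t.core (T := Subgroup.normalClosure {y})
    (fun _ hs _ hu => Subgroup.mul_comm_of_mem_normalClosure (t.commute_conj hy hyK) hs hu)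
    (Subgroup.subset_normalClosure (Set.mem_singleton y)) ho

theorem exists_involution {y : X} (hy : y ∈ H.normalCore) (hyK : y ∈ t.innerCore) (hy1 : y ≠ 1) :
    ∃ z ∈ H.normalCore, z ∈ t.innerCore ∧ z ≠ 1 ∧ z * z = 1 := by
  rcases Nat.even_or_odd (orderOf y) with he | ho
  · obtain ⟨r, hr⟩ := he
    have := orderOf_pos y
    refine ⟨y ^ r, Subgroup.pow_mem _ hy r, Subgroup.pow_mem _ hyK r, ?_, ?_⟩
    · exact pow_ne_one_of_lt_orderOf (by omega) (by omega)
    · rw [← pow_add, ← hr, pow_orderOf_eq_one]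
  · exact absurd (t.eq_one_of_odd hy hyK ho) hy1

theorem commute_of_mem {z : X} (hz : z ∈ t.innerCore) (hz1 : z ≠ 1) (hzz : z * z = 1) {x : X}
    (hx : x ∈ H) : Commute x z := by
  have h1 : x * z * x⁻¹ = z := by
    refine Subgroup.eq_of_mul_self_eq_one_of_mem_zpowers (hz x hx) (t.innerCore_le hz) ?_ hzz ?_ hz1
    · rw [conj_mul, hzz]; simp
    · rwa [Ne, conj_eq_one_iff]
  exact mul_inv_eq_iff_eq_mul.1 h1

theorem admissible_of_innerCore_eq_bot {m₁ : ℕ}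
    (hm : ∀ j : ℤ, c ^ j ∈ t.innerCore ↔ (m₁ : ℤ) ∣ j) (had : Admissible (orderOf (a ^ k)) m₁)
    (hK : t.innerCore = ⊥) : Admissible (orderOf a) (orderOf c) := by
  have hm1 : orderOf c = m₁ := by
    apply Nat.dvd_antisymm
    · have := (hm m₁).2 dvd_rfl
      rw [hK, Subgroup.mem_bot, zpow_natCast] at this
      exact orderOf_dvd_of_pow_eq_one this
    · have := (hm (orderOf c : ℕ)).1 (by rw [zpow_natCast, pow_orderOf_eq_one]; exact one_mem _)
      exact_mod_cast this
  have hk := t.two_le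
  have ho := t.orderOf_eq
  have h4 : a ^ 4 = 1 ∨ 2 * orderOf a * orderOf c ∣ (orderOf c).factorial := by
    by_cases h : a ^ 4 = 1
    · exact Or.inl h
    · exact Or.inr (t.dc.card_dvd_factorial h)
  rw [← orderOf_dvd_iff_pow_eq_one] at h4
  rcases had with ⟨h1, h2⟩ | ⟨h1, h2⟩ | ⟨h1, h2⟩ | ⟨h1, h2⟩ | ⟨h1, h2⟩ <;>
    rw [h1] at ho <;> rw [h2] at hm1
  · exact absurd (orderOf_eq_one_iff.1 hm1) t.c_ne_one
  · have hk2 : k = 2 := by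
      rw [ho, hm1] at h4
      rcases h4 with h4 | h4
      · have := Nat.le_of_dvd (by norm_num) h4; omega
      · have := Nat.le_of_dvd (Nat.factorial_pos _) h4
        simp only [Nat.factorial] at this; omega
    rw [hk2] at ho
    have h2 := t.dc.index_dihedral
    rw [hm1] at h2
    have := Subgroup.normal_of_index_eq_two h2
    have h3 := t.dc.sq_eq_one_of_normal_le_dihedral (L := t.dc.dihedral) le_rfl (j := 1)
      (t.dc.zpowers_le_dihedral ⟨1, rfl⟩)
    have h5 := orderOf_dvd_of_pow_eq_one (x := a) (n := 2) (by exact_mod_cast h3)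
    rw [ho] at h5
    omega
  · have hk2 : k = 2 := by
      rw [ho, hm1] at h4
      rcases h4 with h4 | h4
      · have := Nat.le_of_dvd (by norm_num) h4; omega
      · have := Nat.le_of_dvd (Nat.factorial_pos _) h4
        simp only [Nat.factorial] at this; omega
    rw [ho, hm1, hk2]
    simp [Admissible]
  · exfalso
    rw [ho, hm1] at h4
    rcases h4 with h4 | h4
    · have := Nat.le_of_dvd (by norm_num) h4; omega
    · have := Nat.le_of_dvd (Nat.factorial_pos _) h4
      simp only [Nat.factorial] at this; omega
  · exfalso
    rw [ho, hm1] at h4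
    rcases h4 with h4 | h4
    · have := Nat.le_of_dvd (by norm_num) h4; omega
    · have := Nat.le_of_dvd (Nat.factorial_pos _) h4
      simp only [Nat.factorial] at this; omega

end ThickMaximal
end DihedralCyclic

namespace DihedralCyclic

variable {X : Type*} [Group X] {a b c : X}

namespace ThickMaximal

variable {H : Subgroup X} {k : ℕ} (t : ThickMaximal a b c H k)
include t

theorem rot_mem_of_cyclic_mem {j l : ℤ} (h : a ^ j * c ^ l ∈ H) : a ^ j ∈ H :=
  (H.mul_mem_cancel_right (H.zpow_mem t.c_mem l)).1 h

theorem rot_mem_of_refl_mem {j l : ℤ} (h : a ^ j * b * c ^ l ∈ H) : a ^ j ∈ H :=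
  (H.mul_mem_cancel_right t.b_mem).1 ((H.mul_mem_cancel_right (H.zpow_mem t.c_mem l)).1 h)

theorem zpow_eq_one_of_mem (ha : a ^ k = 1) {j : ℤ} (h : a ^ j ∈ H) : a ^ j = 1 := by
  obtain ⟨i, rfl⟩ := (t.dvd j).1 h
  rw [zpow_mul, zpow_natCast, ha, one_zpow]

theorem mem_or_eq_b_mul (ha : a ^ k = 1) {x : X} (hx : x ∈ H) :
    x ∈ Subgroup.zpowers c ∨ ∃ l : ℤ, x = b * c ^ l := by
  obtain ⟨j, l, rfl | rfl⟩ := t.dc.cover x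
  · rw [t.zpow_eq_one_of_mem ha (t.rot_mem_of_cyclic_mem hx), one_mul]
    exact Or.inl ⟨l, rfl⟩
  · rw [t.zpow_eq_one_of_mem ha (t.rot_mem_of_refl_mem hx), one_mul]
    exact Or.inr ⟨l, rfl⟩

theorem mul_self_mem (ha : a ^ k = 1) (hc : c ∈ t.innerCore) {x : X} (hx : x ∈ H) :
    x * x ∈ Subgroup.zpowers c := by
  rcases t.mem_or_eq_b_mul ha hx with h | ⟨l, rfl⟩
  · exact mul_mem h h
  · have h1 := t.innerCore.zpow_mem hc l b t.b_mem
    have h2 := mul_mem h1 (⟨l, rfl⟩ : c ^ l ∈ Subgroup.zpowers c)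
    rwa [t.dc.b_inv, mul_assoc] at h2

omit t in
theorem index_eq_two (t : ThickMaximal a b c H 2) : H.index = 2 := by
  rw [Subgroup.index_eq_two_iff]
  refine ⟨a⁻¹, fun x => ?_⟩
  obtain ⟨j, h, hh, e⟩ := t.exists_rot_mul x⁻¹
  have h1 : x ∈ H ↔ ((2 : ℕ) : ℤ) ∣ j := by
    rw [← inv_mem_iff, e, H.mul_mem_cancel_right hh, t.dvd]
  have h2 : x * a⁻¹ ∈ H ↔ ((2 : ℕ) : ℤ) ∣ 1 + j := by
    rw [← inv_mem_iff, mul_inv_rev, inv_inv, e, ← mul_assoc, H.mul_mem_cancel_right hh,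
      ← zpow_one_add, t.dvd]
  rw [h1, h2, xor_def]
  push_cast
  omega

variable [Finite X]

theorem admissible_of_even (hk : Even k) {m₁ : ℕ}
    (hm : ∀ j : ℤ, c ^ j ∈ t.innerCore ↔ (m₁ : ℤ) ∣ j) (had : Admissible (orderOf (a ^ k)) m₁)
    (hK : t.innerCore ≠ ⊥) : Admissible (orderOf a) (orderOf c) := by
  obtain rfl := t.eq_two_of_even hk
  have hn : H.Normal := Subgroup.normal_of_index_eq_two t.index_eq_two
  have hc1 := t.c_ne_one
  by_cases ha : a ^ 2 = 1
  · have hm1 : m₁ = 1 := by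
      rw [ha, orderOf_one] at had
      rcases had with h | h | h | h | h <;> omega
    have hcK : c ∈ t.innerCore := by
      have := (hm 1).2 (by rw [hm1]; simp)
      simpa using this
    have h1 : a * (c * c) * a⁻¹ ∈ Subgroup.zpowers c := by
      rw [← conj_mul]
      exact t.mul_self_mem ha hcK (hn.conj_mem c t.c_mem a)
    have h2 := t.eq_one_of_conj_mem (mul_mem hcK hcK : c * c ∈ t.innerCore) t.a_notMem h1
    have ho := t.orderOf_eq
    rw [ha, orderOf_one] at ho
    have hc2 : orderOf c = 2 := orderOf_eq_prime (by rw [pow_two, h2]) hc1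
    rw [ho, hc2]
    simp [Admissible]
  · exfalso
    obtain ⟨y, hy⟩ := Subgroup.ne_bot_iff_exists_ne_one.1 hK
    have hN : H.normalCore = H := Subgroup.normalCore_eq_self H
    obtain ⟨z, hz, hzK, hz1, hzz⟩ := t.exists_involution (y := y)
      (by rw [hN]; exact t.zpowers_le (t.innerCore_le y.2)) y.2 (by simpa using hy)
    have hzC := t.innerCore_le hzK
    rw [hN] at hz
    have hcomm : ∀ x ∈ H, Commute x (a * z * a⁻¹) := by
      intro x hx
      have h1 := t.commute_of_mem hzK hz1 hzz (x := a⁻¹ * x * a) (by simpa using hn.conj_mem x hx a⁻¹)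
      have h2 := (Commute.conj_iff a).2 h1
      rwa [show a * (a⁻¹ * x * a) * a⁻¹ = x by group] at h2
    have hz2C : a * z * a⁻¹ ∉ Subgroup.zpowers c := fun h =>
      hz1 (t.eq_one_of_conj_mem hzK t.a_notMem h)
    have hz2H : a * z * a⁻¹ ∈ H := hn.conj_mem z hz a
    have hz2 : a * z * a⁻¹ * (a * z * a⁻¹) = 1 := by rw [conj_mul, hzz]; simp
    obtain ⟨j, l, e | e⟩ := t.dc.cover (a * z * a⁻¹)
    · have h1 := (hcomm c t.c_mem).symm
      rw [e] at h1
      have h2 : Commute (a ^ j) c := by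
        have h3 := h1.mul_left ((Commute.refl c).zpow_left (-l))
        rwa [mul_assoc, ← zpow_add, add_neg_cancel, zpow_zero, mul_one] at h3
      rw [t.dc.rot_eq_one_of_commute h2, one_mul] at e
      exact hz2C ⟨l, e.symm⟩
    · have hβ : a ^ j * b ∈ H := by
        rw [e] at hz2H
        exact (H.mul_mem_cancel_right (H.zpow_mem t.c_mem l)).1 hz2H
      have h1 := hcomm _ hβ
      have hcl : c ^ l = a ^ j * b * (a * z * a⁻¹) := by
        rw [e, ← mul_assoc, t.dc.refl_sq, one_mul]
      have hcl2 : c ^ l * c ^ l = 1 := by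
        rw [hcl, mul_assoc, ← mul_assoc (a * z * a⁻¹), ← h1.eq, mul_assoc (a ^ j * b), hz2, mul_one,
          t.dc.refl_sq]
      by_cases hcl1 : c ^ l = 1
      · rw [hcl1, mul_one] at e
        apply t.dc.refl_notMem (j - 2)
        have h3 : a⁻¹ * (a ^ j * b) * a = z := by rw [← e]; group
        have h4 : a⁻¹ * (a ^ j * b) * a = a ^ (j - 2) * b := by
          have h5 := t.dc.refl_mul_zpow (-1 + j) 1
          rw [zpow_add, zpow_one] at h5
          rw [← mul_assoc, ← zpow_neg_one, h5]
          congr 2; ring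
        rw [← h4, h3]
        exact hzC
      · have h2 : c ^ l = z := Subgroup.eq_of_mul_self_eq_one_of_mem_zpowers ⟨l, rfl⟩ hzC hcl2 hzz
          hcl1 hz1
        rw [h2] at e
        have h3 : a ^ j * b = a * z * a⁻¹ * z := by
          rw [e, mul_assoc, hzz, mul_one]
        have h4 : a * (a * z * a⁻¹) * a⁻¹ = z := by
          have := t.commute_of_mem hzK hz1 hzz (x := a ^ 2) t.pow_mem
          rw [show a * (a * z * a⁻¹) * a⁻¹ = a ^ 2 * z * (a ^ 2)⁻¹ by rw [pow_two]; group]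
          rw [this.eq, mul_inv_cancel_right]
        have h5 : a * (a ^ j * b) * a⁻¹ = a ^ j * b := by
          rw [h3, ← conj_mul, h4]
          exact (hcomm z hz)
        have h6 : a * (a ^ j * b) * a⁻¹ = a ^ (2 + j) * b := by
          have h7 := t.dc.refl_mul_zpow (1 + j) (-1)
          rw [zpow_add, zpow_one, zpow_neg_one] at h7
          rw [← mul_assoc, h7]
          congr 2; ring
        rw [h5, zpow_add] at h6
        have h7 : a ^ (2 : ℤ) * (a ^ j * b) = a ^ j * b := by rw [← mul_assoc]; exact h6.symm
        rw [mul_eq_right] at h7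
        exact ha (by exact_mod_cast h7)

end ThickMaximal
end DihedralCyclic

namespace DihedralCyclic

variable {X : Type*} [Group X] {a b c : X}

namespace ThickMaximal

variable {H : Subgroup X} {k : ℕ} (t : ThickMaximal a b c H k)
include t

/-- The preimage of the normal subgroup generated by `a` modulo the core of `H`. -/
def rotSubgroup (_ : ThickMaximal a b c H k) : Subgroup X :=
  (Subgroup.zpowers (a : X ⧸ H.normalCore)).comap (QuotientGroup.mk' H.normalCore)

theorem normal_rotSubgroup [Finite X] : t.rotSubgroup.Normal := by
  have := t.normal_quotient
  exact Subgroup.Normal.comap this _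

theorem mem_rotSubgroup_iff {x : X} :
    x ∈ t.rotSubgroup ↔ (x : X ⧸ H.normalCore) ∈ Subgroup.zpowers (a : X ⧸ H.normalCore) := Iff.rfl

theorem a_mem_rotSubgroup : a ∈ t.rotSubgroup := t.mem_rotSubgroup_iff.2 (Subgroup.mem_zpowers _)

theorem exists_of_mem_rotSubgroup {x : X} (hx : x ∈ t.rotSubgroup) :
    ∃ j : ℤ, ∃ g ∈ H.normalCore, x = a ^ j * g := by
  obtain ⟨j, hj⟩ := hx
  refine ⟨j, (a ^ j)⁻¹ * x, ?_, by group⟩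
  simp only [← QuotientGroup.mk_zpow, QuotientGroup.mk'_apply] at hj
  exact QuotientGroup.eq.1 hj

variable [Finite X]

theorem innerCore_eq_bot_of_odd (hk : Odd k)
    (hNK : ∀ y ∈ H.normalCore, y ∈ t.innerCore → y = 1) : t.innerCore = ⊥ := by
  have := t.normal_rotSubgroup
  let T : Subgroup X := Subgroup.centralizer (H.normalCore : Set X) ⊓ t.rotSubgroup
  have hT : T.Normal := inferInstance
  have hcomm : ∀ x ∈ T, ∀ y ∈ T, x * y = y * x := by
    intro x hx y hy
    let f : T →* Subgroup.zpowers (a : X ⧸ H.normalCore) :=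
      ((QuotientGroup.mk' H.normalCore).comp T.subtype).codRestrict _ fun x => x.2.2
    have hf : f.ker ≤ Subgroup.center T := by
      intro g hg
      rw [Subgroup.mem_center_iff]
      intro s
      have h1 : (g : X) ∈ H.normalCore := by
        have h2 : ((f g : Subgroup.zpowers (a : X ⧸ H.normalCore)) : X ⧸ H.normalCore) = 1 := by
          rw [MonoidHom.mem_ker.1 hg]; rfl
        exact (QuotientGroup.eq_one_iff _).1 h2
      exact Subtype.ext (Subgroup.mem_centralizer_iff.1 s.2.1 g h1).symm
    exact congrArg Subtype.val ((f.isMulCommutative_of_isCyclic_of_ker_le_center hf).is_comm.comm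
      ⟨x, hx⟩ ⟨y, hy⟩)
  have hTN : ∀ x ∈ T, x ∈ H.normalCore := by
    intro x hx
    obtain ⟨e, o, ho, hxo⟩ := Nat.exists_eq_two_pow_mul_odd (orderOf_pos x).ne'
    have h1 : x ^ 2 ^ e = 1 := by
      refine t.dc.eq_one_of_odd_order t.core hcomm (T.pow_mem hx _) ?_
      rw [orderOf_pow_of_dvd (by positivity) (by rw [hxo]; exact dvd_mul_right _ _), hxo,
        Nat.mul_div_cancel_left _ (by positivity)]
      exact ho
    have h2 : (x : X ⧸ H.normalCore) ^ k = 1 := by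
      obtain ⟨j, hj⟩ := hx.2
      change (a : X ⧸ H.normalCore) ^ j = x at hj
      rw [← hj, ← zpow_natCast, ← zpow_mul, mul_comm, zpow_mul, zpow_natCast,
        ← QuotientGroup.mk_pow, (QuotientGroup.eq_one_iff _).2 t.pow_mem_core, one_zpow]
    have h3 : (x : X ⧸ H.normalCore) ^ 2 ^ e = 1 := by
      rw [← QuotientGroup.mk_pow, h1, QuotientGroup.mk_one]
    have h4 : Nat.Coprime (2 ^ e) k := Nat.Coprime.pow_left _ (Nat.coprime_two_left.2 hk)
    have h5 := Nat.dvd_gcd (orderOf_dvd_of_pow_eq_one h3) (orderOf_dvd_of_pow_eq_one h2)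
    rw [h4.gcd_eq_one, Nat.dvd_one, orderOf_eq_one_iff, QuotientGroup.eq_one_iff] at h5
    exact h5
  rw [Subgroup.eq_bot_iff_forall]
  intro y hy
  have hyH : y ∈ H := t.zpowers_le (t.innerCore_le hy)
  have hyN : y ∈ Subgroup.centralizer (H.normalCore : Set X) := by
    rw [Subgroup.mem_centralizer_iff]
    intro g hg
    have h1 := hNK (g * y * g⁻¹ * y⁻¹)
      (by
        have h2 := H.normalCore.mul_mem hg
          (H.normalCore_normal.conj_mem _ (H.normalCore.inv_mem hg) y)
        rwa [show g * y * g⁻¹ * y⁻¹ = g * (y * g⁻¹ * y⁻¹) by group])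
      (mul_mem (t.conj_mem_innerCore hy (H.normalCore_le hg)) (inv_mem hy))
    rw [mul_inv_eq_one, mul_inv_eq_iff_eq_mul] at h1
    exact h1
  refine hNK y (t.mem_core_of_commutator (t.innerCore_le hy) (hTN _ ⟨?_, ?_⟩)) hy
  · have h2 : (Subgroup.centralizer (H.normalCore : Set X)).Normal := inferInstance
    have h1 := mul_mem hyN (h2.conj_mem _ (inv_mem hyN) a)
    rwa [show y * a * y⁻¹ * a⁻¹ = y * (a * y⁻¹ * a⁻¹) by group]
  · exact t.rotSubgroup.mul_mem (t.normal_rotSubgroup.conj_mem _ t.a_mem_rotSubgroup y)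
      (t.rotSubgroup.inv_mem t.a_mem_rotSubgroup)

theorem eq_one_of_commute_core (hk : Odd k) {z : X} (hz : z ∈ H.normalCore)
    (hzC : z ∈ Subgroup.zpowers c) (hz1 : z ≠ 1) (hzz : z * z = 1) {f : X} (hf : f ∈ H.normalCore)
    (hfN : ∀ g ∈ H.normalCore, Commute f g) (hfa : Commute f a) : f = 1 := by
  have := t.normal_rotSubgroup
  let F : Subgroup X := H.normalCore ⊓ Subgroup.centralizer (t.rotSubgroup : Set X)
  have hF : F.Normal := inferInstance
  have hmem : f ∈ F := by
    refine ⟨hf, Subgroup.mem_centralizer_iff.2 fun x hx => ?_⟩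
    obtain ⟨j, g, hg, rfl⟩ := t.exists_of_mem_rotSubgroup hx
    exact ((hfa.zpow_right j).mul_right (hfN g hg)).symm
  by_contra hf1
  have hFb : F ≠ ⊥ := fun h => hf1 (by rwa [h, Subgroup.mem_bot] at hmem)
  obtain ⟨j, hj⟩ := t.dc.exists_refl_of_ne_bot t.core hFb
  obtain ⟨g, hg, y, hy, e⟩ := Subgroup.mem_sup_of_normal_left.1 hj
  have hyN : y ∉ H.normalCore := fun h =>
    t.refl_notMem_core hk j (by rw [← e]; exact mul_mem hg.1 h)
  have hyy : y * y ∈ F := by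
    have h1 := F.mul_mem (F.inv_mem hg) (hF.conj_mem _ (F.inv_mem hg) (a ^ j * b))
    have h2 : y = g⁻¹ * (a ^ j * b) := by rw [← e]; group
    have h3 : g⁻¹ * (a ^ j * b * g⁻¹ * (a ^ j * b)⁻¹) = y * y := by
      rw [t.dc.refl_inv, h2]; group
    rwa [h3] at h1
  have hcent : ∀ x : X, Commute x (y * y) := by
    intro x
    obtain ⟨i, h, hh, rfl⟩ := t.exists_rot_mul x
    obtain ⟨g', hg', _, ⟨r, rfl⟩, rfl⟩ := t.exists_core_mul hh
    obtain ⟨l, rfl⟩ := hy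
    rw [← mul_assoc]
    have h1 : a ^ i * g' ∈ t.rotSubgroup := by
      refine mul_mem (zpow_mem t.a_mem_rotSubgroup i) ?_
      rw [t.mem_rotSubgroup_iff, (QuotientGroup.eq_one_iff _).2 hg']
      exact one_mem _
    have h2 : Commute (c ^ r) (c ^ l * c ^ l) := by
      rw [← zpow_add]; exact (Commute.refl c).zpow_zpow _ _
    exact Commute.mul_left (Subgroup.mem_centralizer_iff.1 hyy.2 _ h1) h2
  have hcore : y * y ∈ (Subgroup.zpowers c).normalCore := by
    intro x
    rw [(hcent x).eq, mul_inv_cancel_right]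
    exact mul_mem hy hy
  rw [t.core, Subgroup.mem_bot] at hcore
  by_cases hy1 : y = 1
  · exact hyN (by rw [hy1]; exact one_mem _)
  · exact hyN (by
      rwa [Subgroup.eq_of_mul_self_eq_one_of_mem_zpowers hy hzC hcore hzz hy1 hz1])

end ThickMaximal
end DihedralCyclic

namespace DihedralCyclic

variable {X : Type*} [Group X] {a b c : X}

namespace ThickMaximal

variable {H : Subgroup X} {k : ℕ} (t : ThickMaximal a b c H k)
include t

variable [Finite X]

theorem conj_mem_zpowers_iff {z : X} (hzK : z ∈ t.innerCore) (hz1 : z ≠ 1) (j : ℤ) :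
    a ^ j * z * (a ^ j)⁻¹ ∈ Subgroup.zpowers c ↔ (k : ℤ) ∣ j := by
  rw [← t.dvd]
  exact ⟨fun h => by_contra fun hj => hz1 (t.eq_one_of_conj_mem hzK hj h), fun h => hzK _ h⟩

theorem dvd_of_conj_eq {z : X} (hzK : z ∈ t.innerCore) (hz1 : z ≠ 1) {i j : ℤ}
    (h : a ^ i * z * (a ^ i)⁻¹ = a ^ j * z * (a ^ j)⁻¹) : (k : ℤ) ∣ i - j := by
  rw [← t.conj_mem_zpowers_iff hzK hz1]
  have h1 : a ^ (i - j) * z * (a ^ (i - j))⁻¹ = z := by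
    calc a ^ (i - j) * z * (a ^ (i - j))⁻¹ = (a ^ j)⁻¹ * (a ^ i * z * (a ^ i)⁻¹) * a ^ j := by
          rw [sub_eq_neg_add, zpow_add, zpow_neg]; group
      _ = z := by rw [h]; group
  rw [h1]
  exact t.innerCore_le hzK

theorem eq_three (hk : Odd k) {z : X} (hzK : z ∈ t.innerCore) (hz1 : z ≠ 1) (hzz : z * z = 1)
    (hprod : ∀ i j : ℤ, a ^ i * z * (a ^ i)⁻¹ ∉ Subgroup.zpowers c →
      a ^ j * z * (a ^ j)⁻¹ ∉ Subgroup.zpowers c →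
      a ^ i * z * (a ^ i)⁻¹ * (a ^ j * z * (a ^ j)⁻¹) = 1 ∨
      a ^ i * z * (a ^ i)⁻¹ * (a ^ j * z * (a ^ j)⁻¹) = z) : k = 3 ∧ c * c ∈ H.normalCore := by
  have hprod' : ∀ i j : ℤ, ¬ (k : ℤ) ∣ i → ¬ (k : ℤ) ∣ j → ¬ (k : ℤ) ∣ i - j →
      a ^ i * z * (a ^ i)⁻¹ * (a ^ j * z * (a ^ j)⁻¹) = z := by
    intro i j hi hj hij
    refine (hprod i j (by rwa [t.conj_mem_zpowers_iff hzK hz1])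
      (by rwa [t.conj_mem_zpowers_iff hzK hz1])).resolve_left fun h => hij ?_
    apply t.dvd_of_conj_eq hzK hz1
    have h1 : a ^ j * z * (a ^ j)⁻¹ * (a ^ j * z * (a ^ j)⁻¹) = 1 := by
      rw [conj_mul, hzz]; simp
    rw [← h1] at h
    exact mul_right_cancel h
  have h2 := t.two_le
  have h3 : 3 ≤ k := by
    rcases Nat.lt_or_ge 2 k with h | h
    · exact h
    · rw [show k = 2 by omega] at hk
      exact absurd hk (by decide)
  have hlt : ∀ i : ℤ, 0 < i → i < k → ¬ (k : ℤ) ∣ i := fun i hi hik h =>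
    absurd (Int.le_of_dvd hi h) (by omega)
  have hk3 : k = 3 := by
    by_contra hne
    have e1 := hprod' 2 1 (hlt 2 (by norm_num) (by omega)) (hlt 1 (by norm_num) (by omega))
      (hlt _ (by norm_num) (by omega))
    have e2 := hprod' 3 1 (hlt 3 (by norm_num) (by omega)) (hlt 1 (by norm_num) (by omega))
      (hlt _ (by norm_num) (by omega))
    have h4 := t.dvd_of_conj_eq hzK hz1 (mul_right_cancel (e2.trans e1.symm))
    exact hlt _ (by norm_num) (by omega) h4
  refine ⟨hk3, t.mem_core_of_commutator (mul_mem (Subgroup.mem_zpowers c)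
    (Subgroup.mem_zpowers c)) ?_⟩
  obtain ⟨i, hi⟩ := t.exists_conj_eq c
  have hrot : ∀ j : ℤ, (a : X ⧸ H.normalCore) ^ j = 1 ↔ (3 : ℤ) ∣ j := by
    intro j
    rw [← QuotientGroup.mk_zpow, QuotientGroup.eq_one_iff, t.rot_mem_iff, hk3]; norm_num
  have hi3 : ¬ (3 : ℤ) ∣ i := by
    intro h
    rw [← hrot, ← hi, QuotientGroup.eq_one_iff] at h
    have h5 := H.normalCore_normal.conj_mem _ h c⁻¹
    rw [show c⁻¹ * (c * a * c⁻¹) * c⁻¹⁻¹ = a by group] at h5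
    exact t.a_notMem (H.normalCore_le h5)
  rw [QuotientGroup.mk_mul, QuotientGroup.mk_mul, QuotientGroup.mk_inv] at hi
  have h5 : (c : X ⧸ H.normalCore) * (c * a * (c : X ⧸ H.normalCore)⁻¹) *
      (c : X ⧸ H.normalCore)⁻¹ = (a : X ⧸ H.normalCore) ^ (i * i) := by
    rw [hi, ← conj_zpow, hi, zpow_mul]
  rw [← QuotientGroup.eq_one_iff]
  simp only [QuotientGroup.mk_mul, QuotientGroup.mk_inv]
  rw [mul_inv_rev, show (c : X ⧸ H.normalCore) * c * a * ((c : X ⧸ H.normalCore)⁻¹ *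
    (c : X ⧸ H.normalCore)⁻¹) = (a : X ⧸ H.normalCore) ^ (i * i) by rw [← h5]; group,
    ← zpow_sub_one, hrot]
  obtain ⟨r, hr | hr⟩ : ∃ r : ℤ, i = 3 * r + 1 ∨ i = 3 * r + 2 := ⟨i / 3, by omega⟩
  · exact ⟨3 * r * r + 2 * r, by rw [hr]; ring⟩
  · exact ⟨3 * r * r + 4 * r + 1, by rw [hr]; ring⟩

theorem admissible_of_pow_eq_one (hk : Odd k) {z : X} (hz : z ∈ H.normalCore)
    (hzK : z ∈ t.innerCore) (hz1 : z ≠ 1) (hzz : z * z = 1) (ha : a ^ k = 1)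
    (hc : c ∈ t.innerCore) : Admissible (orderOf a) (orderOf c) := by
  have hzC := t.innerCore_le hzK
  have hKC : ∀ y ∈ Subgroup.zpowers c, y ∈ t.innerCore := fun y hy =>
    Subgroup.zpowers_le.2 hc hy
  have hNC : ∀ y ∈ H.normalCore, y ∈ Subgroup.zpowers c → y = 1 ∨ y = z := by
    intro y hy hyC
    have h1 : a * (y * y) * a⁻¹ ∈ Subgroup.zpowers c := by
      rw [← conj_mul]
      exact t.mul_self_mem ha hc (H.normalCore_le (H.normalCore_normal.conj_mem y hy a))
    have h2 := t.eq_one_of_conj_mem (hKC _ (mul_mem hyC hyC)) t.a_notMem h1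
    by_cases hy1 : y = 1
    · exact Or.inl hy1
    · exact Or.inr (Subgroup.eq_of_mul_self_eq_one_of_mem_zpowers hyC hzC h2 hzz hy1 hz1)
  obtain ⟨hk3, hcc⟩ := t.eq_three hk hzK hz1 hzz (by
    intro i j hi hj
    have hiN := H.normalCore_normal.conj_mem z hz (a ^ i)
    have hjN := H.normalCore_normal.conj_mem z hz (a ^ j)
    apply hNC _ (mul_mem hiN hjN)
    obtain ⟨l, hl⟩ := (t.mem_or_eq_b_mul ha (H.normalCore_le hiN)).resolve_left hi
    obtain ⟨l', hl'⟩ := (t.mem_or_eq_b_mul ha (H.normalCore_le hjN)).resolve_left hj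
    rw [hl, hl']
    have h1 := mul_mem (hKC _ ⟨l, rfl⟩ b t.b_mem) (⟨l', rfl⟩ : c ^ l' ∈ Subgroup.zpowers c)
    rwa [t.dc.b_inv, mul_assoc] at h1)
  have hcN := t.c_notMem_core hk
  have hcC : c * c ∈ Subgroup.zpowers c :=
    mul_mem (Subgroup.mem_zpowers c) (Subgroup.mem_zpowers c)
  have hcc1 : c * c ≠ 1 := by
    intro h
    rw [Subgroup.eq_of_mul_self_eq_one_of_mem_zpowers (Subgroup.mem_zpowers c) hzC h hzz
      t.c_ne_one hz1] at hcN
    exact hcN hz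
  have hccz := (hNC _ hcc hcC).resolve_left hcc1
  have hoc : orderOf c = 2 ^ (1 + 1) := by
    apply orderOf_eq_prime_pow
    · simpa [pow_two] using hcc1
    · rw [show 2 ^ (1 + 1) = 2 * 2 by norm_num, pow_mul, pow_two c, hccz, pow_two, hzz]
  have ho := t.orderOf_eq
  rw [ha, orderOf_one, hk3] at ho
  rw [ho, hoc]
  simp [Admissible]

end ThickMaximal
end DihedralCyclic

namespace DihedralCyclic

variable {X : Type*} [Group X] {a b c : X}

namespace ThickMaximal

variable {H : Subgroup X} {k : ℕ} (t : ThickMaximal a b c H k)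
include t

variable [Finite X]

theorem exists_elementary (hk : Odd k) {z : X} (hz : z ∈ H.normalCore) (hzK : z ∈ t.innerCore)
    (hz1 : z ≠ 1) (hzz : z * z = 1) : ∃ E : Subgroup X, E.Normal ∧ E ≤ H.normalCore ∧
      (∀ x ∈ E, ∀ g ∈ H.normalCore, Commute x g) ∧
      (∀ j : ℤ, a ^ j ∈ E ⊔ Subgroup.zpowers c → a ^ j = 1) ∧
      (∃ (i : ℤ) (e : X) (l : ℤ), e ∈ E ∧ a ^ i * b = e * c ^ l ∧ c ^ l * c ^ l = z ∧ Odd l) ∧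
      k = 3 ∧ c * c ∈ H.normalCore := by
  have hzC := t.innerCore_le hzK
  let E := Subgroup.normalClosure {z}
  have hzE : z ∈ E := Subgroup.subset_normalClosure (Set.mem_singleton z)
  have hEn : E.Normal := Subgroup.normalClosure_normal
  have hEN : E ≤ H.normalCore :=
    Subgroup.normalClosure_le_normal (Set.singleton_subset_iff.2 hz)
  have hEcent : E ≤ Subgroup.centralizer (H.normalCore : Set X) := by
    refine Subgroup.normalClosure_le_normal (Set.singleton_subset_iff.2 ?_)
    exact Subgroup.mem_centralizer_iff.2 fun g hg =>
      t.commute_of_mem hzK hz1 hzz (H.normalCore_le hg)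
  have hE : ∀ x ∈ E, ∀ g ∈ H.normalCore, Commute x g := fun x hx g hg =>
    (Subgroup.mem_centralizer_iff.1 (hEcent hx) g hg).symm
  have hEE : ∀ x ∈ E, x * x = 1 := by
    intro x hx
    induction hx using Subgroup.closure_induction with
    | mem x hx =>
      obtain ⟨_, h1, h2⟩ := Group.mem_conjugatesOfSet_iff.1 hx
      rw [Set.mem_singleton_iff] at h1
      rw [h1, isConj_iff] at h2
      obtain ⟨g, rfl⟩ := h2
      rw [conj_mul, hzz]; simp
    | one => simp
    | mul x y hx hy h1 h2 =>
      have h3 := (hE x hx y (hEN hy)).eq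
      calc x * y * (x * y) = x * (y * x) * y := by group
        _ = x * x * (y * y) := by rw [← h3]; group
        _ = 1 := by rw [h1, h2, one_mul]
    | inv x hx h1 => rw [← mul_inv_rev, h1, inv_one]
  have hrotE : ∀ j : ℤ, a ^ j ∈ E → a ^ j = 1 := fun j hj =>
    t.eq_one_of_commute_core hk hz hzC hz1 hzz (hEN hj) (hE _ hj) ((Commute.refl a).zpow_left j)
  have hsq : ∀ y ∈ Subgroup.zpowers c, y * y = 1 → y = 1 ∨ y = z := by
    intro y hy hyy
    by_cases hy1 : y = 1
    · exact Or.inl hy1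
    · exact Or.inr (Subgroup.eq_of_mul_self_eq_one_of_mem_zpowers hy hzC hyy hzz hy1 hz1)
  have hsqE : ∀ y ∈ Subgroup.zpowers c, y * y = 1 → y ∈ E := by
    intro y hy hyy
    rcases hsq y hy hyy with rfl | rfl
    · exact one_mem _
    · exact hzE
  have hEb : E ≠ ⊥ := fun h => hz1 (by rwa [h, Subgroup.mem_bot] at hzE)
  obtain ⟨i, hi⟩ := t.dc.exists_refl_of_ne_bot t.core hEb
  obtain ⟨e, he, y, hy, hey⟩ := Subgroup.mem_sup_of_normal_left.1 hi
  have hyN : y ∉ H.normalCore := fun h =>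
    t.refl_notMem_core hk i (by rw [← hey]; exact mul_mem (hEN he) h)
  have hyyE : y * y ∈ E := by
    have h1 := E.mul_mem (E.inv_mem he) (hEn.conj_mem _ (E.inv_mem he) (a ^ i * b))
    have h2 : y = e⁻¹ * (a ^ i * b) := by rw [← hey]; group
    have h3 : e⁻¹ * (a ^ i * b * e⁻¹ * (a ^ i * b)⁻¹) = y * y := by
      rw [t.dc.refl_inv, h2]; group
    rwa [h3] at h1
  have hyyz : y * y = z := by
    refine (hsq _ (mul_mem hy hy) (hEE _ hyyE)).resolve_left fun h => hyN ?_
    exact hEN (hsqE y hy h)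
  have hrot : ∀ j : ℤ, a ^ j ∈ E ⊔ Subgroup.zpowers c → a ^ j = 1 := by
    intro j hj
    obtain ⟨e', he', y', hy', hej⟩ := Subgroup.mem_sup_of_normal_left.1 hj
    have hjN : a ^ j ∈ H.normalCore := by
      apply t.rot_mem
      rw [← hej]
      exact H.mul_mem (H.normalCore_le (hEN he')) (t.zpowers_le hy')
    have h1 : y' = e'⁻¹ * a ^ j := by rw [← hej]; group
    have h2 : y' * y' = a ^ (j + j) := by
      have h3 := (hE _ (inv_mem he') _ hjN).eq
      calc y' * y' = e'⁻¹ * (a ^ j * e'⁻¹) * a ^ j := by rw [h1]; group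
        _ = (e' * e')⁻¹ * (a ^ j * a ^ j) := by rw [← h3]; group
        _ = a ^ (j + j) := by rw [hEE e' he', zpow_add]; simp
    have h3 : y' * y' = 1 := by
      rw [h2]
      exact t.dc.eq_one_of_mem (by rw [← h2]; exact mul_mem hy' hy')
    exact hrotE j (by rw [← hej]; exact mul_mem he' (hsqE y' hy' h3))
  have hform : ∀ x ∈ E, x ∉ Subgroup.zpowers c → ∃ l : ℤ, x = a ^ i * b * c ^ l := by
    intro x hx hxC
    obtain ⟨j, l, e1 | e1⟩ := t.dc.cover x
    · exfalso
      apply hxC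
      have h1 : a ^ j ∈ E ⊔ Subgroup.zpowers c := by
        rw [show a ^ j = x * c ^ (-l) by rw [e1]; group]
        exact Subgroup.mul_mem_sup hx ⟨-l, rfl⟩
      rw [hrot j h1, one_mul] at e1
      exact ⟨l, e1.symm⟩
    · have h1 : a ^ j * b ∈ E ⊔ Subgroup.zpowers c := by
        rw [show a ^ j * b = x * c ^ (-l) by rw [e1]; group]
        exact Subgroup.mul_mem_sup hx ⟨-l, rfl⟩
      have h2 := hrot (j - i) (by rw [← t.dc.refl_mul_refl]; exact mul_mem h1 hi)
      refine ⟨l, ?_⟩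
      rw [e1, show j = (j - i) + i by ring, zpow_add, h2, one_mul]
  obtain ⟨hk3, hcc⟩ := t.eq_three hk hzK hz1 hzz (by
    intro r s hr hs
    have hrE := hEn.conj_mem z hzE (a ^ r)
    have hsE := hEn.conj_mem z hzE (a ^ s)
    refine hsq _ ?_ (hEE _ (mul_mem hrE hsE))
    obtain ⟨l, hl⟩ := hform _ hrE hr
    obtain ⟨l', hl'⟩ := hform _ hsE hs
    have h1 : a ^ r * z * (a ^ r)⁻¹ = (a ^ r * z * (a ^ r)⁻¹)⁻¹ :=
      eq_inv_of_mul_eq_one_left (hEE _ hrE)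
    rw [h1, hl, hl']
    exact ⟨l' - l, by simp only; group⟩)
  refine ⟨E, hEn, hEN, hE, hrot, ⟨i, e, ?_⟩, hk3, hcc⟩
  obtain ⟨l, rfl⟩ := hy
  refine ⟨l, he, hey.symm, hyyz, ?_⟩
  rw [← Int.not_even_iff_odd]
  rintro ⟨r, rfl⟩
  apply hyN
  simp only
  rw [zpow_add, ← (Commute.refl c).mul_zpow]
  exact zpow_mem hcc r

theorem relIndex_zpowers : (Subgroup.zpowers c).relIndex H = 2 * orderOf (a ^ k) := by
  have h1 := (t.dc.subgroup t.dvd t.pow_mem t.b_mem t.c_mem).index_zpowers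
  rw [Subgroup.relIndex]
  have h2 : (Subgroup.zpowers c).subgroupOf H = Subgroup.zpowers (⟨c, t.c_mem⟩ : H) := by
    ext x
    rw [Subgroup.mem_subgroupOf]
    constructor
    · rintro ⟨j, hj⟩
      exact ⟨j, Subtype.ext (by simpa using hj)⟩
    · rintro ⟨j, rfl⟩
      exact ⟨j, by simp⟩
  rw [h2, h1, ← Subgroup.orderOf_coe]

end ThickMaximal
end DihedralCyclic

theorem Subgroup.mul_self_mem_of_relIndex_eq_two {X : Type*} [Group X] {K L : Subgroup X}
    (h : K.relIndex L = 2) {x : X} (hx : x ∈ L) : x * x ∈ K := by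
  have := Subgroup.mul_self_mem_of_index_two h (⟨x, hx⟩ : L)
  rwa [Subgroup.mem_subgroupOf] at this

theorem Subgroup.conj_mem_of_relIndex_eq_two {X : Type*} [Group X] {K L : Subgroup X}
    (h : K.relIndex L = 2) (hKL : K ≤ L) {x y : X} (hx : x ∈ L) (hy : y ∈ K) :
    x * y * x⁻¹ ∈ K :=
  (Subgroup.normal_of_index_eq_two h).conj_mem ⟨y, hKL hy⟩ (Subgroup.mem_subgroupOf.2 hy) ⟨x, hx⟩

namespace DihedralCyclic

variable {X : Type*} [Group X] {a b c : X}

namespace ThickMaximal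

variable {H : Subgroup X} {k : ℕ} (t : ThickMaximal a b c H k)
include t

variable [Finite X]

theorem pow_eq_one_of_odd (hk : Odd k) {z : X} (hz : z ∈ H.normalCore)
    (hzK : z ∈ t.innerCore) (hz1 : z ≠ 1) (hzz : z * z = 1) {m₁ : ℕ}
    (hm : ∀ j : ℤ, c ^ j ∈ t.innerCore ↔ (m₁ : ℤ) ∣ j) (had : Admissible (orderOf (a ^ k)) m₁) :
    a ^ k = 1 := by
  by_contra ha
  have hzC := t.innerCore_le hzK
  obtain ⟨E, hEn, hEN, hE, hrot, ⟨i, e, l, he, hel, hlz, hl⟩, hk3, hcc⟩ :=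
    t.exists_elementary hk hz hzK hz1 hzz
  have hkE : a ^ k ∈ E ⊔ Subgroup.zpowers c → a ^ k = 1 := by
    have := hrot k
    rwa [zpow_natCast] at this
  have hinv : c ^ l * a ^ k * (c ^ l)⁻¹ = (a ^ k)⁻¹ := by
    have h1 : c ^ l = e⁻¹ * (a ^ i * b) := by rw [hel]; group
    have h2 : a ^ i * b * a ^ k * (a ^ i * b)⁻¹ = (a ^ k)⁻¹ := by
      rw [t.dc.refl_inv]
      have h3 := t.dc.refl_mul_zpow i k
      rw [zpow_natCast] at h3
      rw [h3, t.dc.refl_mul_refl, ← zpow_natCast, ← zpow_neg]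
      congr 1; ring
    have h3 := (hE e he _ (inv_mem t.pow_mem_core)).eq
    calc c ^ l * a ^ k * (c ^ l)⁻¹ = e⁻¹ * (a ^ i * b * a ^ k * (a ^ i * b)⁻¹) * e := by
          rw [h1]; group
      _ = (a ^ k)⁻¹ := by rw [h2, mul_assoc, ← h3]; group
  have hlK : c ^ l ∈ t.innerCore → a ^ k * a ^ k = 1 := by
    intro h
    have h1 := h _ t.pow_mem
    have h2 : a ^ k * c ^ l * (a ^ k)⁻¹ = a ^ k * a ^ k * c ^ l := by
      have h3 := congrArg (fun x => a ^ k * x⁻¹ * c ^ l) hinv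
      simp only [mul_inv_rev, inv_inv] at h3
      rw [← h3]; group
    rw [h2, (Subgroup.zpowers c).mul_mem_cancel_right ⟨l, rfl⟩, ← pow_add] at h1
    have h3 := t.dc.eq_one_of_mem (j := ((k + k : ℕ) : ℤ)) (by rwa [zpow_natCast])
    rwa [zpow_natCast, pow_add] at h3
  have hz2 : c ^ (l + l) = z := by rw [zpow_add, hlz]
  have hml : (m₁ : ℤ) ∣ l + l := (hm _).1 (by rw [hz2]; exact hzK)
  rcases had with ⟨h1, h2⟩ | ⟨h1, h2⟩ | ⟨h1, h2⟩ | ⟨h1, h2⟩ | ⟨h1, h2⟩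
  · exact ha (orderOf_eq_one_iff.1 h1)
  · have hccK : c * c ∈ t.innerCore := by
      rw [← zpow_two, hm, h2]; norm_num
    have hccz : c * c = 1 ∨ c * c = z := by
      have h3 : c * c * (c * c) = 1 := by
        refine t.eq_one_of_odd (mul_mem hcc hcc) (mul_mem hccK hccK) ?_
        have h4 : (c * c * (c * c)) ^ l.natAbs = 1 := by
          have h5 : (c * c * (c * c)) ^ l = 1 := by
            rw [(Commute.refl (c * c)).mul_zpow, (Commute.refl c).mul_zpow, hlz, hzz]
          rcases Int.natAbs_eq l with h6 | h6
          · rwa [h6, zpow_natCast] at h5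
          · rwa [h6, zpow_neg, inv_eq_one, zpow_natCast] at h5
        exact Odd.of_dvd_nat (Int.natAbs_odd.2 hl) (orderOf_dvd_of_pow_eq_one h4)
      by_cases h4 : c * c = 1
      · exact Or.inl h4
      · exact Or.inr (Subgroup.eq_of_mul_self_eq_one_of_mem_zpowers (t.innerCore_le hccK) hzC h3
          hzz h4 hz1)
    have hcomm2 : Commute (a ^ k) (c * c) := by
      rcases hccz with h | h <;> rw [h]
      · exact Commute.one_right _
      · exact t.commute_of_mem hzK hz1 hzz t.pow_mem
    have heven : ∀ s : ℤ, c ^ s ∈ H.normalCore → Commute (a ^ k) (c ^ s) := by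
      intro s hs
      rcases Int.even_or_odd s with ⟨r, rfl⟩ | ⟨r, rfl⟩
      · rw [zpow_add, ← (Commute.refl c).mul_zpow]
        exact hcomm2.zpow_right r
      · exfalso
        apply t.c_notMem_core hk
        rw [zpow_add, zpow_mul, zpow_one] at hs
        refine (H.normalCore.mul_mem_cancel_left (zpow_mem ?_ r)).1 hs
        rwa [zpow_two]
    refine ha (t.eq_one_of_commute_core hk hz hzC hz1 hzz t.pow_mem_core ?_
      ((Commute.refl a).pow_left k))
    intro g hg
    have hcr : ∀ j : ℤ, Commute (a ^ k) (a ^ j) := fun j =>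
      ((Commute.refl a).pow_left k).zpow_right j
    obtain ⟨j, s, rfl | rfl⟩ := t.dc.cover g
    · have hj := t.rot_mem _ (t.rot_mem_of_cyclic_mem (H.normalCore_le hg))
      exact (hcr j).mul_right (heven s ((H.normalCore.mul_mem_cancel_left hj).1 hg))
    · have h3 : a ^ j * b * c ^ s = a ^ (j - i) * (e * c ^ (l + s)) := by
        have h4 : a ^ j * b = a ^ (j - i) * (a ^ i * b) := by
          rw [← mul_assoc, ← zpow_add]; congr 2; ring
        rw [h4, hel, zpow_add]; group
      have hj : a ^ (j - i) ∈ H.normalCore := by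
        apply t.rot_mem
        rw [← t.dc.refl_mul_refl]
        refine H.mul_mem (H.mul_mem (t.rot_mem_of_refl_mem (H.normalCore_le hg)) t.b_mem) ?_
        rw [hel]
        exact H.mul_mem (H.normalCore_le (hEN he)) (H.zpow_mem t.c_mem l)
      rw [h3] at hg ⊢
      have h4 := (H.normalCore.mul_mem_cancel_left hj).1 hg
      have h5 := (H.normalCore.mul_mem_cancel_left (hEN he)).1 h4
      exact (hcr _).mul_right ((hE e he _ t.pow_mem_core).symm.mul_right (heven _ h5))
  · have hlm : c ^ l ∈ t.innerCore := by
      rw [hm, h2]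
      rw [h2] at hml
      push_cast at hml ⊢
      omega
    have hEH : E ⊔ Subgroup.zpowers c ≤ H :=
      sup_le (hEN.trans H.normalCore_le) t.zpowers_le
    have hrel := Subgroup.relIndex_mul_relIndex (Subgroup.zpowers c) (E ⊔ Subgroup.zpowers c) H
      le_sup_right hEH
    rw [t.relIndex_zpowers, h1] at hrel
    have hr1 : (Subgroup.zpowers c).relIndex (E ⊔ Subgroup.zpowers c) ≠ 1 := by
      rw [Ne, Subgroup.relIndex_eq_one]
      intro h
      apply t.dc.refl_notMem i
      apply h
      rw [hel]
      exact Subgroup.mul_mem_sup he ⟨l, rfl⟩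
    have hr2 : (E ⊔ Subgroup.zpowers c).relIndex H ≠ 1 := by
      rw [Ne, Subgroup.relIndex_eq_one]
      exact fun h => ha (hkE (h t.pow_mem))
    have hr : (Subgroup.zpowers c).relIndex (E ⊔ Subgroup.zpowers c) = 2 ∧
        (E ⊔ Subgroup.zpowers c).relIndex H = 2 := by
      generalize (Subgroup.zpowers c).relIndex (E ⊔ Subgroup.zpowers c) = p at *
      generalize (E ⊔ Subgroup.zpowers c).relIndex H = q at *
      have h3 : p ≤ 4 := Nat.le_of_dvd (by norm_num) ⟨q, by omega⟩
      interval_cases p <;> omega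
    have hccK : c * c ∈ t.innerCore := by
      intro x hx
      rw [← conj_mul]
      exact Subgroup.mul_self_mem_of_relIndex_eq_two hr.1
        (Subgroup.conj_mem_of_relIndex_eq_two hr.2 hEH hx
          (Subgroup.mem_sup_right (Subgroup.mem_zpowers c)))
    rw [← zpow_two, hm, h2] at hccK
    norm_num at hccK
  · have h3 := hlK (by
      rw [hm, h2]
      rw [h2] at hml
      push_cast at hml ⊢
      omega)
    have h4 := orderOf_dvd_of_pow_eq_one (x := a ^ k) (n := 2) (by rw [pow_two, h3])
    rw [h1] at h4
    norm_num at h4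
  · rw [h2] at hml
    push_cast at hml
    obtain ⟨r, rfl⟩ := hl
    omega

theorem admissible {m₁ : ℕ} (hm : ∀ j : ℤ, c ^ j ∈ t.innerCore ↔ (m₁ : ℤ) ∣ j)
    (had : Admissible (orderOf (a ^ k)) m₁) : Admissible (orderOf a) (orderOf c) := by
  by_cases hK : t.innerCore = ⊥
  · exact t.admissible_of_innerCore_eq_bot hm had hK
  rcases Nat.even_or_odd k with hk | hk
  · exact t.admissible_of_even hk hm had hK
  · have hNK : ∃ y ∈ H.normalCore, y ∈ t.innerCore ∧ y ≠ 1 := by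
      by_contra! h
      exact hK (t.innerCore_eq_bot_of_odd hk h)
    obtain ⟨y, hy, hyK, hy1⟩ := hNK
    obtain ⟨z, hz, hzK, hz1, hzz⟩ := t.exists_involution hy hyK hy1
    have ha := t.pow_eq_one_of_odd hk hz hzK hz1 hzz hm had
    refine t.admissible_of_pow_eq_one hk hz hzK hz1 hzz ha ?_
    have hm1 : m₁ = 1 := by
      rw [ha, orderOf_one] at had
      rcases had with h | h | h | h | h <;> omega
    have := (hm 1).2 (by rw [hm1]; simp)
    rwa [zpow_one] at this

end ThickMaximal
end DihedralCyclic

universe u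

namespace DihedralCyclic

section
variable {X : Type u} [Group X] {a b c : X} (h : DihedralCyclic a b c)
include h

theorem exists_rot_mul {H : Subgroup X} (hc : c ∈ H) (hb : b ∈ H) (x : X) :
    ∃ j : ℤ, ∃ y ∈ H, x = a ^ j * y := by
  obtain ⟨j, k, e | e⟩ := h.cover x
  · exact ⟨j, _, H.zpow_mem hc k, e⟩
  · exact ⟨j, _, H.mul_mem hb (H.zpow_mem hc k), by rw [e, mul_assoc]⟩

theorem rot_mem_normalCore {H : Subgroup X} (hc : c ∈ H) (hb : b ∈ H) {j : ℤ} (hj : a ^ j ∈ H) :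
    a ^ j ∈ H.normalCore := by
  intro x
  obtain ⟨i, y, hy, e⟩ := h.exists_rot_mul hc hb x⁻¹
  have h1 : x * a ^ j * x⁻¹ = y⁻¹ * a ^ j * y := by
    rw [← inv_inv x, e]
    group
  rw [h1]
  exact H.mul_mem (H.mul_mem (H.inv_mem hy) hj) hy

theorem thinMaximal_or_thickMaximal (hcore : (Subgroup.zpowers c).normalCore = ⊥) {H : Subgroup X}
    (hH : IsCoatom H) (hc : c ∈ H) (hb : b ∈ H) {k : ℕ} (hk : ∀ j : ℤ, a ^ j ∈ H ↔ (k : ℤ) ∣ j) :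
    ThinMaximal a b c H ∨ ThickMaximal a b c H k := by
  have hrot : ∀ j : ℤ, a ^ j ∈ H → a ^ j ∈ H.normalCore := fun j => h.rot_mem_normalCore hc hb
  by_cases hr : ∃ r : ℤ, a ^ r * b ∈ H.normalCore ⊔ Subgroup.zpowers c
  · right
    refine ⟨h, hH, hc, hb, hrot, le_antisymm (sup_le H.normalCore_le (Subgroup.zpowers_le.2 hc)) ?_,
      hcore, hk⟩
    obtain ⟨r, hr⟩ := hr
    have hle : H.normalCore ⊔ Subgroup.zpowers c ≤ H :=
      sup_le H.normalCore_le (Subgroup.zpowers_le.2 hc)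
    have hb' : b ∈ H.normalCore ⊔ Subgroup.zpowers c :=
      (Subgroup.mul_mem_cancel_left _ (Subgroup.mem_sup_left
        (hrot r ((H.mul_mem_cancel_right hb).1 (hle hr))))).1 hr
    have hc' : c ∈ H.normalCore ⊔ Subgroup.zpowers c :=
      Subgroup.mem_sup_right (Subgroup.mem_zpowers c)
    intro x hx
    obtain ⟨j, l, rfl | rfl⟩ := h.cover x
    · have hj := (H.mul_mem_cancel_right (H.zpow_mem hc l)).1 hx
      exact mul_mem (Subgroup.mem_sup_left (hrot j hj)) (zpow_mem hc' l)
    · have hj := (H.mul_mem_cancel_right hb).1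
        ((H.mul_mem_cancel_right (H.zpow_mem hc l)).1 hx)
      exact mul_mem (mul_mem (Subgroup.mem_sup_left (hrot j hj)) hb') (zpow_mem hc' l)
  · left
    push Not at hr
    have hN : H.normalCore = ⊥ := by
      apply Subgroup.eq_bot_of_normal_le_of_normalCore_eq_bot hcore
      exact le_sup_left.trans (h.min _ (Subgroup.mem_sup_right (Subgroup.mem_zpowers c)) hr)
    refine ⟨h, hH, hc, hb, fun j hj => ?_, hN⟩
    have := hrot j hj
    rwa [hN, Subgroup.mem_bot] at this

end

theorem admissible_of_card (n : ℕ) : ∀ {X : Type u} [Group X] [Finite X] {a b c : X},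
    DihedralCyclic a b c → (Subgroup.zpowers c).normalCore = ⊥ → Nat.card X = n →
    Admissible (orderOf a) (orderOf c) := by
  induction n using Nat.strong_induction_on with
  | _ n ih =>
    intro X _ _ a b c h hcore hn
    obtain ⟨H, hH, hle⟩ := (eq_top_or_exists_le_coatom (Subgroup.zpowers c)).resolve_left
      fun e => h.b_notMem (by rw [e]; trivial)
    by_cases hHC : ∃ i : ℤ, a ^ i * b ∈ H
    · obtain ⟨i, hb⟩ := hHC
      have h' := h.rebase i
      have hc : c ∈ H := hle (Subgroup.mem_zpowers c)
      obtain ⟨k, hk⟩ := H.exists_zpow_mem_iff a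
      rcases h'.thinMaximal_or_thickMaximal hcore hH hc hb hk with t | t
      · exact t.admissible
      · have h2 := t.dc.subgroup t.dvd t.pow_mem t.b_mem t.c_mem
        have hcard : Nat.card (H ⧸ (Subgroup.zpowers (⟨c, t.c_mem⟩ : H)).normalCore) < n := by
          refine (Nat.card_le_card_of_surjective _ QuotientGroup.mk_surjective).trans_lt ?_
          rw [← hn]
          exact lt_of_le_of_ne H.card_le_card_group fun e => hH.1 (H.card_eq_iff_eq_top.1 e)
        have h3 := ih _ hcard h2.quotient_core normalCore_quotient_core rfl
        rw [h2.orderOf_quotient_core, Subgroup.orderOf_mk] at h3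
        refine t.admissible ?_ h3
        intro j
        rw [orderOf_dvd_iff_zpow_eq_one, ← QuotientGroup.mk_zpow, QuotientGroup.eq_one_iff]
        have hz : ∀ x : H, x ∈ Subgroup.zpowers (⟨c, t.c_mem⟩ : H) ↔
            (x : X) ∈ Subgroup.zpowers c := by
          intro x
          constructor
          · rintro ⟨i, rfl⟩
            exact ⟨i, by simp⟩
          · rintro ⟨i, hi⟩
            exact ⟨i, Subtype.ext (by simpa using hi)⟩
        constructor
        · intro hj g
          rw [hz]
          simpa using hj g g.2
        · intro hj g hg
          have := (hz _).1 (hj ⟨g, hg⟩)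
          simpa using this
    · push Not at hHC
      have : H = Subgroup.zpowers c :=
        le_antisymm (h.min H (hle (Subgroup.mem_zpowers c)) hHC) hle
      rw [this] at hH
      exact h.admissible_of_isCoatom hcore hH

/-- The numerical classification of core-free products. -/
theorem admissible {X : Type u} [Group X] [Finite X] {a b c : X} (h : DihedralCyclic a b c)
    (hcore : (Subgroup.zpowers c).normalCore = ⊥) : Admissible (orderOf a) (orderOf c) :=
  admissible_of_card _ h hcore rfl

end DihedralCyclic

theorem Subgroup.exists_injective_perm_of_index_eq {X : Type*} [Group X] {H : Subgroup X} {n : ℕ}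
    [NeZero n] (hi : H.index = n) (hH : H.normalCore = ⊥) :
    ∃ f : X →* Equiv.Perm (Fin n), Function.Injective f := by
  have hfin : Finite (X ⧸ H) := Nat.finite_of_card_ne_zero (by
    rw [← Subgroup.index_eq_card, hi]; exact NeZero.ne n)
  have e : (X ⧸ H) ≃ Fin n := Finite.equivFinOfCardEq (by rw [← Subgroup.index_eq_card, hi])
  refine ⟨(e.permCongrHom.toMonoidHom).comp (MulAction.toPermHom X (X ⧸ H)), ?_⟩
  rw [MonoidHom.coe_comp]
  refine e.permCongrHom.injective.comp ?_
  rw [← MonoidHom.ker_eq_bot_iff, ← Subgroup.normalCore_eq_ker, hH]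

theorem nonempty_mulEquiv_perm_of_index_eq_four {X : Type*} [Group X] [Finite X] {H : Subgroup X}
    (hi : H.index = 4) (hH : H.normalCore = ⊥) (hX : Nat.card X = 24) :
    Nonempty (X ≃* Equiv.Perm (Fin 4)) := by
  obtain ⟨f, hf⟩ := Subgroup.exists_injective_perm_of_index_eq hi hH
  refine ⟨MulEquiv.ofBijective f ((Nat.bijective_iff_injective_and_card f).2 ⟨hf, ?_⟩)⟩
  rw [hX, Nat.card_perm, Nat.card_fin]; rfl

theorem nonempty_mulEquiv_alternatingGroup_of_index_eq_four {X : Type*} [Group X] [Finite X]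
    {H : Subgroup X} (hi : H.index = 4) (hH : H.normalCore = ⊥) (hX : Nat.card X = 12) :
    Nonempty (X ≃* alternatingGroup (Fin 4)) := by
  obtain ⟨f, hf⟩ := Subgroup.exists_injective_perm_of_index_eq hi hH
  have hr : f.range.index = 2 := by
    have h1 := f.range.card_mul_index
    rw [Nat.card_congr (MonoidHom.ofInjective hf).symm.toEquiv, hX, Nat.card_perm, Nat.card_fin,
      show Nat.factorial 4 = 24 from rfl] at h1
    omega
  exact ⟨(MonoidHom.ofInjective hf).trans
    (MulEquiv.subgroupCongr (Equiv.Perm.eq_alternatingGroup_of_index_eq_two hr))⟩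

theorem nonempty_mulEquiv_dihedralGroup {X : Type*} [Group X] [Finite X] {n : ℕ} [NeZero n]
    {r s : X} (hr : orderOf r = n) (hs : s * s = 1) (hrs : s * r * s⁻¹ = r⁻¹)
    (hsr : s ∉ Subgroup.zpowers r) (hX : Nat.card X = 2 * n) :
    Nonempty (X ≃* DihedralGroup n) := by
  have hn : (zmultiplesHom (Additive X) (Additive.ofMul r)) n = 0 := by
    rw [zmultiplesHom_apply, natCast_zsmul, ← ofMul_pow, ← hr, pow_orderOf_eq_one]; rfl
  set g : ZMod n →+ Additive X := ZMod.lift n ⟨_, hn⟩ with hg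
  let g' : ZMod n → X := fun i => (g i).toMul
  have hadd : ∀ i j, g' (i + j) = g' i * g' j := fun i j => by simp [g']
  have hsub : ∀ i j, g' (i - j) = g' i * (g' j)⁻¹ := fun i j => by
    simp [g', div_eq_mul_inv]
  have hz : ∀ k : ℤ, g' k = r ^ k := fun k => by
    simp [g', hg, ZMod.lift_coe]
  have hex : ∀ i : ZMod n, ∃ k : ℤ, i = k := fun i => ⟨i.cast, by simp⟩
  have hs' : s⁻¹ = s := inv_eq_of_mul_eq_one_left hs
  have hconj : ∀ i, g' i * s = s * (g' i)⁻¹ := fun i => by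
    obtain ⟨k, rfl⟩ := hex i
    rw [hz]
    have h1 : s * r ^ k * s⁻¹ = (r ^ k)⁻¹ := by rw [← conj_zpow, hrs, inv_zpow]
    rw [← h1, hs', ← mul_assoc, ← mul_assoc, hs, one_mul]
  have hcomm : ∀ i j, g' i * g' j = g' j * g' i := fun i j => by
    rw [← hadd, ← hadd, add_comm]
  let f : DihedralGroup n →* X :=
    { toFun := fun x => match x with
        | .r i => g' i
        | .sr i => s * g' i
      map_one' := by
        change g' 0 = 1
        simp [g']
      map_mul' := by
        rintro (i | i) (j | j)
        · exact hadd i j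
        · change s * g' (j - i) = g' i * (s * g' j)
          rw [hsub, ← mul_assoc (g' i), hconj, mul_assoc]
          congr 1
          rw [mul_inv_eq_iff_eq_mul, mul_assoc, hcomm j i, inv_mul_cancel_left]
        · change s * g' (i + j) = s * g' i * g' j
          rw [hadd, mul_assoc]
        · change g' (j - i) = s * g' i * (s * g' j)
          rw [hsub, mul_assoc, ← mul_assoc (g' i), hconj, ← mul_assoc, ← mul_assoc, hs, one_mul,
            mul_inv_eq_iff_eq_mul, mul_assoc, hcomm j i, inv_mul_cancel_left] }
  have hf : Function.Injective f := by
    rw [injective_iff_map_eq_one]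
    rintro (i | i) hi
    · obtain ⟨k, rfl⟩ := hex i
      change g' k = 1 at hi
      rw [hz, ← orderOf_dvd_iff_zpow_eq_one, hr] at hi
      rw [(ZMod.intCast_zmod_eq_zero_iff_dvd k n).2 hi]; rfl
    · obtain ⟨k, rfl⟩ := hex i
      change s * g' k = 1 at hi
      rw [hz, mul_eq_one_iff_eq_inv, ← zpow_neg] at hi
      exact absurd ⟨-k, hi.symm⟩ hsr
  refine ⟨(MulEquiv.ofBijective f ((Nat.bijective_iff_injective_and_card f).2 ⟨hf, ?_⟩)).symm⟩
  rw [DihedralGroup.nat_card, hX]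

namespace DihedralCyclic

variable {X : Type*} [Group X] [Finite X] {a b c : X}

section
variable (h : DihedralCyclic a b c)
include h

omit [Finite X] in
theorem mulEquiv_zmod_two (ha : orderOf a = 1) (hc : orderOf c = 1) :
    Nonempty (X ≃* Multiplicative (ZMod 2)) := by
  have : Fact (Nat.Prime 2) := ⟨Nat.prime_two⟩
  refine ⟨mulEquivOfPrimeCardEq (p := 2) ?_ ?_⟩
  · rw [h.card_eq, ha, hc]
  · simp

theorem mulEquiv_dihedralGroup_four (ha : orderOf a = 2) (hc : orderOf c = 2) :
    Nonempty (X ≃* DihedralGroup 4) := by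
  have hX := h.card_eq
  rw [ha, hc] at hX
  have ha2 : a * a = 1 := by rw [← pow_two, ← ha, pow_orderOf_eq_one]
  have hc2 : c * c = 1 := by rw [← pow_two, ← hc, pow_orderOf_eq_one]
  have hai : a⁻¹ = a := inv_eq_of_mul_eq_one_left ha2
  have hci : c⁻¹ = c := inv_eq_of_mul_eq_one_left hc2
  have hnc : ¬ Commute a c := by
    intro hcomm
    have := h.rot_eq_one_of_commute (j := 1) (by rwa [zpow_one])
    rw [zpow_one, ← orderOf_eq_one_iff, ha] at this
    omega
  have hinv : c * (a * c) * c⁻¹ = (a * c)⁻¹ := by rw [mul_inv_rev, hai, hci, mul_assoc, mul_assoc,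
    hc2, mul_one]
  have hns : c ∉ Subgroup.zpowers (a * c) := by
    rintro ⟨k, hk⟩
    apply hnc
    have h1 : Commute (a * c) ((a * c) ^ k) := (Commute.refl _).zpow_right k
    simp only at hk
    rw [hk] at h1
    have h2 : Commute c⁻¹ c := (Commute.refl c).inv_left
    simpa using h1.mul_left h2
  refine nonempty_mulEquiv_dihedralGroup (r := a * c) (s := c) ?_ hc2 hinv hns (by rw [hX])
  have hp : (a * c) ^ 2 ≠ 1 := by
    intro e
    apply hnc
    rw [pow_two, mul_eq_one_iff_eq_inv, mul_inv_rev, hai, hci] at e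
    exact e
  have hdvd : orderOf (a * c) ∣ 2 ^ 3 := by
    rw [show 2 ^ 3 = 2 * 2 * 2 from rfl, ← hX]; exact orderOf_dvd_natCard _
  obtain ⟨t, ht, e⟩ := (Nat.dvd_prime_pow Nat.prime_two).1 hdvd
  interval_cases t
  · rw [pow_zero, orderOf_eq_one_iff] at e
    rw [e, one_pow] at hp
    exact absurd rfl hp
  · rw [pow_one] at e
    rw [← e, pow_orderOf_eq_one] at hp
    exact absurd rfl hp
  · exact e
  · have htop : Subgroup.zpowers (a * c) = ⊤ := by
      rw [← Subgroup.card_eq_iff_eq_top, Nat.card_zpowers, e, hX]; rfl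
    exact absurd (htop ▸ Subgroup.mem_top c) hns

variable (hcore : (Subgroup.zpowers c).normalCore = ⊥)
include hcore

theorem mulEquiv_alternatingGroup_four (ha : orderOf a = 2) (hc : orderOf c = 3) :
    Nonempty (X ≃* alternatingGroup (Fin 4)) := by
  refine nonempty_mulEquiv_alternatingGroup_of_index_eq_four (H := Subgroup.zpowers c) ?_ hcore ?_
  · rw [h.index_zpowers, ha]
  · rw [h.card_eq, ha, hc]

omit hcore in
theorem mulEquiv_perm_four_of_orderOf_eq_three (ha : orderOf a = 3) (hc : orderOf c = 4) :
    Nonempty (X ≃* Equiv.Perm (Fin 4)) := by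
  refine nonempty_mulEquiv_perm_of_index_eq_four (H := h.dihedral) ?_
    (h.normalCore_dihedral_eq_bot ?_) ?_
  · rw [h.index_dihedral, hc]
  · rw [Ne, ← orderOf_dvd_iff_pow_eq_one, ha]; decide
  · rw [h.card_eq, ha, hc]

theorem mulEquiv_perm_four_of_orderOf_eq_four (ha : orderOf a = 4) (hc : orderOf c = 3) :
    Nonempty (X ≃* Equiv.Perm (Fin 4)) := by
  have hX := h.card_eq
  rw [ha, hc] at hX
  have h3 : Fact (Nat.Prime 3) := ⟨Nat.prime_three⟩
  have hcn : ¬ (Subgroup.zpowers c).Normal := by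
    intro hn
    rw [Subgroup.normalCore_eq_self, Subgroup.zpowers_eq_bot] at hcore
    rw [hcore, orderOf_one] at hc
    omega
  set N := Subgroup.normalizer (Subgroup.zpowers c : Set X) with hN
  have hCN : Subgroup.zpowers c ≤ N := Subgroup.le_normalizer
  have hCc : Nat.card (Subgroup.zpowers c) = 3 := by rw [Nat.card_zpowers, hc]
  have hcardC : Nat.card (Subgroup.zpowers c) = 3 ^ (Nat.card X).factorization 3 := by
    rw [hCc, hX, show (2 * 4 * 3 : ℕ) = 3 ^ 1 * 8 by norm_num,
      Nat.factorization_mul (by norm_num) (by norm_num), Nat.factorization_pow]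
    simp [Nat.Prime.factorization h3.1,
      Nat.factorization_eq_zero_of_not_dvd (by norm_num : ¬ 3 ∣ 8)]
  let P : Sylow 3 X := Sylow.ofCard (Subgroup.zpowers c) hcardC
  have hP : Nat.card (Sylow 3 X) = N.index := P.card_eq_index_normalizer
  have hmod : N.index ≡ 1 [MOD 3] := by rw [← hP]; exact card_sylow_modEq_one 3 X
  have hcn3 : Nat.card N = 3 * (Subgroup.zpowers c).relIndex N := by
    rw [← Subgroup.card_mul_relIndex_of_le hCN, hCc]
  have hmul := N.card_mul_index
  rw [hcn3, hX] at hmul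
  have hne1 : N.index ≠ 1 := by
    intro e
    apply hcn
    rw [← Subgroup.normalizer_eq_top_iff]
    exact Subgroup.index_eq_one.1 e
  have hd : N.index ∣ 8 := ⟨(Subgroup.zpowers c).relIndex N, by nlinarith⟩
  have hi : N.index = 4 := by
    have hle := Nat.le_of_dvd (by norm_num) hd
    unfold Nat.ModEq at hmod
    generalize N.index = t at *
    interval_cases t <;> omega
  have hrel : (Subgroup.zpowers c).relIndex N = 2 := by rw [hi] at hmul; omega
  have hcardN : Nat.card N = 6 := by rw [hcn3, hrel]
  refine nonempty_mulEquiv_perm_of_index_eq_four hi ?_ hX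
  have hLd : Nat.card N.normalCore ∣ 6 := hcardN ▸ Subgroup.card_dvd_of_le N.normalCore_le
  have hle := Nat.le_of_dvd (by norm_num) hLd
  have hpos : 0 < Nat.card N.normalCore := Nat.card_pos
  by_contra hne
  have hodd : ¬ Odd (Nat.card N.normalCore) := fun ho => hne (h.eq_bot_of_odd_card hcore ho)
  have hcase : Nat.card N.normalCore = 2 ∨ Nat.card N.normalCore = 6 := by
    generalize Nat.card N.normalCore = t at *
    interval_cases t
    · exact absurd (by decide) hodd
    · exact Or.inl rfl
    · exact absurd (by decide) hodd
    · omega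
    · omega
    · exact Or.inr rfl
  rcases hcase with h2 | h6
  · obtain ⟨j, hj⟩ := h.exists_refl_of_ne_bot hcore hne
    obtain ⟨w, hw, z, ⟨r, rfl⟩, e⟩ := Subgroup.mem_sup_of_normal_left.1 hj
    simp only at e
    have hcent : ∀ x, x * w = w * x := by
      intro x
      obtain ⟨w0, hw0⟩ := (Nat.card_eq_two_iff' (1 : N.normalCore)).1 h2
      by_cases h1 : w = 1
      · rw [h1, mul_one, one_mul]
      · have hx := N.normalCore_normal.conj_mem w hw x
        have e1 := hw0.2 ⟨w, hw⟩ (fun e => h1 (congrArg Subtype.val e))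
        have e2 := hw0.2 ⟨x * w * x⁻¹, hx⟩ (fun e => h1 (by
          have := congrArg Subtype.val e
          simpa using this))
        have e3 := congrArg Subtype.val (e2.trans e1.symm)
        simp only at e3
        exact mul_inv_eq_iff_eq_mul.1 e3
    have hw2 : w * w = 1 := by
      have := pow_card_eq_one' (x := (⟨w, hw⟩ : N.normalCore))
      rw [h2] at this
      simpa [pow_two] using congrArg Subtype.val this
    have hcr : c ^ r = 1 := by
      have h1 := h.refl_sq j
      rw [← e] at h1
      have h2 : w * c ^ r * (w * c ^ r) = (w * w) * c ^ (2 * r) := by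
        rw [mul_assoc, ← mul_assoc (c ^ r), hcent, two_mul, zpow_add]; group
      rw [h2, hw2, one_mul, ← orderOf_dvd_iff_zpow_eq_one, hc] at h1
      rw [← orderOf_dvd_iff_zpow_eq_one, hc]
      push_cast at *
      omega
    rw [hcr, mul_one] at e
    have h4 := hcent a
    rw [e, ← mul_assoc, ← zpow_one_add] at h4
    have h5 := h.refl_mul_zpow j 1
    rw [zpow_one] at h5
    rw [h5, mul_left_inj, ← mul_inv_eq_one, ← zpow_neg, ← zpow_add,
      ← orderOf_dvd_iff_zpow_eq_one, ha] at h4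
    push_cast at h4
    omega
  · apply hcn
    have hLN : N.normalCore = N := Subgroup.eq_of_le_of_card_ge N.normalCore_le (by omega)
    refine ⟨fun x hx g => ?_⟩
    have hx' : x ∈ N.normalCore := hLN.ge (hCN hx)
    have hd := hLN.le (N.normalCore_normal.conj_mem x hx' g)
    have hdd := Subgroup.mul_self_mem_of_relIndex_eq_two hrel hd
    have hx3 : x * x * (x * x) = x := by
      have := orderOf_dvd_natCard (⟨x, hx⟩ : Subgroup.zpowers c)
      rw [hCc, orderOf_dvd_iff_pow_eq_one] at this
      have h3 : x ^ 3 = 1 := by simpa using congrArg Subtype.val this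
      calc x * x * (x * x) = x ^ 3 * x := by simp only [pow_succ, pow_zero, one_mul, mul_assoc]
        _ = x := by rw [h3, one_mul]
    have h4 := (Subgroup.zpowers c).mul_mem hdd hdd
    have h5 : g * x * g⁻¹ * (g * x * g⁻¹) * (g * x * g⁻¹ * (g * x * g⁻¹)) =
        g * (x * x * (x * x)) * g⁻¹ := by group
    rwa [h5, hx3] at h4

end

end DihedralCyclic

section
variable {X : Type*} [Group X] {a b c : X} {M : Subgroup X}

theorem Subgroup.zpow_mem_normalCore_of_cover (hconj : b * a * b⁻¹ = a⁻¹)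
    (hcover : ∀ x : X, ∃ j k : ℤ, x = a ^ j * c ^ k ∨ x = a ^ j * b * c ^ k) (hc : c ∈ M) {j : ℤ}
    (hj : a ^ j ∈ M) : a ^ j ∈ M.normalCore := by
  intro x
  have hb : b⁻¹ * a ^ j * b = (a ^ j)⁻¹ := by
    have h1 : b * (a ^ j)⁻¹ * b⁻¹ = a ^ j := by
      rw [← inv_zpow, ← conj_zpow, ← conj_inv, hconj, inv_inv]
    calc b⁻¹ * a ^ j * b = b⁻¹ * (b * (a ^ j)⁻¹ * b⁻¹) * b := by rw [h1]
      _ = (a ^ j)⁻¹ := by group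
  obtain ⟨i, k, e | e⟩ := hcover x⁻¹
  · rw [← inv_inv x, e]
    have h1 : (a ^ i * c ^ k)⁻¹ * a ^ j * (a ^ i * c ^ k)⁻¹⁻¹ = (c ^ k)⁻¹ * a ^ j * c ^ k := by
      group
    rw [h1]
    exact M.mul_mem (M.mul_mem (M.inv_mem (M.zpow_mem hc k)) hj) (M.zpow_mem hc k)
  · rw [← inv_inv x, e]
    have h1 : (a ^ i * b * c ^ k)⁻¹ * a ^ j * (a ^ i * b * c ^ k)⁻¹⁻¹ =
        (c ^ k)⁻¹ * (b⁻¹ * a ^ j * b) * c ^ k := by group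
    rw [h1, hb]
    exact M.mul_mem (M.mul_mem (M.inv_mem (M.zpow_mem hc k)) (M.inv_mem hj)) (M.zpow_mem hc k)

variable (hsq : b * b = 1) (hconj : b * a * b⁻¹ = a⁻¹)
  (hcover : ∀ x : X, ∃ j k : ℤ, x = a ^ j * c ^ k ∨ x = a ^ j * b * c ^ k)
  (hrefl : ∀ j k : ℤ, a ^ j * b ≠ c ^ k) (hc : c ∈ M)
  (hM : ∀ x ∈ M, ∃ j k : ℤ, x = a ^ j * c ^ k)

section
include hconj hcover hc hM

theorem Subgroup.le_normalCore_sup_zpowers : M ≤ M.normalCore ⊔ Subgroup.zpowers c := by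
  intro x hx
  obtain ⟨j, k, rfl⟩ := hM x hx
  have hj : a ^ j ∈ M := (M.mul_mem_cancel_right (M.zpow_mem hc k)).1 hx
  exact Subgroup.mul_mem_sup (zpow_mem_normalCore_of_cover hconj hcover hc hj) ⟨k, rfl⟩

theorem Subgroup.coe_eq_zpowers_mul_zpowers :
    (M : Set X) = (Subgroup.zpowers (a ^ orderOf (a : X ⧸ M.normalCore)) : Set X) *
      (Subgroup.zpowers c : Set X) := by
  ext x
  constructor
  · intro hx
    obtain ⟨j, k, rfl⟩ := hM x hx
    have hj : a ^ j ∈ M := (M.mul_mem_cancel_right (M.zpow_mem hc k)).1 hx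
    have hj' := zpow_mem_normalCore_of_cover hconj hcover hc hj
    rw [← QuotientGroup.eq_one_iff, QuotientGroup.mk_zpow, ← orderOf_dvd_iff_zpow_eq_one] at hj'
    obtain ⟨t, ht⟩ := hj'
    refine Set.mul_mem_mul ⟨t, ?_⟩ ⟨k, rfl⟩
    simp only
    rw [ht, zpow_mul, zpow_natCast]
  · rintro ⟨y, hy, z, hz, rfl⟩
    refine M.mul_mem ?_ ((Subgroup.zpowers_le.2 hc) hz)
    refine (Subgroup.zpowers_le.2 (M.normalCore_le ?_)) hy
    rw [← QuotientGroup.eq_one_iff, QuotientGroup.mk_pow, pow_orderOf_eq_one]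

theorem Subgroup.coe_normalCore_eq_zpowers_mul_zpowers :
    (M.normalCore : Set X) = (Subgroup.zpowers (a ^ orderOf (a : X ⧸ M.normalCore)) : Set X) *
      (Subgroup.zpowers (c ^ orderOf (c : X ⧸ M.normalCore)) : Set X) := by
  ext x
  constructor
  · intro hx
    obtain ⟨j, k, rfl⟩ := hM x (M.normalCore_le hx)
    have hj : a ^ j ∈ M := (M.mul_mem_cancel_right (M.zpow_mem hc k)).1 (M.normalCore_le hx)
    have hj' := zpow_mem_normalCore_of_cover hconj hcover hc hj
    have hk := (M.normalCore.mul_mem_cancel_left hj').1 hx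
    rw [← QuotientGroup.eq_one_iff, QuotientGroup.mk_zpow, ← orderOf_dvd_iff_zpow_eq_one] at hj' hk
    obtain ⟨t, ht⟩ := hj'
    obtain ⟨s, hs⟩ := hk
    refine Set.mul_mem_mul ⟨t, ?_⟩ ⟨s, ?_⟩
    · simp only
      rw [ht, zpow_mul, zpow_natCast]
    · simp only
      rw [hs, zpow_mul, zpow_natCast]
  · rintro ⟨y, hy, z, hz, rfl⟩
    refine M.normalCore.mul_mem ((Subgroup.zpowers_le.2 ?_) hy) ((Subgroup.zpowers_le.2 ?_) hz) <;>
      rw [← QuotientGroup.eq_one_iff, QuotientGroup.mk_pow, pow_orderOf_eq_one]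

omit hconj hcover hM in
theorem Subgroup.normalCore_zpowers_quotient_normalCore :
    (Subgroup.zpowers (c : X ⧸ M.normalCore)).normalCore = ⊥ := by
  apply normalCore_zpowers_quotient_eq_bot
  exact Subgroup.normalCore_mono
    (sup_le M.normalCore_le (Subgroup.zpowers_le.2 hc))

include hsq hrefl

theorem DihedralCyclic.quotient_normalCore
    (hmax : ∀ J : Subgroup X, c ∈ J → (∀ x ∈ J, ∃ j k : ℤ, x = a ^ j * c ^ k) → J ≤ M) :
    DihedralCyclic (a : X ⧸ M.normalCore) (b : X ⧸ M.normalCore) (c : X ⧸ M.normalCore) := by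
  refine map_mk M.normalCore hsq hconj hcover ?_ ?_ ?_
  · intro j k hx
    exact Subgroup.zpow_mem_normalCore_of_cover hconj hcover hc
      ((M.mul_mem_cancel_right (M.zpow_mem hc k)).1 (M.normalCore_le hx))
  · intro j k hx
    obtain ⟨i, l, e⟩ := hM _ (M.normalCore_le hx)
    apply hrefl (-i + j) (l - k)
    rw [zpow_add, mul_assoc, zpow_neg, inv_mul_eq_iff_eq_mul, zpow_sub, ← mul_assoc, ← e,
      mul_inv_cancel_right]
  · intro J _ hcJ hr
    refine (hmax J hcJ fun x hx => ?_).trans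
      (Subgroup.le_normalCore_sup_zpowers hconj hcover hc hM)
    obtain ⟨j, k, e | e⟩ := hcover x
    · exact ⟨j, k, e⟩
    · rw [e] at hx
      exact absurd ((J.mul_mem_cancel_right (J.zpow_mem hcJ k)).1 hx) (hr j)

end

theorem Subgroup.exists_zpow_eq_or_of_relIndex {D : Subgroup X} (hD : (zpowers a).relIndex D = 2)
    (hsq : b * b = 1) (hbD : b ∈ D) (hb : b ∉ zpowers a) {g : X} (hg : g ∈ D) :
    ∃ j : ℤ, g = a ^ j ∨ g = a ^ j * b := by
  have h1 := Subgroup.mul_mem_iff_of_index_two (H := (zpowers a).subgroupOf D) hD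
    (a := ⟨g, hg⟩) (b := ⟨b, hbD⟩)
  simp only [Subgroup.mem_subgroupOf, MulMemClass.mk_mul_mk] at h1
  by_cases hga : g ∈ zpowers a
  · obtain ⟨j, rfl⟩ := hga
    exact ⟨j, Or.inl rfl⟩
  · obtain ⟨j, hj⟩ := h1.2 (iff_of_false hga hb)
    refine ⟨j, Or.inr ?_⟩
    simp only at hj
    rw [hj, mul_assoc, hsq, mul_one]

end

/-- Theorem 1.1 for `X = D⟨c⟩`: the largest subgroup `M` with `⟨c⟩ ≤ M ⊆ ⟨a⟩⟨c⟩` is of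
the form `⟨aⁱ⟩⟨c⟩` for `i ∈ {1,2,3,4}`, and `X/M_X` is `ℤ₂`, `D₈`, `A₄` or `S₄`
according to one of five cases. -/
theorem dihedral_product_M_classification {X : Type*} [Group X] [Finite X]
    (n m : ℕ) (hn : 2 ≤ n) (hm : 2 ≤ m) (a b c : X) (D : Subgroup X)
    (hDgen : D = Subgroup.closure {a, b})
    (hoa : orderOf a = n) (hob : orderOf b = 2)
    (hrel : b * a * b⁻¹ = a⁻¹) (hcardD : Nat.card D = 2 * n)
    (hoc : orderOf c = m)
    (hint : D ⊓ Subgroup.zpowers c = ⊥)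
    (hfact : ∀ x : X, ∃ g ∈ D, ∃ k : ℤ, x = g * c ^ k)
    (M : Subgroup X)
    (hMc : Subgroup.zpowers c ≤ M)
    (hMsub : (M : Set X) ⊆ (Subgroup.zpowers a : Set X) * (Subgroup.zpowers c : Set X))
    (hMmax : ∀ M' : Subgroup X, Subgroup.zpowers c ≤ M' →
      (M' : Set X) ⊆ (Subgroup.zpowers a : Set X) * (Subgroup.zpowers c : Set X) →
      M' ≤ M) :
    ((M : Set X) = (Subgroup.zpowers a : Set X) * (Subgroup.zpowers c : Set X) ∧
      (M.normalCore : Set X) =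
        (Subgroup.zpowers a : Set X) * (Subgroup.zpowers c : Set X) ∧
      Nonempty ((X ⧸ M.normalCore) ≃* Multiplicative (ZMod 2))) ∨
    ((M : Set X) = (Subgroup.zpowers (a ^ 2) : Set X) * (Subgroup.zpowers c : Set X) ∧
      (M.normalCore : Set X) =
        (Subgroup.zpowers (a ^ 2) : Set X) * (Subgroup.zpowers (c ^ 2) : Set X) ∧
      Nonempty ((X ⧸ M.normalCore) ≃* DihedralGroup 4)) ∨
    ((M : Set X) = (Subgroup.zpowers (a ^ 2) : Set X) * (Subgroup.zpowers c : Set X) ∧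
      (M.normalCore : Set X) =
        (Subgroup.zpowers (a ^ 2) : Set X) * (Subgroup.zpowers (c ^ 3) : Set X) ∧
      Nonempty ((X ⧸ M.normalCore) ≃* alternatingGroup (Fin 4))) ∨
    ((M : Set X) = (Subgroup.zpowers (a ^ 4) : Set X) * (Subgroup.zpowers c : Set X) ∧
      (M.normalCore : Set X) =
        (Subgroup.zpowers (a ^ 4) : Set X) * (Subgroup.zpowers (c ^ 3) : Set X) ∧
      Nonempty ((X ⧸ M.normalCore) ≃* Equiv.Perm (Fin 4))) ∨
    ((M : Set X) = (Subgroup.zpowers (a ^ 3) : Set X) * (Subgroup.zpowers c : Set X) ∧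
      (M.normalCore : Set X) =
        (Subgroup.zpowers (a ^ 3) : Set X) * (Subgroup.zpowers (c ^ 4) : Set X) ∧
      Nonempty ((X ⧸ M.normalCore) ≃* Equiv.Perm (Fin 4))) := by
  have hb2 : b * b = 1 := by rw [← pow_two, ← hob, pow_orderOf_eq_one]
  have haD : a ∈ D := hDgen ▸ Subgroup.subset_closure (by simp)
  have hbD : b ∈ D := hDgen ▸ Subgroup.subset_closure (by simp)
  have hAD : Subgroup.zpowers a ≤ D := Subgroup.zpowers_le.2 haD
  have hcA : Nat.card (Subgroup.zpowers a) = n := by rw [Nat.card_zpowers, hoa]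
  have hbA : b ∉ Subgroup.zpowers a := by
    intro hb
    have hDA : D ≤ Subgroup.zpowers a := by
      rw [hDgen, Subgroup.closure_le]
      rintro x (rfl | rfl)
      · exact Subgroup.mem_zpowers x
      · exact hb
    rw [le_antisymm hDA hAD, hcA] at hcardD
    omega
  have hrel2 : (Subgroup.zpowers a).relIndex D = 2 := by
    have h1 := Subgroup.card_mul_relIndex_of_le hAD
    rw [hcA, hcardD, mul_comm] at h1
    exact Nat.eq_of_mul_eq_mul_right (by omega) h1
  have hcover : ∀ x : X, ∃ j k : ℤ, x = a ^ j * c ^ k ∨ x = a ^ j * b * c ^ k := by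
    intro x
    obtain ⟨g, hg, k, rfl⟩ := hfact x
    obtain ⟨j, rfl | rfl⟩ := Subgroup.exists_zpow_eq_or_of_relIndex hrel2 hb2 hbD hbA hg
    · exact ⟨j, k, Or.inl rfl⟩
    · exact ⟨j, k, Or.inr rfl⟩
  have hrefl : ∀ j k : ℤ, a ^ j * b ≠ c ^ k := by
    intro j k e
    have h1 : a ^ j * b ∈ D ⊓ Subgroup.zpowers c :=
      ⟨D.mul_mem (D.zpow_mem haD j) hbD, ⟨k, e.symm⟩⟩
    rw [hint, Subgroup.mem_bot, mul_eq_one_iff_inv_eq] at h1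
    exact hbA ⟨-j, by simp only; rw [← h1, zpow_neg]⟩
  have hcM : c ∈ M := hMc (Subgroup.mem_zpowers c)
  have hM : ∀ x ∈ M, ∃ j k : ℤ, x = a ^ j * c ^ k := by
    intro x hx
    obtain ⟨_, ⟨j, rfl⟩, _, ⟨k, rfl⟩, rfl⟩ := hMsub hx
    exact ⟨j, k, rfl⟩
  have hmax : ∀ J : Subgroup X, c ∈ J → (∀ x ∈ J, ∃ j k : ℤ, x = a ^ j * c ^ k) → J ≤ M := by
    intro J hcJ hJ
    refine hMmax J (Subgroup.zpowers_le.2 hcJ) fun x hx => ?_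
    obtain ⟨j, k, rfl⟩ := hJ x hx
    exact Set.mul_mem_mul ⟨j, rfl⟩ ⟨k, rfl⟩
  have hq := DihedralCyclic.quotient_normalCore hb2 hrel hcover hrefl hcM hM hmax
  have hcore := Subgroup.normalCore_zpowers_quotient_normalCore hcM
  rw [Subgroup.coe_normalCore_eq_zpowers_mul_zpowers hrel hcover hcM hM,
    Subgroup.coe_eq_zpowers_mul_zpowers hrel hcover hcM hM]
  rcases hq.admissible hcore with ⟨ha, hc⟩ | ⟨ha, hc⟩ | ⟨ha, hc⟩ | ⟨ha, hc⟩ | ⟨ha, hc⟩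
  · refine Or.inl ⟨?_, ?_, hq.mulEquiv_zmod_two ha hc⟩ <;> simp only [ha, hc, pow_one]
  · refine Or.inr (Or.inl ⟨?_, ?_, hq.mulEquiv_dihedralGroup_four ha hc⟩) <;> simp only [ha, hc]
  · refine Or.inr (Or.inr (Or.inl ⟨?_, ?_, hq.mulEquiv_alternatingGroup_four hcore ha hc⟩)) <;>
      simp only [ha, hc]
  · refine Or.inr (Or.inr (Or.inr (Or.inl ⟨?_, ?_,
      hq.mulEquiv_perm_four_of_orderOf_eq_four hcore ha hc⟩))) <;> simp only [ha, hc]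
  · refine Or.inr (Or.inr (Or.inr (Or.inr ⟨?_, ?_,
      hq.mulEquiv_perm_four_of_orderOf_eq_three ha hc⟩))) <;> simp only [ha, hc]
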